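/- If p = (ph, pv) ∈ (0,1)² satisfies κ_□(p) = ph + pv − 1 = 0, then the inhomogeneous bond percolation measure P^□_{(ph,pv)} on the square lattice has the box-crossing property. -/

import Mathlib

open MeasureTheory Set

set_option linter.unusedVariables false

namespace Perc

/-- Points of the plane. -/
abbrev Pt := ℝ × ℝ

/-- A lattice embedded in the plane, with edges indexed by `E`;
each edge is embedded as the segment between the two endpoints given by `ends`. -/
structure LatticeOn (E : Type) where
  ends : E → Pt × Pt

/-- Bond configurations. -/
abbrev Config (E : Type) := E → Bool

/-- `P` is the Bernoulli bond-percolation product measure in which edge `e`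
is open with probability `p e`, independently over edges. -/
def IsBernoulliProduct {E : Type} (p : E → ℝ) (P : Measure (Config E)) : Prop :=
  IsProbabilityMeasure P ∧
    ∀ (s : Finset E) (f : E → Bool),
      P {ω | ∀ e ∈ s, ω e = f e} =
        ∏ e ∈ s, ENNReal.ofReal (if f e then p e else 1 - p e)

/-- The union of the closed segments of the open edges. -/
def openEdgeSet {E : Type} (L : LatticeOn E) (ω : Config E) : Set Pt :=
  ⋃ e ∈ {e : E | ω e = true}, segment ℝ (L.ends e).1 (L.ends e).2

/-- There is an arc, contained in `S` and in the union of the open edges,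
with one endpoint in `A` and the other in `B`. -/
def CrossingIn {E : Type} (L : LatticeOn E) (ω : Config E) (S A B : Set Pt) : Prop :=
  ∃ γ : ℝ → Pt, ContinuousOn γ (Icc 0 1) ∧ γ 0 ∈ A ∧ γ 1 ∈ B ∧
    ∀ t ∈ Icc (0:ℝ) 1, γ t ∈ S ∩ openEdgeSet L ω

/-- Rotation of the plane by angle `θ`. -/
noncomputable def rot (θ : ℝ) (z : Pt) : Pt :=
  (Real.cos θ * z.1 - Real.sin θ * z.2, Real.sin θ * z.1 + Real.cos θ * z.2)

/-- `f` comprises a rotation and a translation. -/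
def IsRotTrans (f : Pt → Pt) : Prop := ∃ θ : ℝ, ∃ t : Pt, f = fun z => rot θ z + t

def stdRect (h l : ℝ) : Set Pt := {z | 0 ≤ z.1 ∧ z.1 ≤ h ∧ 0 ≤ z.2 ∧ z.2 ≤ l}
def leftSide (h l : ℝ) : Set Pt := {z | z.1 = 0 ∧ 0 ≤ z.2 ∧ z.2 ≤ l}
def rightSide (h l : ℝ) : Set Pt := {z | z.1 = h ∧ 0 ≤ z.2 ∧ z.2 ≤ l}
def bottomSide (h l : ℝ) : Set Pt := {z | z.2 = 0 ∧ 0 ≤ z.1 ∧ z.1 ≤ h}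
def topSide (h l : ℝ) : Set Pt := {z | z.2 = l ∧ 0 ≤ z.1 ∧ z.1 ≤ h}

/-- The box `f(stdRect h l)` (where `f` is a rotation plus translation) possesses
open crossings in both directions. -/
def HasBoxCrossings {E : Type} (L : LatticeOn E) (ω : Config E) (h l : ℝ) (f : Pt → Pt) : Prop :=
  CrossingIn L ω (f '' stdRect h l) (f '' leftSide h l) (f '' rightSide h l) ∧
  CrossingIn L ω (f '' stdRect h l) (f '' bottomSide h l) (f '' topSide h l)

/-- The box-crossing property: for every `α > 0` there is `δ > 0` such that every box
of size `αN × N` (any position and orientation) possesses open crossings with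
probability at least `δ`, for all large `N`. -/
def BoxCrossingProperty {E : Type} (L : LatticeOn E) (P : Measure (Config E)) : Prop :=
  ∀ α : ℝ, 0 < α → ∃ δ : ℝ, 0 < δ ∧ ∃ N₀ : ℕ, ∀ N : ℕ, N₀ ≤ N →
    ∀ f : Pt → Pt, IsRotTrans f →
      ENNReal.ofReal δ ≤ P {ω | HasBoxCrossings L ω (α * N) N f}

/-- Horizontal-crossing event of the box `[-m,m] × [0,n]`. -/
def Ch {E : Type} (L : LatticeOn E) (m n : ℝ) (ω : Config E) : Prop :=
  CrossingIn L ω {z | -m ≤ z.1 ∧ z.1 ≤ m ∧ 0 ≤ z.2 ∧ z.2 ≤ n}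
    {z | z.1 = -m ∧ 0 ≤ z.2 ∧ z.2 ≤ n} {z | z.1 = m ∧ 0 ≤ z.2 ∧ z.2 ≤ n}

/-- Vertical-crossing event of the box `[-m,m] × [0,n]`. -/
def Cv {E : Type} (L : LatticeOn E) (m n : ℝ) (ω : Config E) : Prop :=
  CrossingIn L ω {z | -m ≤ z.1 ∧ z.1 ≤ m ∧ 0 ≤ z.2 ∧ z.2 ≤ n}
    {z | z.2 = 0 ∧ -m ≤ z.1 ∧ z.1 ≤ m} {z | z.2 = n ∧ -m ≤ z.1 ∧ z.1 ≤ m}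

/-- `u` and `v` are the endpoints of some open edge. -/
def openAdj {E : Type} (L : LatticeOn E) (ω : Config E) (u v : Pt) : Prop :=
  ∃ e, ω e = true ∧ (L.ends e = (u, v) ∨ L.ends e = (v, u))

/-- `u` and `v` are joined by a path of open edges. -/
def openConn {E : Type} (L : LatticeOn E) (ω : Config E) : Pt → Pt → Prop :=
  Relation.ReflTransGen (openAdj L ω)

/-- The open cluster at `v`. -/
def cluster {E : Type} (L : LatticeOn E) (ω : Config E) (v : Pt) : Set Pt :=
  {u | openConn L ω v u}

/-- The vertex set of the lattice. -/
def vertexSet {E : Type} (L : LatticeOn E) : Set Pt :=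
  ⋃ e : E, {(L.ends e).1, (L.ends e).2}

/-- `v` is the endpoint of an infinite open self-avoiding path. -/
def ConnToInfinity {E : Type} (L : LatticeOn E) (ω : Config E) (v : Pt) : Prop :=
  ∃ γ : ℕ → Pt, γ 0 = v ∧ Function.Injective γ ∧ ∀ n, openAdj L ω (γ n) (γ (n + 1))

/-- Euclidean distance on the plane. -/
noncomputable def edist2 (u v : Pt) : ℝ := Real.sqrt ((u.1 - v.1) ^ 2 + (u.2 - v.2) ^ 2)

/-- `rad (C_v) ≥ r`, where `rad (C_v)` is the supremum of all `x` such that `C_v`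
meets the complement of the open Euclidean ball `v + S_x`. -/
def RadiusGE {E : Type} (L : LatticeOn E) (ω : Config E) (v : Pt) (r : ℝ) : Prop :=
  ∀ x : ℝ, x < r → ∃ u ∈ cluster L ω v, x ≤ edist2 v u

/-- `κ_□`. -/
def kappaS (a b : ℝ) : ℝ := a + b - 1
/-- `κ_△`. -/
def kappaT (a b c : ℝ) : ℝ := a + b + c - a * b * c - 1
/-- `κ_⬡`. -/
def kappaH (a b c : ℝ) : ℝ := -kappaT (1 - a) (1 - b) (1 - c)

/-- Edges of a square-type lattice: `(a, b, true)` is the `horizontal`-class edge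
at `(a,b)` and `(a, b, false)` the `vertical`-class edge at `(a,b)`. -/
abbrev SqE := ℤ × ℤ × Bool
/-- Edges of the triangular lattice (also indexing the dual hexagonal edges):
`(a, b, i)` with `i = 0` horizontal, `i = 1` the right edge of an upwards pointing
triangle, `i = 2` the left edge of an upwards pointing triangle, in row `b`. -/
abbrev TriE := ℤ × ℤ × Fin 3

/-- The unit square lattice, with vertex set `ℤ²`. -/
noncomputable def sqLattice : LatticeOn SqE :=
  ⟨fun e =>
    if e.2.2 then (((e.1 : ℝ), (e.2.1 : ℝ)), ((e.1 : ℝ) + 1, (e.2.1 : ℝ)))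
    else (((e.1 : ℝ), (e.2.1 : ℝ)), ((e.1 : ℝ), (e.2.1 : ℝ) + 1))⟩

/-- The dual of the unit square lattice (shifted by `(1/2, 1/2)`), with each dual edge
indexed by the primal edge it crosses. -/
noncomputable def sqDualLattice : LatticeOn SqE :=
  ⟨fun e =>
    if e.2.2 then
      (((e.1 : ℝ) + 1 / 2, (e.2.1 : ℝ) - 1 / 2), ((e.1 : ℝ) + 1 / 2, (e.2.1 : ℝ) + 1 / 2))
    else
      (((e.1 : ℝ) - 1 / 2, (e.2.1 : ℝ) + 1 / 2), ((e.1 : ℝ) + 1 / 2, (e.2.1 : ℝ) + 1 / 2))⟩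

/-- Vertices of the triangular lattice (equilateral triangles of side `√3`,
one family of edges horizontal). -/
noncomputable def tv (a b : ℤ) : Pt :=
  (Real.sqrt 3 * ((a : ℝ) + (b : ℝ) / 2), 3 / 2 * (b : ℝ))

/-- The triangular lattice. -/
noncomputable def triLattice : LatticeOn TriE :=
  ⟨fun e =>
    if e.2.2 = 0 then (tv e.1 e.2.1, tv (e.1 + 1) e.2.1)
    else if e.2.2 = 1 then (tv (e.1 + 1) e.2.1, tv e.1 (e.2.1 + 1))
    else (tv e.1 e.2.1, tv e.1 (e.2.1 + 1))⟩

/-- Circumcentre of the upwards pointing triangle with base vertex `tv a b`. -/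
noncomputable def hup (a b : ℤ) : Pt :=
  (Real.sqrt 3 * ((a : ℝ) + ((b : ℝ) + 1) / 2), 3 / 2 * (b : ℝ) + 1 / 2)

/-- Circumcentre of the downwards pointing triangle below the edge `tv a b – tv (a+1) b`. -/
noncomputable def hdown (a b : ℤ) : Pt :=
  (Real.sqrt 3 * ((a : ℝ) + ((b : ℝ) + 1) / 2), 3 / 2 * (b : ℝ) - 1 / 2)

/-- The hexagonal lattice, the planar dual of `triLattice`, with vertices at the
circumcentres of the triangles; each hexagonal edge is indexed by the triangular
edge it crosses. -/
noncomputable def hexLattice : LatticeOn TriE :=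
  ⟨fun e =>
    if e.2.2 = 0 then (hdown e.1 e.2.1, hup e.1 e.2.1)
    else if e.2.2 = 1 then (hup e.1 e.2.1, hdown e.1 (e.2.1 + 1))
    else (hup e.1 e.2.1, hdown (e.1 - 1) (e.2.1 + 1))⟩

/-- The square lattice with horizontal edges of length `√3` and vertical edges of
length `1` (as in the mixed lattices). -/
noncomputable def sqStretch : LatticeOn SqE :=
  ⟨fun e =>
    if e.2.2 then
      ((Real.sqrt 3 * (e.1 : ℝ), (e.2.1 : ℝ)), (Real.sqrt 3 * ((e.1 : ℝ) + 1), (e.2.1 : ℝ)))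
    else ((Real.sqrt 3 * (e.1 : ℝ), (e.2.1 : ℝ)), (Real.sqrt 3 * (e.1 : ℝ), (e.2.1 : ℝ) + 1))⟩

/-- Vertices of the square lattice rotated by `π/4`. -/
noncomputable def rv (a b : ℤ) : Pt :=
  (((a : ℝ) - (b : ℝ)) / Real.sqrt 2, ((a : ℝ) + (b : ℝ)) / Real.sqrt 2)

/-- The square lattice rotated by `π/4`: edges `(a,b,true)` are inclined at angle `π/4`
and edges `(a,b,false)` at angle `3π/4`; the row (height) of such an edge is `a + b`. -/
noncomputable def rsqLattice : LatticeOn SqE :=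
  ⟨fun e =>
    if e.2.2 then (rv e.1 e.2.1, rv (e.1 + 1) e.2.1)
    else (rv e.1 e.2.1, rv e.1 (e.2.1 + 1))⟩

/-- Inhomogeneous intensities on the square lattice: `ph` on horizontal edges,
`pv` on vertical ones. -/
def sqInt (ph pv : ℝ) : SqE → ℝ := fun e => if e.2.2 then ph else pv

/-- Inhomogeneous intensities on the triangular (or hexagonal) lattice:
`p0` on class-0 edges, `p1` on class-1, `p2` on class-2. -/
def triInt (p0 p1 p2 : ℝ) : TriE → ℝ := fun e => ![p0, p1, p2] e.2.2

/-- Highly inhomogeneous intensities on the triangular (or hexagonal) lattice: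
`p` on horizontal-class edges, `q n` on right edges of upwards pointing triangles at
height `n`, `q' n` on left edges of upwards pointing triangles at height `n`. -/
def triHI (p : ℝ) (q q' : ℤ → ℝ) : TriE → ℝ := fun e =>
  if e.2.2 = 0 then p else if e.2.2 = 1 then q e.2.1 else q' e.2.1

/-- Highly inhomogeneous intensities on the rotated square lattice: `q n` on edges
inclined at `π/4` at height `n`, `q' n` on edges inclined at `3π/4` at height `n`. -/
def rsqHI (q q' : ℤ → ℝ) : SqE → ℝ := fun e =>
  if e.2.2 then q (e.1 + e.2.1) else q' (e.1 + e.2.1)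

section FiniteExpectation

variable {E : Type} [DecidableEq E]

/-- Expectation of `f` when the edges of the list `l` are resampled independently, and the
other edges are kept as in the given configuration. -/
noncomputable def resample (p : E → ℝ) : List E → (Config E → ℝ) → Config E → ℝ
  | [], f, ω => f ω
  | e :: l, f, ω =>
      p e * resample p l f (Function.update ω e true) +
        (1 - p e) * resample p l f (Function.update ω e false)

/-- `A` depends only on the edges in `s`. -/
def DepOn (s : Set E) (A : Set (Config E)) : Prop :=
  ∀ ω ω' : Config E, (∀ e ∈ s, ω e = ω' e) → (ω ∈ A ↔ ω' ∈ A)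

/-- `f` depends only on the edges in `s`. -/
def FunDepOn (s : Set E) (f : Config E → ℝ) : Prop :=
  ∀ ω ω' : Config E, (∀ e ∈ s, ω e = ω' e) → f ω = f ω'

/-- Monotone functions of configurations. -/
def FunIncr (f : Config E → ℝ) : Prop :=
  ∀ ω ω' : Config E, (∀ e, ω e = true → ω' e = true) → f ω ≤ f ω'

lemma resample_funIncr {p : E → ℝ} (hp : ∀ e, p e ∈ Icc (0 : ℝ) 1) (l : List E)
    {f : Config E → ℝ} (h : FunIncr f) : FunIncr (resample p l f) := by
  induction l with
  | nil => exact h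
  | cons e l ih =>
    intro ω ω' hh
    simp only [resample]
    have h1 := hp e
    have h2 : ∀ b, resample p l f (Function.update ω e b) ≤
        resample p l f (Function.update ω' e b) := by
      intro b
      apply ih
      intro e'
      by_cases he : e' = e
      · subst he; simp
      · simpa [he] using hh e'
    have := h2 true
    have := h2 false
    have := sub_nonneg.2 h1.2
    have := h1.1
    gcongr

lemma resample_harris {p : E → ℝ} (hp : ∀ e, p e ∈ Icc (0 : ℝ) 1) (l : List E)
    {f g : Config E → ℝ} (hf : FunIncr f) (hg : FunIncr g) (ω : Config E) :
    resample p l f ω * resample p l g ω ≤ resample p l (fun ω => f ω * g ω) ω := by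
  induction l generalizing ω with
  | nil => exact le_rfl
  | cons e l ih =>
    simp only [resample]
    have h1 := hp e
    have hle : ∀ ω : Config E, ∀ e', Function.update ω e false e' = true →
        Function.update ω e true e' = true := by
      intro ω e'
      by_cases he : e' = e
      · subst he; simp
      · simp [he]
    have a := resample_funIncr hp l hf _ _ (hle ω)
    have b := resample_funIncr hp l hg _ _ (hle ω)
    have c := ih (Function.update ω e true)
    have d := ih (Function.update ω e false)
    have q := sub_nonneg.2 h1.2
    have q' := h1.1
    have k1 := mul_le_mul_of_nonneg_left c q'
    have k2 := mul_le_mul_of_nonneg_left d q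
    have k3 := mul_nonneg (mul_nonneg q' q) (mul_nonneg (sub_nonneg.2 a) (sub_nonneg.2 b))
    nlinarith

lemma resample_funDepOn {p : E → ℝ} (l : List E) {s : Set E} {f : Config E → ℝ}
    (hf : FunDepOn s f) : FunDepOn (s \ {e | e ∈ l}) (resample p l f) := by
  induction l with
  | nil => simpa [resample] using hf
  | cons e l ih =>
    intro ω ω' hh
    have h2 : ∀ b, resample p l f (Function.update ω e b) =
        resample p l f (Function.update ω' e b) := by
      intro b
      apply ih
      intro e' he'
      by_cases h : e' = e
      · subst h; simp
      · simp only [ne_eq, h, not_false_eq_true, Function.update_of_ne]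
        apply hh
        exact ⟨he'.1, by simpa [h] using he'.2⟩
    simp only [resample, h2]

lemma resample_indep {p : E → ℝ} (l : List E) {s t : Set E} (hst : Disjoint s t)
    {f g : Config E → ℝ} (hf : FunDepOn s f) (hg : FunDepOn t g) (ω : Config E) :
    resample p l (fun ω => f ω * g ω) ω = resample p l f ω * resample p l g ω := by
  induction l generalizing ω with
  | nil => rfl
  | cons e l ih =>
    simp only [resample, ih]
    by_cases he : e ∈ s
    · have : e ∉ t := fun h => Set.disjoint_left.1 hst he h
      have h2 : resample p l g (Function.update ω e true) =
          resample p l g (Function.update ω e false) := by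
        apply resample_funDepOn l hg
        intro e' he'
        have : e' ≠ e := by rintro rfl; exact this he'.1
        simp [this]
      rw [h2]; ring
    · have h2 : resample p l f (Function.update ω e true) =
          resample p l f (Function.update ω e false) := by
        apply resample_funDepOn l hf
        intro e' he'
        have : e' ≠ e := by rintro rfl; exact he he'.1
        simp [this]
      rw [h2]; ring

end FiniteExpectation

section BernoulliMeasure

variable {E : Type} {p : E → ℝ} {P : Measure (Config E)}

/-- Events depending on finitely many edges. -/
def IsLocal (A : Set (Config E)) : Prop := ∃ s : Finset E, DepOn (s : Set E) A

/-- Increasing events. -/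
def IsIncr (A : Set (Config E)) : Prop :=
  ∀ ω ω' : Config E, (∀ e, ω e = true → ω' e = true) → ω ∈ A → ω' ∈ A

/-- Decreasing events. -/
def IsDecr (A : Set (Config E)) : Prop :=
  ∀ ω ω' : Config E, (∀ e, ω e = true → ω' e = true) → ω' ∈ A → ω ∈ A

lemma IsIncr.compl {A : Set (Config E)} (h : IsIncr A) : IsDecr Aᶜ :=
  fun ω ω' hh hA hA' => hA (h ω ω' hh hA')

lemma IsDecr.compl {A : Set (Config E)} (h : IsDecr A) : IsIncr Aᶜ :=
  fun ω ω' hh hA hA' => hA (h ω ω' hh hA')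

lemma IsIncr.inter {A B : Set (Config E)} (h : IsIncr A) (h' : IsIncr B) : IsIncr (A ∩ B) :=
  fun ω ω' hh hA => ⟨h ω ω' hh hA.1, h' ω ω' hh hA.2⟩

lemma IsDecr.inter {A B : Set (Config E)} (h : IsDecr A) (h' : IsDecr B) : IsDecr (A ∩ B) :=
  fun ω ω' hh hA => ⟨h ω ω' hh hA.1, h' ω ω' hh hA.2⟩

lemma DepOn.mono {s t : Set E} {A : Set (Config E)} (h : DepOn s A) (hst : s ⊆ t) :
    DepOn t A := fun ω ω' hh => h ω ω' fun e he => hh e (hst he)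

lemma DepOn.compl {s : Set E} {A : Set (Config E)} (h : DepOn s A) : DepOn s Aᶜ :=
  fun ω ω' hh => not_congr (h ω ω' hh)

lemma DepOn.inter {s : Set E} {A B : Set (Config E)} (h : DepOn s A) (h' : DepOn s B) :
    DepOn s (A ∩ B) := fun ω ω' hh => and_congr (h ω ω' hh) (h' ω ω' hh)

lemma DepOn.union {s : Set E} {A B : Set (Config E)} (h : DepOn s A) (h' : DepOn s B) :
    DepOn s (A ∪ B) := fun ω ω' hh => or_congr (h ω ω' hh) (h' ω ω' hh)

lemma IsLocal.of_finite {s : Set E} (hs : s.Finite) {A : Set (Config E)} (h : DepOn s A) :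
    IsLocal A := ⟨hs.toFinset, by simpa using h⟩

lemma IsLocal.compl {A : Set (Config E)} (h : IsLocal A) : IsLocal Aᶜ :=
  ⟨h.choose, h.choose_spec.compl⟩

lemma IsLocal.common {A B : Set (Config E)} (h : IsLocal A) (h' : IsLocal B) :
    ∃ s : Finset E, DepOn (s : Set E) A ∧ DepOn (s : Set E) B := by
  classical
  obtain ⟨s, hs⟩ := h
  obtain ⟨t, ht⟩ := h'
  exact ⟨s ∪ t, hs.mono (by simp), ht.mono (by simp)⟩

lemma IsLocal.inter {A B : Set (Config E)} (h : IsLocal A) (h' : IsLocal B) :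
    IsLocal (A ∩ B) := by
  obtain ⟨s, h1, h2⟩ := h.common h'
  exact ⟨s, h1.inter h2⟩

lemma IsLocal.union {A B : Set (Config E)} (h : IsLocal A) (h' : IsLocal B) :
    IsLocal (A ∪ B) := by
  obtain ⟨s, h1, h2⟩ := h.common h'
  exact ⟨s, h1.union h2⟩

lemma isLocal_univ : IsLocal (univ : Set (Config E)) := ⟨∅, fun _ _ _ => Iff.rfl⟩

lemma isLocal_biInter {ι : Type*} (s : Finset ι) {A : ι → Set (Config E)}
    (h : ∀ i ∈ s, IsLocal (A i)) : IsLocal (⋂ i ∈ s, A i) := by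
  classical
  induction s using Finset.induction_on with
  | empty => simpa using isLocal_univ
  | insert a s ha ih =>
    rw [Finset.set_biInter_insert]
    exact (h a (by simp)).inter (ih fun i hi => h i (by simp [hi]))

lemma measurableSet_cylinder (s : Finset E) (f : Config E) :
    MeasurableSet {ω : Config E | ∀ e ∈ s, ω e = f e} := by
  have : {ω : Config E | ∀ e ∈ s, ω e = f e} = ⋂ e ∈ s, (fun ω => ω e) ⁻¹' {f e} := by
    ext; simp
  rw [this]
  exact Finset.measurableSet_biInter s fun e _ => measurable_pi_apply e (measurableSet_singleton _)

lemma IsLocal.measurableSet {A : Set (Config E)} (h : IsLocal A) : MeasurableSet A := by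
  classical
  obtain ⟨s, hs⟩ := h
  have : A = ⋃ g ∈ {g : s → Bool | (fun e => if h : e ∈ s then g ⟨e, h⟩ else false) ∈ A},
      {ω : Config E | ∀ e ∈ s, ω e = if h : e ∈ s then g ⟨e, h⟩ else false} := by
    ext ω
    simp only [mem_ofPred_eq, mem_iUnion, exists_prop]
    constructor
    · intro hω
      refine ⟨fun e => ω e, (hs ω _ ?_).1 hω, ?_⟩ <;> intro e he
      · have : e ∈ s := by simpa using he
        simp [this]
      · simp [he]
    · rintro ⟨g, hg, hω⟩
      exact (hs ω _ (fun e he => hω e (by simpa using he))).2 hg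
  rw [this]
  exact MeasurableSet.biUnion (Set.to_countable _) fun g _ => measurableSet_cylinder s _

lemma IsBernoulliProduct.real_cylinder (hP : IsBernoulliProduct p P)
    (hp : ∀ e, p e ∈ Icc (0 : ℝ) 1) (s : Finset E) (f : E → Bool) :
    P.real {ω | ∀ e ∈ s, ω e = f e} = ∏ e ∈ s, if f e then p e else 1 - p e := by
  rw [Measure.real, hP.2, ENNReal.toReal_prod]
  refine Finset.prod_congr rfl fun e _ => ENNReal.toReal_ofReal ?_
  split_ifs
  · exact (hp e).1
  · exact sub_nonneg.2 (hp e).2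

lemma IsBernoulliProduct.real_cylinder_inter [DecidableEq E] (hP : IsBernoulliProduct p P)
    (hp : ∀ e, p e ∈ Icc (0 : ℝ) 1) (A : Set (Config E)) (l : List E) (s : Finset E)
    (ω₀ : Config E) (hl : l.Nodup) (hd : ∀ e ∈ l, e ∉ s)
    (hA : DepOn {e | e ∈ s ∨ e ∈ l} A) :
    P.real ({ω | ∀ e ∈ s, ω e = ω₀ e} ∩ A) =
      P.real {ω | ∀ e ∈ s, ω e = ω₀ e} * resample p l (A.indicator fun _ => 1) ω₀ := by
  have := hP.1
  induction l generalizing s ω₀ with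
  | nil =>
    simp only [resample]
    by_cases h : ω₀ ∈ A
    · rw [Set.inter_eq_left.2]
      · simp [h]
      · intro ω hω
        exact (hA ω ω₀ (fun e he => hω e (by simpa using he))).2 h
    · have : {ω | ∀ e ∈ s, ω e = ω₀ e} ∩ A = ∅ := by
        ext ω
        simp only [mem_inter_iff, mem_ofPred_eq, mem_empty_iff_false, iff_false, not_and]
        intro hω hA'
        exact h ((hA ω ω₀ (fun e he => hω e (by simpa using he))).1 hA')
      simp [this, h]
  | cons e l ih =>
    have hes : e ∉ s := hd e (by simp)
    rw [List.nodup_cons] at hl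
    have key : ∀ b, P.real (({ω | ∀ e ∈ s, ω e = ω₀ e} ∩ A) ∩ {ω | ω e = b}) =
        P.real {ω | ∀ e ∈ s, ω e = ω₀ e} * (if b then p e else 1 - p e) *
          resample p l (A.indicator fun _ => 1) (Function.update ω₀ e b) := by
      intro b
      have hcyl : {ω : Config E | ∀ e' ∈ insert e s, ω e' = Function.update ω₀ e b e'} =
          {ω | ∀ e ∈ s, ω e = ω₀ e} ∩ {ω | ω e = b} := by
        ext ω
        simp only [Finset.mem_insert, forall_eq_or_imp, Function.update_self, mem_ofPred_eq,
          mem_inter_iff]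
        rw [and_comm]
        refine and_congr_left fun _ => forall₂_congr fun e' he' => ?_
        have : e' ≠ e := by rintro rfl; exact hes he'
        simp [this]
      have h3 := ih (insert e s) (Function.update ω₀ e b) hl.2 (by
          intro e' he' h
          rcases Finset.mem_insert.1 h with rfl | h
          · exact hl.1 he'
          · exact hd e' (by simp [he']) h) (by
          refine hA.mono ?_
          intro e'
          simp only [mem_ofPred_eq, List.mem_cons, Finset.mem_insert]
          tauto)
      rw [real_cylinder hP hp, Finset.prod_insert hes, hcyl, Function.update_self] at h3
      rw [Set.inter_right_comm, h3, real_cylinder hP hp]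
      rw [mul_comm (if b = true then p e else 1 - p e)]
      congr 2
      refine Finset.prod_congr rfl fun e' he' => ?_
      have : e' ≠ e := by rintro rfl; exact hes he'
      simp [this]
    have hm : MeasurableSet {ω : Config E | ω e = true} := by
      simpa using measurableSet_cylinder {e} (fun _ : E => true)
    rw [← measureReal_inter_add_sdiff (s := {ω | ∀ e ∈ s, ω e = ω₀ e} ∩ A) hm, key true]
    have : ({ω | ∀ e ∈ s, ω e = ω₀ e} ∩ A) \ {ω : Config E | ω e = true} =
        ({ω | ∀ e ∈ s, ω e = ω₀ e} ∩ A) ∩ {ω : Config E | ω e = false} := by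
      ext ω; simp
    rw [this, key false]
    simp only [resample]
    simp only [if_true, Bool.false_eq_true, if_false]
    ring

lemma IsBernoulliProduct.real_eq_resample [DecidableEq E] (hP : IsBernoulliProduct p P)
    (hp : ∀ e, p e ∈ Icc (0 : ℝ) 1) {A : Set (Config E)} {l : List E} (hl : l.Nodup)
    (hA : DepOn {e | e ∈ l} A) (ω₀ : Config E) :
    P.real A = resample p l (A.indicator fun _ => 1) ω₀ := by
  have := hP.1
  have := hP.real_cylinder_inter hp A l ∅ ω₀ hl (by simp) (by simpa using hA)
  simpa using this

lemma DepOn.toList [DecidableEq E] {s : Finset E} {A : Set (Config E)}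
    (h : DepOn (s : Set E) A) : DepOn {e | e ∈ s.toList} A := by
  simpa using h

lemma IsBernoulliProduct.real_eq_of_agree {q : E → ℝ} {Q : Measure (Config E)}
    (hP : IsBernoulliProduct p P) (hp : ∀ e, p e ∈ Icc (0 : ℝ) 1)
    (hQ : IsBernoulliProduct q Q) (hq : ∀ e, q e ∈ Icc (0 : ℝ) 1) {A : Set (Config E)}
    {s : Finset E} (hA : DepOn (s : Set E) A) (h : ∀ e ∈ s, p e = q e) :
    P.real A = Q.real A := by
  classical
  rw [hP.real_eq_resample hp s.nodup_toList hA.toList fun _ => false,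
    hQ.real_eq_resample hq s.nodup_toList hA.toList fun _ => false]
  have : ∀ l : List E, (∀ e ∈ l, p e = q e) → ∀ f ω, resample p l f ω = resample q l f ω := by
    intro l hl f
    induction l with
    | nil => intro ω; rfl
    | cons e l ih =>
      intro ω
      simp only [resample, hl e (by simp), ih fun e he => hl e (by simp [he])]
  exact this _ (fun e he => h e (by simpa using he)) _ _

lemma IsBernoulliProduct.real_eq {Q : Measure (Config E)}
    (hP : IsBernoulliProduct p P) (hQ : IsBernoulliProduct p Q)
    (hp : ∀ e, p e ∈ Icc (0 : ℝ) 1) {A : Set (Config E)} (hA : IsLocal A) :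
    P.real A = Q.real A :=
  hP.real_eq_of_agree hp hQ hp hA.choose_spec fun _ _ => rfl

lemma funIncr_indicator {A : Set (Config E)} (h : IsIncr A) :
    FunIncr (A.indicator fun _ => (1 : ℝ)) := by
  classical
  intro ω ω' hh
  by_cases h1 : ω ∈ A
  · simp [h1, h ω ω' hh h1]
  · simp only [h1, not_false_eq_true, indicator_of_notMem]
    exact Set.indicator_nonneg (fun _ _ => zero_le_one) _

lemma DepOn.funDepOn {s : Set E} {A : Set (Config E)} (h : DepOn s A) :
    FunDepOn s (A.indicator fun _ => (1 : ℝ)) := by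
  classical
  intro ω ω' hh
  by_cases h1 : ω ∈ A
  · simp [h1, (h ω ω' hh).1 h1]
  · simp [h1, (h ω ω' hh).not.1 h1]

lemma indicator_inter_eq_mul (A B : Set (Config E)) :
    ((A ∩ B).indicator fun _ => (1 : ℝ)) =
      fun ω => A.indicator (fun _ => (1 : ℝ)) ω * B.indicator (fun _ => (1 : ℝ)) ω := by
  classical
  ext ω
  by_cases h1 : ω ∈ A <;> by_cases h2 : ω ∈ B <;> simp [h1, h2]

/-- The Harris inequality for increasing local events. -/
lemma IsBernoulliProduct.harris (hP : IsBernoulliProduct p P) (hp : ∀ e, p e ∈ Icc (0 : ℝ) 1)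
    {A B : Set (Config E)} (hA : IsLocal A) (hB : IsLocal B) (iA : IsIncr A) (iB : IsIncr B) :
    P.real A * P.real B ≤ P.real (A ∩ B) := by
  classical
  obtain ⟨s, h1, h2⟩ := hA.common hB
  have hn := s.nodup_toList
  rw [hP.real_eq_resample hp hn h1.toList fun _ => false,
    hP.real_eq_resample hp hn h2.toList fun _ => false,
    hP.real_eq_resample hp hn (h1.inter h2).toList fun _ => false, indicator_inter_eq_mul]
  exact resample_harris hp _ (funIncr_indicator iA) (funIncr_indicator iB) _

lemma IsBernoulliProduct.real_compl (hP : IsBernoulliProduct p P) {A : Set (Config E)}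
    (hA : IsLocal A) : P.real Aᶜ = 1 - P.real A := by
  have := hP.1
  rw [measureReal_compl hA.measurableSet]; simp

/-- The Harris inequality for decreasing local events. -/
lemma IsBernoulliProduct.harris_decr (hP : IsBernoulliProduct p P)
    (hp : ∀ e, p e ∈ Icc (0 : ℝ) 1) {A B : Set (Config E)} (hA : IsLocal A) (hB : IsLocal B)
    (iA : IsDecr A) (iB : IsDecr B) : P.real A * P.real B ≤ P.real (A ∩ B) := by
  have := hP.1
  have h := hP.harris hp hA.compl hB.compl iA.compl iB.compl
  rw [hP.real_compl hA, hP.real_compl hB, ← Set.compl_union, hP.real_compl (hA.union hB)] at h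
  have h2 := measureReal_union_add_inter (μ := P) (s := A) hB.measurableSet
  nlinarith

/-- Events depending on disjoint sets of edges are independent. -/
lemma IsBernoulliProduct.indep (hP : IsBernoulliProduct p P) (hp : ∀ e, p e ∈ Icc (0 : ℝ) 1)
    {A B : Set (Config E)} (hA : IsLocal A) (hB : IsLocal B) {s t : Set E} (hst : Disjoint s t)
    (iA : DepOn s A) (iB : DepOn t B) : P.real (A ∩ B) = P.real A * P.real B := by
  classical
  obtain ⟨u, h1, h2⟩ := hA.common hB
  have hn := u.nodup_toList
  rw [hP.real_eq_resample hp hn h1.toList fun _ => false,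
    hP.real_eq_resample hp hn h2.toList fun _ => false,
    hP.real_eq_resample hp hn (h1.inter h2).toList fun _ => false, indicator_inter_eq_mul]
  exact resample_indep _ hst iA.funDepOn iB.funDepOn _

lemma IsBernoulliProduct.harris_biInter (hP : IsBernoulliProduct p P)
    (hp : ∀ e, p e ∈ Icc (0 : ℝ) 1) {ι : Type*} (s : Finset ι) {A : ι → Set (Config E)}
    (hA : ∀ i ∈ s, IsLocal (A i)) (iA : ∀ i ∈ s, IsIncr (A i)) :
    ∏ i ∈ s, P.real (A i) ≤ P.real (⋂ i ∈ s, A i) ∧ IsIncr (⋂ i ∈ s, A i) := by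
  classical
  have := hP.1
  induction s using Finset.induction_on with
  | empty => simp [IsIncr]
  | insert a s ha ih =>
    rw [Finset.set_biInter_insert, Finset.prod_insert ha]
    obtain ⟨h1, h2⟩ := ih (fun i hi => hA i (by simp [hi])) (fun i hi => iA i (by simp [hi]))
    refine ⟨?_, (iA a (by simp)).inter h2⟩
    calc _ ≤ P.real (A a) * P.real (⋂ i ∈ s, A i) := by gcongr
      _ ≤ _ := hP.harris hp (hA a (by simp)) (isLocal_biInter s fun i hi => hA i (by simp [hi]))
        (iA a (by simp)) h2

/-- Relabelling the edges (and possibly exchanging open and closed) turns a Bernoulli product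
measure into another one. -/
lemma IsBernoulliProduct.map (hP : IsBernoulliProduct p P) {F : Type} (φ : F ↪ E) (c : Bool) :
    IsBernoulliProduct (fun e => if c then 1 - p (φ e) else p (φ e))
      (P.map fun ω e => xor c (ω (φ e))) := by
  have := hP.1
  have hm : Measurable fun (ω : Config E) (e : F) => xor c (ω (φ e)) := by
    refine measurable_pi_lambda _ fun e => ?_
    exact (measurable_from_top (f := fun b => xor c b)).comp (measurable_pi_apply (φ e))
  refine ⟨Measure.isProbabilityMeasure_map hm.aemeasurable, fun s f => ?_⟩
  rw [Measure.map_apply hm (measurableSet_cylinder s f)]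
  classical
  have h := hP.2 (s.map φ) (fun e => if h : ∃ e', φ e' = e then xor c (f h.choose) else true)
  have hch : ∀ e, (if h : ∃ e', φ e' = φ e then xor c (f h.choose) else true) = xor c (f e) := by
    intro e
    have h : ∃ e', φ e' = φ e := ⟨e, rfl⟩
    rw [dif_pos h, φ.injective h.choose_spec]
  rw [Finset.prod_map] at h
  simp only [hch] at h
  convert h using 1
  · congr 1
    ext ω
    simp only [mem_preimage, mem_ofPred_eq, Finset.mem_map, forall_exists_index, and_imp,
      forall_apply_eq_imp_iff₂, hch]
    refine forall₂_congr fun e _ => ?_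
    cases c <;> cases ω (φ e) <;> cases f e <;> simp
  · refine Finset.prod_congr rfl fun e _ => ?_
    cases c <;> cases f e <;> simp

lemma exists_isBernoulliProduct (p : E → ℝ) (hp : ∀ e, p e ∈ Icc (0 : ℝ) 1) :
    ∃ P : Measure (Config E), IsBernoulliProduct p P := by
  classical
  let μ : E → Measure Bool := fun e =>
    ENNReal.ofReal (p e) • Measure.dirac true + ENNReal.ofReal (1 - p e) • Measure.dirac false
  have hμ : ∀ e, IsProbabilityMeasure (μ e) := by
    intro e
    refine ⟨?_⟩
    simp only [μ, Measure.add_apply, Measure.smul_apply, measure_univ, smul_eq_mul, mul_one]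
    rw [← ENNReal.ofReal_add (hp e).1 (sub_nonneg.2 (hp e).2)]
    simp
  refine ⟨Measure.infinitePi μ, inferInstance, fun s f => ?_⟩
  have h := Measure.infinitePi_pi (μ := μ) (s := s) (t := fun e => {f e})
    (fun e _ => measurableSet_singleton _)
  have h2 : {ω : Config E | ∀ e ∈ s, ω e = f e} = Set.pi s fun e => {f e} := by
    ext; simp [Set.mem_pi]
  rw [h2, h]
  refine Finset.prod_congr rfl fun e _ => ?_
  cases hf : f e <;> simp [μ]

end BernoulliMeasure

section Connectivity

variable {α β : Type*}

/-- `v` can be reached from `u` by a chain of `r`-steps all of whose vertices lie in `R`. -/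
inductive Conn (r : α → α → Prop) (R : Set α) (u : α) : α → Prop
  | refl : u ∈ R → Conn r R u u
  | tail {v w : α} : Conn r R u v → r v w → w ∈ R → Conn r R u w

variable {r : α → α → Prop} {R S : Set α} {u v w : α}

lemma Conn.right_mem (h : Conn r R u v) : v ∈ R := by
  cases h <;> assumption

lemma Conn.left_mem (h : Conn r R u v) : u ∈ R := by
  induction h <;> assumption

lemma Conn.trans (h : Conn r R u v) (h' : Conn r R v w) : Conn r R u w := by
  induction h' with
  | refl _ => exact h
  | tail _ h1 h2 ih => exact ih.tail h1 h2

lemma Conn.single (h : r u v) (hu : u ∈ R) (hv : v ∈ R) : Conn r R u v :=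
  (Conn.refl hu).tail h hv

lemma Conn.head (h : r u v) (hu : u ∈ R) (h' : Conn r R v w) : Conn r R u w :=
  (Conn.single h hu h'.left_mem).trans h'

lemma Conn.symm (hr : ∀ a b, r a b → r b a) (h : Conn r R u v) : Conn r R v u := by
  induction h with
  | refl h => exact Conn.refl h
  | tail h1 h2 h3 ih => exact Conn.head (hr _ _ h2) h3 ih

lemma Conn.map {s : β → β → Prop} {T : Set β} (f : α → β) (h : Conn r R u v)
    (hf : ∀ a ∈ R, f a ∈ T) (hr : ∀ a ∈ R, ∀ b ∈ R, r a b → s (f a) (f b)) :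
    Conn s T (f u) (f v) := by
  induction h with
  | refl h => exact Conn.refl (hf _ h)
  | tail h1 h2 h3 ih => exact ih.tail (hr _ h1.right_mem _ h3 h2) (hf _ h3)

lemma Conn.mono (h : Conn r R u v) (hRS : R ⊆ S) : Conn r S u v :=
  h.map id hRS fun _ _ _ _ h => h

/-- The part of a path after its last visit to `K`. -/
lemma Conn.last_visit (h : Conn r R u v) (K : Set α) :
    Conn r (R \ K) u v ∨ ∃ w ∈ K, Conn r R u w ∧
      (w = v ∨ ∃ w', r w w' ∧ Conn r (R \ K) w' v) := by
  induction h with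
  | refl h =>
    by_cases hK : u ∈ K
    · exact Or.inr ⟨u, hK, Conn.refl h, Or.inl rfl⟩
    · exact Or.inl (Conn.refl ⟨h, hK⟩)
  | @tail x y h1 h2 h3 ih =>
    by_cases hK : y ∈ K
    · exact Or.inr ⟨y, hK, h1.tail h2 h3, Or.inl rfl⟩
    · rcases ih with ih | ⟨w, hw, h4, rfl | ⟨w', h5, h6⟩⟩
      · exact Or.inl (ih.tail h2 ⟨h3, hK⟩)
      · exact Or.inr ⟨w, hw, h4, Or.inr ⟨y, h2, Conn.refl ⟨h3, hK⟩⟩⟩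
      · exact Or.inr ⟨w, hw, h4, Or.inr ⟨w', h5, h6.tail h2 ⟨h3, hK⟩⟩⟩

/-- The part of a path before its first visit to `K`. -/
lemma Conn.first_visit (h : Conn r R u v) (K : Set α) :
    Conn r (R \ K) u v ∨ ∃ w ∈ K, Conn r R w v ∧
      (w = u ∨ ∃ w', Conn r (R \ K) u w' ∧ r w' w) := by
  induction h with
  | refl h =>
    by_cases hK : u ∈ K
    · exact Or.inr ⟨u, hK, Conn.refl h, Or.inl rfl⟩
    · exact Or.inl (Conn.refl ⟨h, hK⟩)
  | @tail x y h1 h2 h3 ih =>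
    rcases ih with ih | ⟨w, hw, h4, h5⟩
    · by_cases hK : y ∈ K
      · exact Or.inr ⟨y, hK, Conn.refl h3, Or.inr ⟨x, ih, h2⟩⟩
      · exact Or.inl (ih.tail h2 ⟨h3, hK⟩)
    · exact Or.inr ⟨w, hw, h4.tail h2 h3, h5⟩

lemma Conn.cross_lower (h : Conn r R u v) (f : α → ℤ) (hf : ∀ a ∈ R, ∀ b ∈ R, r a b → f b ≤ f a + 1)
    {a : ℤ} (hu : f u ≤ a) (hv : a ≤ f v) :
    ∃ u', f u' = a ∧ Conn r (R ∩ {x | a ≤ f x}) u' v ∧ Conn r R u u' := by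
  rcases h.last_visit {x | f x < a} with h1 | ⟨w, hw, h1, rfl | ⟨w', h2, h3⟩⟩
  · have h2 : f u = a := le_antisymm hu (by simpa using h1.left_mem.2)
    exact ⟨u, h2, h1.mono fun x hx => ⟨hx.1, by simpa using hx.2⟩, Conn.refl h.left_mem⟩
  · simp only [mem_ofPred_eq] at hw; omega
  · have h4 := h3.left_mem
    simp only [mem_sdiff, mem_ofPred_eq, not_lt] at h4 hw
    have h5 := hf w h1.right_mem w' h4.1 h2
    refine ⟨w', by omega, h3.mono fun x hx => ⟨hx.1, by simpa using hx.2⟩, h1.tail h2 h4.1⟩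

lemma Conn.cross_upper (h : Conn r R u v) (f : α → ℤ) (hf : ∀ a ∈ R, ∀ b ∈ R, r a b → f b ≤ f a + 1)
    {b : ℤ} (hu : f u ≤ b) (hv : b ≤ f v) :
    ∃ v', f v' = b ∧ Conn r (R ∩ {x | f x ≤ b}) u v' ∧ Conn r R v' v := by
  rcases h.first_visit {x | b < f x} with h1 | ⟨w, hw, h1, rfl | ⟨w', h2, h3⟩⟩
  · have h2 : f v = b := le_antisymm (by simpa using h1.right_mem.2) hv
    exact ⟨v, h2, h1.mono fun x hx => ⟨hx.1, by simpa using hx.2⟩, Conn.refl h.right_mem⟩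
  · simp only [mem_ofPred_eq] at hw; omega
  · have h4 := h2.right_mem
    simp only [mem_sdiff, mem_ofPred_eq, not_lt] at h4 hw
    have h5 := hf w' h4.1 w h1.left_mem h3
    refine ⟨w', by omega, h2.mono fun x hx => ⟨hx.1, by simpa using hx.2⟩, h1.head h3 h4.1⟩

/-- A path from below level `a` to above level `b` contains a path from level `a` to level `b`
staying between these levels. -/
lemma Conn.cross (h : Conn r R u v) (f : α → ℤ) (hf : ∀ a ∈ R, ∀ b ∈ R, r a b → f b ≤ f a + 1)
    {a b : ℤ} (hu : f u ≤ a) (hab : a ≤ b) (hv : b ≤ f v) :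
    ∃ u' v', f u' = a ∧ f v' = b ∧ Conn r (R ∩ {x | a ≤ f x ∧ f x ≤ b}) u' v' := by
  obtain ⟨u', h1, h2, -⟩ := h.cross_lower f hf hu (hab.trans hv)
  obtain ⟨v', h3, h4, -⟩ := h2.cross_upper f (fun a ha b hb => hf a ha.1 b hb.1)
    (b := b) (by omega) hv
  exact ⟨u', v', h1, h3, h4.mono fun x hx => ⟨hx.1.1, hx.1.2, hx.2⟩⟩

end Connectivity

section SquareLattice

/-- Lower-left endpoint of an edge. -/
def esrc (e : SqE) : ℤ × ℤ := (e.1, e.2.1)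

/-- Upper-right endpoint of an edge. -/
def etgt (e : SqE) : ℤ × ℤ := if e.2.2 then (e.1 + 1, e.2.1) else (e.1, e.2.1 + 1)

/-- Vertices joined by an open edge. -/
def OAdj (ω : Config SqE) (u v : ℤ × ℤ) : Prop :=
  ∃ e, ω e = true ∧ (esrc e = u ∧ etgt e = v ∨ esrc e = v ∧ etgt e = u)

/-- Nearest neighbours in the square lattice. -/
def LAdj : ℤ × ℤ → ℤ × ℤ → Prop := OAdj fun _ => true

lemma OAdj.symm {ω : Config SqE} {u v : ℤ × ℤ} (h : OAdj ω u v) : OAdj ω v u := by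
  obtain ⟨e, he, h⟩ := h
  exact ⟨e, he, h.symm⟩

lemma oAdj_iff {ω : Config SqE} {u v : ℤ × ℤ} : OAdj ω u v ↔
    (v = (u.1 + 1, u.2) ∧ ω (u.1, u.2, true) = true) ∨
    (v = (u.1, u.2 + 1) ∧ ω (u.1, u.2, false) = true) ∨
    (u = (v.1 + 1, v.2) ∧ ω (v.1, v.2, true) = true) ∨
    (u = (v.1, v.2 + 1) ∧ ω (v.1, v.2, false) = true) := by
  constructor
  · rintro ⟨⟨x, y, b⟩, he, ⟨h1, h2⟩ | ⟨h1, h2⟩⟩ <;> subst h1 <;> subst h2 <;>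
      cases b <;> simp_all [esrc, etgt]
  · rintro (⟨h, he⟩ | ⟨h, he⟩ | ⟨h, he⟩ | ⟨h, he⟩)
    · exact ⟨_, he, Or.inl ⟨rfl, by simp [etgt, h]⟩⟩
    · exact ⟨_, he, Or.inl ⟨rfl, by simp [etgt, h]⟩⟩
    · exact ⟨_, he, Or.inr ⟨rfl, by simp [etgt, h]⟩⟩
    · exact ⟨_, he, Or.inr ⟨rfl, by simp [etgt, h]⟩⟩

lemma lAdj_iff {u v : ℤ × ℤ} : LAdj u v ↔
    (v = (u.1 + 1, u.2)) ∨ (v = (u.1, u.2 + 1)) ∨ (u = (v.1 + 1, v.2)) ∨ (u = (v.1, v.2 + 1)) := by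
  simp [LAdj, oAdj_iff]

lemma OAdj.lAdj {ω : Config SqE} {u v : ℤ × ℤ} (h : OAdj ω u v) : LAdj u v := by
  obtain ⟨e, -, h⟩ := h
  exact ⟨e, rfl, h⟩

lemma LAdj.symm {u v : ℤ × ℤ} (h : LAdj u v) : LAdj v u := OAdj.symm h

lemma LAdj.fst_le {u v : ℤ × ℤ} (h : LAdj u v) : v.1 ≤ u.1 + 1 := by
  rcases lAdj_iff.1 h with h | h | h | h <;> simp [h]
  omega

lemma LAdj.snd_le {u v : ℤ × ℤ} (h : LAdj u v) : v.2 ≤ u.2 + 1 := by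
  rcases lAdj_iff.1 h with h | h | h | h <;> simp [h]
  omega

/-- The edges with both endpoints in `R`. -/
def edgesIn (R : Set (ℤ × ℤ)) : Set SqE := {e | esrc e ∈ R ∧ etgt e ∈ R}

lemma edgesIn_finite {R : Set (ℤ × ℤ)} (hR : R.Finite) : (edgesIn R).Finite := by
  refine ((hR.prod (Set.finite_univ (α := Bool))).image
    (fun z : (ℤ × ℤ) × Bool => ((z.1.1, z.1.2, z.2) : SqE))).subset ?_
  rintro ⟨x, y, b⟩ he
  exact ⟨((x, y), b), ⟨he.1, mem_univ _⟩, rfl⟩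

lemma OAdj.congr {ω ω' : Config SqE} {R : Set (ℤ × ℤ)} {u v : ℤ × ℤ}
    (h : ∀ e ∈ edgesIn R, ω e = true → ω' e = true) (hu : u ∈ R) (hv : v ∈ R)
    (huv : OAdj ω u v) : OAdj ω' u v := by
  obtain ⟨e, he, h1⟩ := huv
  refine ⟨e, h e ?_ he, h1⟩
  rcases h1 with ⟨rfl, rfl⟩ | ⟨rfl, rfl⟩ <;> exact ⟨by assumption, by assumption⟩

/-- Connection by an open path in `R`. -/
abbrev OConn (ω : Config SqE) (R : Set (ℤ × ℤ)) : ℤ × ℤ → ℤ × ℤ → Prop := Conn (OAdj ω) R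

lemma OConn.congr {ω ω' : Config SqE} {R : Set (ℤ × ℤ)} {u v : ℤ × ℤ}
    (h : ∀ e ∈ edgesIn R, ω e = true → ω' e = true) (huv : OConn ω R u v) : OConn ω' R u v :=
  Conn.map id huv (fun _ h => h) fun _ ha _ hb hab => hab.congr h ha hb

lemma OConn.lConn {ω : Config SqE} {R : Set (ℤ × ℤ)} {u v : ℤ × ℤ}
    (huv : OConn ω R u v) : Conn LAdj R u v :=
  OConn.congr (by simp) huv

lemma OConn.symm {ω : Config SqE} {R : Set (ℤ × ℤ)} {u v : ℤ × ℤ}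
    (h : OConn ω R u v) : OConn ω R v u := Conn.symm (fun _ _ h => h.symm) h

lemma OConn.cross_fst {ω : Config SqE} {R : Set (ℤ × ℤ)} {u v : ℤ × ℤ} (h : OConn ω R u v)
    {a b : ℤ} (hu : u.1 ≤ a) (hab : a ≤ b) (hv : b ≤ v.1) :
    ∃ u' v' : ℤ × ℤ, u'.1 = a ∧ v'.1 = b ∧ OConn ω (R ∩ {x | a ≤ x.1 ∧ x.1 ≤ b}) u' v' :=
  Conn.cross h Prod.fst (fun _ _ _ _ h => h.lAdj.fst_le) hu hab hv

lemma OConn.cross_snd {ω : Config SqE} {R : Set (ℤ × ℤ)} {u v : ℤ × ℤ} (h : OConn ω R u v)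
    {a b : ℤ} (hu : u.2 ≤ a) (hab : a ≤ b) (hv : b ≤ v.2) :
    ∃ u' v' : ℤ × ℤ, u'.2 = a ∧ v'.2 = b ∧ OConn ω (R ∩ {x | a ≤ x.2 ∧ x.2 ≤ b}) u' v' :=
  Conn.cross h Prod.snd (fun _ _ _ _ h => h.lAdj.snd_le) hu hab hv

/-- Lattice points of a rectangle. -/
def Box (x₀ x₁ y₀ y₁ : ℤ) : Set (ℤ × ℤ) := {v | x₀ ≤ v.1 ∧ v.1 ≤ x₁ ∧ y₀ ≤ v.2 ∧ v.2 ≤ y₁}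

lemma mem_box {x₀ x₁ y₀ y₁ : ℤ} {v : ℤ × ℤ} :
    v ∈ Box x₀ x₁ y₀ y₁ ↔ x₀ ≤ v.1 ∧ v.1 ≤ x₁ ∧ y₀ ≤ v.2 ∧ v.2 ≤ y₁ := Iff.rfl

lemma box_finite (x₀ x₁ y₀ y₁ : ℤ) : (Box x₀ x₁ y₀ y₁).Finite :=
  ((Set.finite_Icc x₀ x₁).prod (Set.finite_Icc y₀ y₁)).subset
    fun _ h => ⟨⟨h.1, h.2.1⟩, ⟨h.2.2.1, h.2.2.2⟩⟩

lemma box_mono {x₀ x₁ y₀ y₁ x₀' x₁' y₀' y₁' : ℤ} (h1 : x₀' ≤ x₀) (h2 : x₁ ≤ x₁') (h3 : y₀' ≤ y₀)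
    (h4 : y₁ ≤ y₁') : Box x₀ x₁ y₀ y₁ ⊆ Box x₀' x₁' y₀' y₁' := by
  rintro v ⟨a, b, c, d⟩
  exact ⟨by omega, by omega, by omega, by omega⟩

/-- The event that `A` and `B` are connected by an open path in `R`. -/
def ConnEvent (R A B : Set (ℤ × ℤ)) : Set (Config SqE) :=
  {ω | ∃ u ∈ A, ∃ v ∈ B, OConn ω R u v}

lemma connEvent_depOn (R A B : Set (ℤ × ℤ)) : DepOn (edgesIn R) (ConnEvent R A B) := by
  intro ω ω' h
  constructor
  · rintro ⟨u, hu, v, hv, huv⟩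
    exact ⟨u, hu, v, hv, huv.congr fun e he => by simp [h e he]⟩
  · rintro ⟨u, hu, v, hv, huv⟩
    exact ⟨u, hu, v, hv, huv.congr fun e he => by simp [h e he]⟩

lemma connEvent_isIncr (R A B : Set (ℤ × ℤ)) : IsIncr (ConnEvent R A B) := by
  rintro ω ω' h ⟨u, hu, v, hv, huv⟩
  exact ⟨u, hu, v, hv, huv.congr fun e _ => h e⟩

lemma connEvent_isLocal {R : Set (ℤ × ℤ)} (hR : R.Finite) (A B : Set (ℤ × ℤ)) :
    IsLocal (ConnEvent R A B) :=
  IsLocal.of_finite (edgesIn_finite hR) (connEvent_depOn R A B)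

/-- Left-right crossings of a rectangle. -/
def HC (x₀ x₁ y₀ y₁ : ℤ) : Set (Config SqE) :=
  ConnEvent (Box x₀ x₁ y₀ y₁) {v | v.1 = x₀} {v | v.1 = x₁}

/-- Bottom-top crossings of a rectangle. -/
def VC (x₀ x₁ y₀ y₁ : ℤ) : Set (Config SqE) :=
  ConnEvent (Box x₀ x₁ y₀ y₁) {v | v.2 = y₀} {v | v.2 = y₁}

lemma mem_HC {x₀ x₁ y₀ y₁ : ℤ} {ω : Config SqE} : ω ∈ HC x₀ x₁ y₀ y₁ ↔
    ∃ u v : ℤ × ℤ, u.1 = x₀ ∧ v.1 = x₁ ∧ OConn ω (Box x₀ x₁ y₀ y₁) u v := by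
  constructor
  · rintro ⟨u, hu, v, hv, h⟩; exact ⟨u, v, hu, hv, h⟩
  · rintro ⟨u, v, hu, hv, h⟩; exact ⟨u, hu, v, hv, h⟩

lemma mem_VC {x₀ x₁ y₀ y₁ : ℤ} {ω : Config SqE} : ω ∈ VC x₀ x₁ y₀ y₁ ↔
    ∃ u v : ℤ × ℤ, u.2 = y₀ ∧ v.2 = y₁ ∧ OConn ω (Box x₀ x₁ y₀ y₁) u v := by
  constructor
  · rintro ⟨u, hu, v, hv, h⟩; exact ⟨u, v, hu, hv, h⟩
  · rintro ⟨u, v, hu, hv, h⟩; exact ⟨u, hu, v, hv, h⟩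

lemma HC_isLocal (x₀ x₁ y₀ y₁ : ℤ) : IsLocal (HC x₀ x₁ y₀ y₁) :=
  connEvent_isLocal (box_finite _ _ _ _) _ _

lemma VC_isLocal (x₀ x₁ y₀ y₁ : ℤ) : IsLocal (VC x₀ x₁ y₀ y₁) :=
  connEvent_isLocal (box_finite _ _ _ _) _ _

lemma HC_isIncr (x₀ x₁ y₀ y₁ : ℤ) : IsIncr (HC x₀ x₁ y₀ y₁) := connEvent_isIncr _ _ _

lemma VC_isIncr (x₀ x₁ y₀ y₁ : ℤ) : IsIncr (VC x₀ x₁ y₀ y₁) := connEvent_isIncr _ _ _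

/-- Crossings of a longer and thinner rectangle contain crossings of a shorter and wider one. -/
lemma HC_subset {x₀ x₁ y₀ y₁ x₀' x₁' y₀' y₁' : ℤ} (h1 : x₀ ≤ x₀') (h2 : x₁' ≤ x₁)
    (h3 : y₀' ≤ y₀) (h4 : y₁ ≤ y₁') (h5 : x₀' ≤ x₁') : HC x₀ x₁ y₀ y₁ ⊆ HC x₀' x₁' y₀' y₁' := by
  intro ω hω
  obtain ⟨u, v, hu, hv, h⟩ := mem_HC.1 hω
  obtain ⟨u', v', hu', hv', h'⟩ := h.cross_fst (a := x₀') (b := x₁') (by omega) h5 (by omega)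
  refine mem_HC.2 ⟨u', v', hu', hv', h'.mono ?_⟩
  rintro z ⟨⟨a, b, c, d⟩, e, f⟩
  exact ⟨e, f, by omega, by omega⟩

end SquareLattice

section PlanarIntersection

lemma int_sum_Ico_succ {M : Type*} [AddCommMonoid M] {a b : ℤ} (h : a ≤ b) (f : ℤ → M) :
    ∑ i ∈ Finset.Ico a (b + 1), f i = ∑ i ∈ Finset.Ico a b, f i + f b := by
  have : Finset.Ico a (b + 1) = insert b (Finset.Ico a b) := by
    ext i; simp only [Finset.mem_Ico, Finset.mem_insert]; omega
  rw [this, Finset.sum_insert (by simp), add_comm]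

lemma zmod2_add_self (x : ZMod 2) : x + x = 0 := CharTwo.add_self_eq_zero x

lemma zmod2_telescope {a b : ℤ} (h : a ≤ b) (g : ℤ → ZMod 2) :
    ∑ i ∈ Finset.Ico a b, (g i + g (i - 1)) = g (b - 1) + g (a - 1) := by
  induction b, h using Int.leInduction with
  | base => simp [zmod2_add_self]
  | succ b hb ih =>
    rw [int_sum_Ico_succ hb, ih, add_sub_cancel_right]
    linear_combination zmod2_add_self (g (b - 1))

/-- The mod 2 chain carried by a path. -/
lemma exists_chain {A : Set (ℤ × ℤ)} {u v : ℤ × ℤ} (h : Conn LAdj A u v) :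
    ∃ κ : SqE → ZMod 2, (∀ e, e ∉ edgesIn A → κ e = 0) ∧
      ∀ x y : ℤ, κ (x, y, true) + κ (x - 1, y, true) + κ (x, y, false) + κ (x, y - 1, false) =
        (if (x, y) = u then 1 else 0) + (if (x, y) = v then 1 else 0) := by
  induction h with
  | refl h => exact ⟨fun _ => 0, by simp, by simp [zmod2_add_self]⟩
  | @tail v w h1 h2 h3 ih =>
    obtain ⟨κ, hκ, hb⟩ := ih
    obtain ⟨e, -, he⟩ := h2
    have hv := h1.right_mem
    have hin : e ∈ edgesIn A := by
      rcases he with ⟨rfl, rfl⟩ | ⟨rfl, rfl⟩ <;> exact ⟨by assumption, by assumption⟩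
    refine ⟨fun e' => κ e' + if e' = e then 1 else 0, ?_, ?_⟩
    · intro e' he'
      have : e' ≠ e := by rintro rfl; exact he' hin
      simp [hκ e' he', this]
    · intro x y
      have hbd : ((if ((x, y, true) : SqE) = e then 1 else 0) +
          (if ((x - 1, y, true) : SqE) = e then 1 else 0) +
          (if ((x, y, false) : SqE) = e then 1 else 0) +
          (if ((x, y - 1, false) : SqE) = e then 1 else 0) : ZMod 2) =
          (if (x, y) = esrc e then 1 else 0) + (if (x, y) = etgt e then 1 else 0) := by
        obtain ⟨x', y', b⟩ := e
        cases b
        · have : (x, y) = (x', y' + 1) ↔ ((x, y - 1, false) : SqE) = (x', y', false) := by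
            simp only [Prod.mk.injEq, and_true]; omega
          simp [esrc, etgt, this]
        · have : (x, y) = (x' + 1, y') ↔ ((x - 1, y, true) : SqE) = (x', y', true) := by
            simp only [Prod.mk.injEq, and_true]; omega
          simp [esrc, etgt, this]
      have h2 : ((if (x, y) = esrc e then 1 else 0) + (if (x, y) = etgt e then 1 else 0) : ZMod 2) =
          (if (x, y) = v then 1 else 0) + (if (x, y) = w then 1 else 0) := by
        rcases he with ⟨rfl, rfl⟩ | ⟨rfl, rfl⟩
        · rfl
        · exact add_comm _ _
      have h3 := hb x y
      rw [h2] at hbd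
      linear_combination h3 + hbd + zmod2_add_self (if (x, y) = v then (1 : ZMod 2) else 0)

/-- A left-right path and a bottom-top path in a rectangle have a common vertex. -/
theorem paths_meet {x₀ x₁ y₀ y₁ : ℤ} {A B : Set (ℤ × ℤ)} (hA : A ⊆ Box x₀ x₁ y₀ y₁)
    (hB : B ⊆ Box x₀ x₁ y₀ y₁) {u v b t : ℤ × ℤ} (h1 : Conn LAdj A u v) (h2 : Conn LAdj B b t)
    (hu : u.1 = x₀) (hv : v.1 = x₁) (hb : b.2 = y₀) (ht : t.2 = y₁) : (A ∩ B).Nonempty := by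
  by_contra hAB
  rw [Set.not_nonempty_iff_eq_empty] at hAB
  have hdis : ∀ z ∈ B, z ∉ A := fun z hz hz' => by
    have : z ∈ A ∩ B := ⟨hz', hz⟩
    simp [hAB] at this
  obtain ⟨κ, hκ, hbd⟩ := exists_chain h1
  have hvA := h1.right_mem
  have huA := h1.left_mem
  let H : ℤ → ℤ → ZMod 2 := fun x y => κ (x, y, true) + if (x, y) = v then 1 else 0
  let W : ℤ → ℤ → ZMod 2 := fun x y => κ (x, y, false)
  have hbdy : ∀ x y, x ≤ x₁ → H x y + H (x - 1) y =
      (W x y + W x (y - 1)) + if (x, y) = u then 1 else 0 := by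
    intro x y hx
    have h3 := hbd x y
    have h4 : (x - 1, y) ≠ v := by
      intro h; rw [← h] at hv; simp at hv; omega
    simp only [H, W, h4, if_false]
    linear_combination h3 + zmod2_add_self (if (x, y) = v then (1 : ZMod 2) else 0)
      - zmod2_add_self (κ (x, y, false)) - zmod2_add_self (κ (x, y - 1, false))
  have hHout : ∀ x y, (x, y) ∉ A → H x y = 0 := by
    intro x y hxy
    have h3 : (x, y) ≠ v := fun h => hxy (h ▸ hvA)
    simp only [H, h3, if_false, add_zero]
    exact hκ _ fun h => hxy h.1
  have hWout : ∀ x y, (x, y) ∉ A → W x y = 0 := fun x y hxy => hκ _ fun h => hxy h.1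
  have hWout' : ∀ x y, (x, y) ∉ A → W x (y - 1) = 0 := fun x y hxy => hκ _ fun h => hxy (by
    simpa [etgt] using h.2)
  let c : ℤ → ℤ → ZMod 2 := fun x y => ∑ i ∈ Finset.Ico y₀ y, H x i
  have hc : ∀ x y, x ≤ x₁ → y₀ ≤ y → c x y + c (x - 1) y =
      (W x (y - 1) + W x (y₀ - 1)) + ∑ i ∈ Finset.Ico y₀ y, if (x, i) = u then 1 else 0 := by
    intro x y hx hy
    simp only [c]
    rw [← Finset.sum_add_distrib, ← zmod2_telescope hy, ← Finset.sum_add_distrib]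
    exact Finset.sum_congr rfl fun i _ => hbdy x i hx
  have hWbot : ∀ x, W x (y₀ - 1) = 0 := fun x => hWout _ _ fun h => by
    have := (hA h).2.2.1; simp at this
  have hhor : ∀ x y, x₀ < x → x ≤ x₁ → y₀ ≤ y → (x, y) ∈ B → c (x - 1) y = c x y := by
    intro x y hx0 hx1 hy hB'
    have h3 := hc x y hx1 hy
    have h4 : ∑ i ∈ Finset.Ico y₀ y, (if (x, i) = u then (1 : ZMod 2) else 0) = 0 := by
      refine Finset.sum_eq_zero fun i _ => if_neg ?_
      rintro rfl; simp at hu; omega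
    rw [hWbot, hWout' _ _ (hdis _ hB'), h4] at h3
    linear_combination -h3 + zmod2_add_self (c (x - 1) y)
  have hconst : c t.1 t.2 = c b.1 b.2 := by
    clear ht
    induction h2 with
    | refl h => rfl
    | @tail z w h4 h5 h6 ih =>
      rw [← ih]
      have hz := h4.right_mem
      have hzB := hB hz
      have hwB := hB h6
      have hzz := hdis z hz
      have hww := hdis w h6
      clear h4 ih
      obtain ⟨z1, z2⟩ := z
      obtain ⟨w1, w2⟩ := w
      simp only [mem_box] at hzB hwB
      rcases lAdj_iff.1 h5 with h | h | h | h
      · obtain ⟨rfl, rfl⟩ := Prod.mk.inj h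
        have := hhor (z1 + 1) w2 (by omega) (by omega) (by omega) h6
        simpa using this.symm
      · obtain ⟨rfl, rfl⟩ := Prod.mk.inj h
        simp only [c]
        rw [int_sum_Ico_succ (by omega), hHout _ _ hzz, add_zero]
      · obtain ⟨rfl, rfl⟩ := Prod.mk.inj h
        have := hhor (w1 + 1) z2 (by omega) (by omega) (by omega) hz
        simpa using this
      · obtain ⟨rfl, rfl⟩ := Prod.mk.inj h
        simp only [c]
        rw [int_sum_Ico_succ (by omega), hHout _ _ hww, add_zero]
  have hbot : c b.1 b.2 = 0 := by simp [c, hb]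
  have htB := hB h2.right_mem
  have hcol : ∀ x, x₀ - 1 ≤ x → x ≤ x₁ → c x (y₁ + 1) = if x₀ ≤ x then 1 else 0 := by
    intro x hx
    induction x, hx using Int.leInduction with
    | base =>
      intro _
      simp only [c]
      rw [Finset.sum_eq_zero]
      · simp
      · intro i _
        exact hHout _ _ fun h => by have := (hA h).1; simp at this
    | succ x hx ih =>
      intro hx1
      have h3 := hc (x + 1) (y₁ + 1) hx1 (by have := htB.2.2; omega)
      rw [hWbot, hWout' _ _ (fun h => by have := (hA h).2.2.2; simp at this), add_sub_cancel_right,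
        ih (by omega)] at h3
      by_cases hxx : x₀ ≤ x
      · rw [Finset.sum_eq_zero] at h3
        · rw [if_pos (by omega)]
          rw [if_pos hxx] at h3
          linear_combination h3 - zmod2_add_self 1
        · intro i _
          apply if_neg
          rintro rfl; simp at hu; omega
      · have hx2 : x + 1 = x₀ := by omega
        rw [if_neg hxx] at h3
        rw [if_pos (by omega)]
        have huB := hA huA
        rw [Finset.sum_eq_single u.2] at h3
        · have : ((x + 1, u.2) : ℤ × ℤ) = u := by rw [hx2, ← hu]
          rw [if_pos this] at h3
          linear_combination h3
        · intro i _ hi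
          apply if_neg
          rintro rfl; exact hi rfl
        · intro h
          exact absurd (Finset.mem_Ico.2 ⟨huB.2.2.1, by have := huB.2.2.2; omega⟩) h
  have htop := hcol t.1 (by have := htB.1; omega) htB.2.1
  rw [if_pos htB.1] at htop
  have h5 : c t.1 (y₁ + 1) = c t.1 y₁ + H t.1 y₁ :=
    int_sum_Ico_succ (by have := htB.2.2; omega) _
  rw [hHout _ _ (by rw [← ht]; exact hdis t h2.right_mem), htop, add_zero, ← ht, hconst, hbot] at h5
  exact one_ne_zero h5

end PlanarIntersection

section Symmetries

lemma OAdj.relabel {ω : Config SqE} (φ : SqE → SqE) (f : ℤ × ℤ → ℤ × ℤ)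
    (h : ∀ e, (esrc (φ e) = f (esrc e) ∧ etgt (φ e) = f (etgt e)) ∨
      (esrc (φ e) = f (etgt e) ∧ etgt (φ e) = f (esrc e))) {u v : ℤ × ℤ}
    (huv : OAdj (fun e => ω (φ e)) u v) : OAdj ω (f u) (f v) := by
  obtain ⟨e, he, h1⟩ := huv
  refine ⟨φ e, he, ?_⟩
  rcases h e with ⟨h2, h3⟩ | ⟨h2, h3⟩ <;> rcases h1 with ⟨rfl, rfl⟩ | ⟨rfl, rfl⟩ <;> simp [h2, h3]

lemma OConn.relabel {ω : Config SqE} (φ : SqE → SqE) (f : ℤ × ℤ → ℤ × ℤ)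
    (h : ∀ e, (esrc (φ e) = f (esrc e) ∧ etgt (φ e) = f (etgt e)) ∨
      (esrc (φ e) = f (etgt e) ∧ etgt (φ e) = f (esrc e))) {R S : Set (ℤ × ℤ)}
    (hRS : ∀ z ∈ R, f z ∈ S) {u v : ℤ × ℤ}
    (huv : OConn (fun e => ω (φ e)) R u v) : OConn ω S (f u) (f v) :=
  Conn.map f huv hRS fun _ _ _ _ => OAdj.relabel φ f h

/-- Translation of edges. -/
def shiftE (a b : ℤ) : SqE ≃ SqE where
  toFun e := (e.1 + a, e.2.1 + b, e.2.2)
  invFun e := (e.1 - a, e.2.1 - b, e.2.2)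
  left_inv e := by simp
  right_inv e := by simp

/-- Translation of vertices. -/
def shiftV (a b : ℤ) (v : ℤ × ℤ) : ℤ × ℤ := (v.1 + a, v.2 + b)

lemma shiftE_ends (a b : ℤ) (e : SqE) :
    (esrc (shiftE a b e) = shiftV a b (esrc e) ∧ etgt (shiftE a b e) = shiftV a b (etgt e)) ∨
    (esrc (shiftE a b e) = shiftV a b (etgt e) ∧ etgt (shiftE a b e) = shiftV a b (esrc e)) := by
  obtain ⟨x, y, c⟩ := e
  left
  cases c <;> simp [esrc, etgt, shiftE, shiftV] <;> omega

/-- Reflection of edges in a vertical line. -/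
def reflXE (c : ℤ) : SqE ≃ SqE where
  toFun e := if e.2.2 then (c - e.1 - 1, e.2.1, true) else (c - e.1, e.2.1, false)
  invFun e := if e.2.2 then (c - e.1 - 1, e.2.1, true) else (c - e.1, e.2.1, false)
  left_inv := by rintro ⟨x, y, b⟩; cases b <;> simp; omega
  right_inv := by rintro ⟨x, y, b⟩; cases b <;> simp; omega

/-- Reflection of vertices in a vertical line. -/
def reflXV (c : ℤ) (v : ℤ × ℤ) : ℤ × ℤ := (c - v.1, v.2)

lemma reflXE_ends (c : ℤ) (e : SqE) :
    (esrc (reflXE c e) = reflXV c (esrc e) ∧ etgt (reflXE c e) = reflXV c (etgt e)) ∨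
    (esrc (reflXE c e) = reflXV c (etgt e) ∧ etgt (reflXE c e) = reflXV c (esrc e)) := by
  obtain ⟨x, y, b⟩ := e
  cases b
  · left; simp [esrc, etgt, reflXE, reflXV]
  · right; simp [esrc, etgt, reflXE, reflXV]; omega

/-- Reflection of edges in a horizontal line. -/
def reflYE (c : ℤ) : SqE ≃ SqE where
  toFun e := if e.2.2 then (e.1, c - e.2.1, true) else (e.1, c - e.2.1 - 1, false)
  invFun e := if e.2.2 then (e.1, c - e.2.1, true) else (e.1, c - e.2.1 - 1, false)
  left_inv := by rintro ⟨x, y, b⟩; cases b <;> simp; omega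
  right_inv := by rintro ⟨x, y, b⟩; cases b <;> simp; omega

/-- Reflection of vertices in a horizontal line. -/
def reflYV (c : ℤ) (v : ℤ × ℤ) : ℤ × ℤ := (v.1, c - v.2)

lemma reflYE_ends (c : ℤ) (e : SqE) :
    (esrc (reflYE c e) = reflYV c (esrc e) ∧ etgt (reflYE c e) = reflYV c (etgt e)) ∨
    (esrc (reflYE c e) = reflYV c (etgt e) ∧ etgt (reflYE c e) = reflYV c (esrc e)) := by
  obtain ⟨x, y, b⟩ := e
  cases b
  · right; simp [esrc, etgt, reflYE, reflYV]; omega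
  · left; simp [esrc, etgt, reflYE, reflYV]

/-- Reflection of edges in the diagonal. -/
def swapE : SqE ≃ SqE where
  toFun e := (e.2.1, e.1, !e.2.2)
  invFun e := (e.2.1, e.1, !e.2.2)
  left_inv := by rintro ⟨x, y, b⟩; simp
  right_inv := by rintro ⟨x, y, b⟩; simp

lemma swapE_ends (e : SqE) :
    (esrc (swapE e) = (esrc e).swap ∧ etgt (swapE e) = (etgt e).swap) ∨
    (esrc (swapE e) = (etgt e).swap ∧ etgt (swapE e) = (esrc e).swap) := by
  obtain ⟨x, y, b⟩ := e
  left
  cases b <;> simp [esrc, etgt, swapE]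

/-- The edge crossed by a dual edge, dual vertices `(x + 1/2, y + 1/2)` being indexed by
`(x, y)`. -/
def dualE : SqE ≃ SqE where
  toFun e := if e.2.2 then (e.1 + 1, e.2.1, false) else (e.1, e.2.1 + 1, true)
  invFun e := if e.2.2 then (e.1, e.2.1 - 1, false) else (e.1 - 1, e.2.1, true)
  left_inv := by rintro ⟨x, y, b⟩; cases b <;> simp
  right_inv := by rintro ⟨x, y, b⟩; cases b <;> simp

/-- The dual configuration. -/
def dualConfig (ω : Config SqE) : Config SqE := fun e => !ω (dualE e)

variable {p q : SqE → ℝ} {P Q : Measure (Config SqE)}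

lemma IsBernoulliProduct.real_relabel (hP : IsBernoulliProduct p P)
    (hQ : IsBernoulliProduct q Q) (hq : ∀ e, q e ∈ Icc (0 : ℝ) 1)
    (φ : SqE ≃ SqE) (c : Bool) (h : ∀ e, q e = if c then 1 - p (φ e) else p (φ e))
    {A : Set (Config SqE)} (hA : IsLocal A) :
    P.real {ω | (fun e => xor c (ω (φ e))) ∈ A} = Q.real A := by
  have h1 := hP.map φ.toEmbedding c
  have h2 : q = fun e => if c then 1 - p (φ e) else p (φ e) := funext h
  have hm : Measurable fun (ω : Config SqE) (e : SqE) => xor c (ω (φ e)) := by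
    refine measurable_pi_lambda _ fun e => ?_
    exact (measurable_from_top (f := fun b => xor c b)).comp (measurable_pi_apply (φ e))
  subst h2
  rw [hQ.real_eq h1 hq hA, Measure.real, Measure.real]
  exact congrArg ENNReal.toReal (Measure.map_apply hm hA.measurableSet).symm

lemma isLocal_relabel (φ : SqE ≃ SqE) (c : Bool) {A : Set (Config SqE)} (hA : IsLocal A) :
    IsLocal {ω | (fun e => xor c (ω (φ e))) ∈ A} := by
  obtain ⟨s, hs⟩ := hA
  refine ⟨s.map φ.toEmbedding, fun ω ω' h => hs _ _ fun e he => ?_⟩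
  have : ω (φ e) = ω' (φ e) := h _ (by simpa using he)
  simp [this]

/-- `P` is a critical bond percolation measure on the square lattice, with density `ph` on
horizontal edges. -/
structure IsCritical (ph : ℝ) (P : Measure (Config SqE)) : Prop where
  mem : ph ∈ Ioo (0 : ℝ) 1
  law : IsBernoulliProduct (sqInt ph (1 - ph)) P

lemma IsCritical.int_mem {ph : ℝ} (h : IsCritical ph P) (e : SqE) :
    sqInt ph (1 - ph) e ∈ Icc (0 : ℝ) 1 := by
  have := h.mem.1
  have := h.mem.2
  unfold sqInt
  split_ifs <;> constructor <;> linarith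

lemma IsCritical.isProbabilityMeasure {ph : ℝ} (h : IsCritical ph P) : IsProbabilityMeasure P :=
  h.law.1

/-- Probability of crossing `a` columns of edges in a strip of `b` horizontal lines. -/
noncomputable def hc (P : Measure (Config SqE)) (a b : ℤ) : ℝ := P.real (HC 0 a 0 (b - 1))

variable {ph : ℝ}

lemma IsCritical.real_relabel_self (h : IsCritical ph P) (φ : SqE ≃ SqE)
    (hφ : ∀ e, (φ e).2.2 = e.2.2) {A : Set (Config SqE)} (hA : IsLocal A) :
    P.real {ω | (fun e => ω (φ e)) ∈ A} = P.real A := by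
  have := h.law.real_relabel h.law h.int_mem φ false (by intro e; simp [sqInt, hφ]) hA
  simpa using this

lemma shiftE_snd (a b : ℤ) (e : SqE) : (shiftE a b e).2.2 = e.2.2 := rfl

lemma reflXE_snd (c : ℤ) (e : SqE) : (reflXE c e).2.2 = e.2.2 := by
  obtain ⟨x, y, b⟩ := e
  cases b <;> simp [reflXE]

lemma reflYE_snd (c : ℤ) (e : SqE) : (reflYE c e).2.2 = e.2.2 := by
  obtain ⟨x, y, b⟩ := e
  cases b <;> simp [reflYE]

lemma HC_shift (a b x₀ x₁ y₀ y₁ : ℤ) :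
    {ω : Config SqE | (fun e => ω (shiftE a b e)) ∈ HC x₀ x₁ y₀ y₁} =
      HC (x₀ + a) (x₁ + a) (y₀ + b) (y₁ + b) := by
  ext ω
  simp only [mem_ofPred_eq, mem_HC]
  constructor
  · rintro ⟨u, v, hu, hv, h⟩
    refine ⟨shiftV a b u, shiftV a b v, by simp [shiftV, hu], by simp [shiftV, hv], ?_⟩
    refine OConn.relabel (shiftE a b) _ (shiftE_ends a b) ?_ h
    intro z hz
    simp only [mem_box, shiftV] at hz ⊢
    omega
  · rintro ⟨u, v, hu, hv, h⟩
    refine ⟨shiftV (-a) (-b) u, shiftV (-a) (-b) v, by simp [shiftV, hu], by simp [shiftV, hv], ?_⟩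
    refine OConn.relabel (shiftE (-a) (-b)) _ (shiftE_ends (-a) (-b)) (R := Box (x₀ + a) (x₁ + a)
      (y₀ + b) (y₁ + b)) ?_ ?_
    · intro z hz
      simp only [mem_box, shiftV] at hz ⊢
      omega
    · convert h using 2
      simp [shiftE]

lemma VC_swap (x₀ x₁ y₀ y₁ : ℤ) :
    {ω : Config SqE | (fun e => ω (swapE e)) ∈ HC x₀ x₁ y₀ y₁} = VC y₀ y₁ x₀ x₁ := by
  ext ω
  simp only [mem_ofPred_eq, mem_HC, mem_VC]
  constructor
  · rintro ⟨u, v, hu, hv, h⟩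
    refine ⟨u.swap, v.swap, by simp [hu], by simp [hv], ?_⟩
    refine OConn.relabel swapE _ swapE_ends ?_ h
    intro z hz
    simp only [mem_box, Prod.fst_swap, Prod.snd_swap] at hz ⊢
    omega
  · rintro ⟨u, v, hu, hv, h⟩
    refine ⟨u.swap, v.swap, by simp [hu], by simp [hv], ?_⟩
    refine OConn.relabel swapE _ swapE_ends (R := Box y₀ y₁ x₀ x₁) ?_ ?_
    · intro z hz
      simp only [mem_box, Prod.fst_swap, Prod.snd_swap] at hz ⊢
      omega
    · simpa [swapE] using h

lemma IsCritical.real_HC (h : IsCritical ph P) (x₀ x₁ y₀ y₁ : ℤ) :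
    P.real (HC x₀ x₁ y₀ y₁) = hc P (x₁ - x₀) (y₁ - y₀ + 1) := by
  have h1 := h.real_relabel_self (shiftE x₀ y₀) (shiftE_snd _ _)
    (HC_isLocal 0 (x₁ - x₀) 0 (y₁ - y₀))
  rw [HC_shift] at h1
  simpa [hc] using h1

/-- Exchanging the two coordinates. -/
lemma IsCritical.exists_swap (h : IsCritical ph P) : ∃ Q, IsCritical (1 - ph) Q ∧
    ∀ x₀ x₁ y₀ y₁, Q.real (HC x₀ x₁ y₀ y₁) = P.real (VC y₀ y₁ x₀ x₁) := by
  have hm : 1 - ph ∈ Ioo (0 : ℝ) 1 := by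
    have := h.mem.1
    have := h.mem.2
    constructor <;> linarith
  have hmem : ∀ e, sqInt (1 - ph) (1 - (1 - ph)) e ∈ Icc (0 : ℝ) 1 := by
    have := hm.1
    have := hm.2
    intro e
    unfold sqInt
    split_ifs <;> constructor <;> linarith
  obtain ⟨Q, hQ⟩ := exists_isBernoulliProduct (sqInt (1 - ph) (1 - (1 - ph))) hmem
  refine ⟨Q, ⟨hm, hQ⟩, fun x₀ x₁ y₀ y₁ => ?_⟩
  have h1 := h.law.real_relabel hQ hmem swapE false (by
    rintro ⟨x, y, b⟩; cases b <;> simp [sqInt, swapE]) (HC_isLocal x₀ x₁ y₀ y₁)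
  rw [← h1, ← VC_swap]
  simp

end Symmetries

section Duality

lemma dualConfig_true (ω : Config SqE) (x y : ℤ) :
    dualConfig ω (x, y, true) = !ω (x + 1, y, false) := rfl

lemma dualConfig_false (ω : Config SqE) (x y : ℤ) :
    dualConfig ω (x, y, false) = !ω (x, y + 1, true) := rfl

open Classical in
/-- Either the primal configuration crosses a rectangle from left to right or the dual
configuration crosses the dual rectangle from bottom to top. -/
theorem HC_or_dual_VC (ω : Config SqE) {a b : ℤ} (ha : 1 ≤ a) (hb : 1 ≤ b) :
    ω ∈ HC 0 a 0 (b - 1) ∨ dualConfig ω ∈ VC 0 (a - 1) (-1) (b - 1) := by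
  by_contra hcon
  rw [not_or] at hcon
  obtain ⟨hH, hV⟩ := hcon
  let KI : Set (ℤ × ℤ) := {z | ∃ u : ℤ × ℤ, u.2 = -1 ∧
    OConn (dualConfig ω) (Box 0 (a - 1) (-1) (b - 1)) u z}
  let KK : Set (ℤ × ℤ) := {z | ∃ u : ℤ × ℤ, u.1 = 0 ∧ OConn ω (Box 0 a 0 (b - 1)) u z}
  let I : ℤ → ℤ → ZMod 2 := fun x y => if (x, y) ∈ KI then 1 else 0
  let k : ℤ → ℤ → ZMod 2 := fun x y => if (x, y) ∈ KK then 1 else 0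
  have hIb : ∀ x, 0 ≤ x → x ≤ a - 1 → I x (-1) = 1 := by
    intro x h1 h2
    exact if_pos ⟨(x, -1), rfl, Conn.refl ⟨h1, h2, le_rfl, by simp; omega⟩⟩
  have hIt : ∀ x, I x (b - 1) = 0 := by
    intro x
    refine if_neg ?_
    rintro ⟨u, hu, h⟩
    exact hV (mem_VC.2 ⟨u, _, hu, rfl, h⟩)
  have hk0 : ∀ y, 0 ≤ y → y ≤ b - 1 → k 0 y = 1 := by
    intro y h1 h2
    exact if_pos ⟨(0, y), rfl, Conn.refl ⟨le_rfl, by simp; omega, h1, h2⟩⟩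
  have hka : ∀ y, k a y = 0 := by
    intro y
    refine if_neg ?_
    rintro ⟨u, hu, h⟩
    exact hH (mem_HC.2 ⟨u, _, hu, rfl, h⟩)
  have hkey : ∀ (ω' : Config SqE) (R : Set (ℤ × ℤ)) (c : ℤ × ℤ → Prop) (z w : ℤ × ℤ), z ∈ R →
      w ∈ R → OAdj ω' z w → ((∃ u, c u ∧ OConn ω' R u z) ↔ ∃ u, c u ∧ OConn ω' R u w) := by
    intro ω' R c z w hz hw hzw
    constructor
    · rintro ⟨u, hu, h⟩; exact ⟨u, hu, h.tail hzw hw⟩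
    · rintro ⟨u, hu, h⟩; exact ⟨u, hu, h.tail hzw.symm hz⟩
  have hδh : ∀ x y, 0 ≤ x → x ≤ a - 1 → 0 ≤ y → y ≤ b - 1 → I x y + I x (y - 1) = 0 ∨
      ω (x, y, true) = true := by
    intro x y h1 h2 h3 h4
    by_cases hω : ω (x, y, true) = true
    · exact Or.inr hω
    · left
      have : (x, y - 1) ∈ KI ↔ (x, y) ∈ KI := hkey _ _ _ _ _ ⟨h1, h2, by simp; omega, by simp; omega⟩
        ⟨h1, h2, by simp; omega, h4⟩ (oAdj_iff.2 (Or.inr (Or.inl ⟨by simp, by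
          simp [dualConfig_false, hω]⟩)))
      simp only [I, this, zmod2_add_self]
  have hδv : ∀ x y, 1 ≤ x → x ≤ a - 1 → -1 ≤ y → y ≤ b - 1 → I x y + I (x - 1) y = 0 ∨
      ω (x, y, false) = true := by
    intro x y h1 h2 h3 h4
    by_cases hω : ω (x, y, false) = true
    · exact Or.inr hω
    · left
      have : (x - 1, y) ∈ KI ↔ (x, y) ∈ KI := hkey _ _ _ _ _
        ⟨by simp; omega, by simp; omega, h3, h4⟩
        ⟨by simp; omega, h2, h3, h4⟩ (oAdj_iff.2 (Or.inl ⟨by simp, by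
          simp [dualConfig_true, hω]⟩))
      simp only [I, this, zmod2_add_self]
  have hkh : ∀ x y, 0 ≤ x → x ≤ a - 1 → 0 ≤ y → y ≤ b - 1 →
      k x y * (I x y + I x (y - 1)) = k (x + 1) y * (I x y + I x (y - 1)) := by
    intro x y h1 h2 h3 h4
    rcases hδh x y h1 h2 h3 h4 with h | h
    · simp [h]
    · have : (x, y) ∈ KK ↔ (x + 1, y) ∈ KK := hkey _ _ _ _ _ ⟨h1, by simp; omega, h3, h4⟩
        ⟨by simp; omega, by simp; omega, h3, h4⟩ (oAdj_iff.2 (Or.inl ⟨rfl, h⟩))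
      simp only [k, this]
  have hkv : ∀ x y, 1 ≤ x → x ≤ a - 1 → 0 ≤ y → y ≤ b - 1 →
      k x y * (I x y + I (x - 1) y) = k x (y + 1) * (I x y + I (x - 1) y) := by
    intro x y h1 h2 h3 h4
    rcases eq_or_lt_of_le h4 with rfl | h4
    · simp [hIt]
    rcases hδv x y h1 h2 (by omega) h4.le with h | h
    · simp [h]
    · have : (x, y) ∈ KK ↔ (x, y + 1) ∈ KK := hkey _ _ _ _ _
        ⟨by simp; omega, by simp; omega, h3, h4.le⟩
        ⟨by simp; omega, by simp; omega, by simp; omega, by simp; omega⟩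
        (oAdj_iff.2 (Or.inr (Or.inl ⟨rfl, h⟩)))
      simp only [k, this]
  let n : ℤ → ZMod 2 := fun x => ∑ y ∈ Finset.Ico 0 b, k x y * (I x y + I x (y - 1))
  have hn : ∀ x, 0 ≤ x → x ≤ a - 1 → n x = 1 := by
    intro x hx
    induction x, hx using Int.leInduction with
    | base =>
      intro h
      have : n 0 = ∑ y ∈ Finset.Ico 0 b, (I 0 y + I 0 (y - 1)) := by
        refine Finset.sum_congr rfl fun y hy => ?_
        rw [Finset.mem_Ico] at hy
        rw [hk0 y hy.1 (by omega), one_mul]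
      rw [this, zmod2_telescope (by omega)]
      simp only [zero_sub]
      rw [hIt, hIb 0 le_rfl h, zero_add]
    | succ x hx ih =>
      intro hxa
      have h1 : n x = ∑ y ∈ Finset.Ico 0 b, k (x + 1) y * (I x y + I x (y - 1)) := by
        refine Finset.sum_congr rfl fun y hy => ?_
        rw [Finset.mem_Ico] at hy
        exact hkh x y hx (by omega) hy.1 (by omega)
      have h2 : n (x + 1) + n x = 0 := by
        rw [h1]
        simp only [n]
        rw [← Finset.sum_add_distrib]
        have h3 := zmod2_telescope (a := 0) (b := b) (by omega)
          fun y => k (x + 1) (y + 1) * (I (x + 1) y + I x y)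
        simp only [sub_add_cancel, zero_sub] at h3
        rw [hIt, hIt, hIb _ (by omega) hxa, hIb _ hx (by omega)] at h3
        simp only [zmod2_add_self, mul_zero] at h3
        rw [← h3]
        refine Finset.sum_congr rfl fun y hy => ?_
        rw [Finset.mem_Ico] at hy
        have h4 := hkv (x + 1) y (by omega) hxa hy.1 (by omega)
        rw [add_sub_cancel_right] at h4
        rw [← h4]
        ring
      have h3 := ih (by omega)
      linear_combination h2 - h3 - zmod2_add_self 1
  have h1 := hn (a - 1) (by omega) le_rfl
  have h2 : n (a - 1) = 0 := by
    refine Finset.sum_eq_zero fun y hy => ?_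
    rw [Finset.mem_Ico] at hy
    rw [hkh _ y (by omega) le_rfl hy.1 (by omega), sub_add_cancel, hka, zero_mul]
  rw [h1] at h2
  exact one_ne_zero h2

/-- A path and its midpoints in the doubled lattice. -/
lemma OConn.double {ω : Config SqE} {R : Set (ℤ × ℤ)} {S : Set (ℤ × ℤ)} (o : ℤ × ℤ)
    {u v : ℤ × ℤ} (h : OConn ω R u v) (h1 : ∀ z ∈ R, z + z + o ∈ S)
    (h2 : ∀ z ∈ R, ∀ w ∈ R, OAdj ω z w → z + w + o ∈ S) :
    Conn LAdj S (u + u + o) (v + v + o) := by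
  induction h with
  | refl h => exact Conn.refl (h1 _ h)
  | @tail z w h3 h4 h5 ih =>
    have h6 := h3.right_mem
    have h7 : LAdj (z + z + o) (z + w + o) ∧ LAdj (z + w + o) (w + w + o) := by
      have h8 := h4.lAdj
      rw [lAdj_iff] at h8 ⊢
      rw [lAdj_iff]
      obtain ⟨z1, z2⟩ := z
      obtain ⟨w1, w2⟩ := w
      obtain ⟨o1, o2⟩ := o
      simp only [Prod.mk_add_mk, Prod.mk.injEq] at h8 ⊢
      omega
    exact (ih.tail h7.1 (h2 _ h6 _ h5 h4)).tail h7.2 (h1 _ h5)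

/-- The primal and the dual crossing exclude each other. -/
theorem not_HC_and_dual_VC (ω : Config SqE) {a b : ℤ} (h1 : ω ∈ HC 0 a 0 (b - 1))
    (h2 : dualConfig ω ∈ VC 0 (a - 1) (-1) (b - 1)) : False := by
  obtain ⟨u, v, hu, hv, h⟩ := mem_HC.1 h1
  obtain ⟨s, t, hs, ht, h'⟩ := mem_VC.1 h2
  let A : Set (ℤ × ℤ) := {z | z ∈ Box 0 (2 * a) (-1) (2 * b - 1) ∧
    ((∃ u : ℤ × ℤ, z = u + u + (0, 0)) ∨ ∃ u v, OAdj ω u v ∧ z = u + v + (0, 0))}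
  let B : Set (ℤ × ℤ) := {z | z ∈ Box 0 (2 * a) (-1) (2 * b - 1) ∧
    ((∃ u : ℤ × ℤ, z = u + u + (1, 1)) ∨ ∃ u v, OAdj (dualConfig ω) u v ∧ z = u + v + (1, 1))}
  have hA : Conn LAdj A (u + u + (0, 0)) (v + v + (0, 0)) := by
    refine h.double (0, 0) ?_ ?_
    · intro z hz
      simp only [mem_box] at hz
      exact ⟨by simp only [mem_box, Prod.fst_add, Prod.snd_add]; omega, Or.inl ⟨z, rfl⟩⟩
    · intro z hz w hw hzw
      simp only [mem_box] at hz hw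
      exact ⟨by simp only [mem_box, Prod.fst_add, Prod.snd_add]; omega, Or.inr ⟨z, w, hzw, rfl⟩⟩
  have hB : Conn LAdj B (s + s + (1, 1)) (t + t + (1, 1)) := by
    refine h'.double (1, 1) ?_ ?_
    · intro z hz
      simp only [mem_box] at hz
      exact ⟨by simp only [mem_box, Prod.fst_add, Prod.snd_add]; omega, Or.inl ⟨z, rfl⟩⟩
    · intro z hz w hw hzw
      simp only [mem_box] at hz hw
      exact ⟨by simp only [mem_box, Prod.fst_add, Prod.snd_add]; omega, Or.inr ⟨z, w, hzw, rfl⟩⟩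
  obtain ⟨z, hzA, hzB⟩ := paths_meet (fun z hz => hz.1) (fun z hz => hz.1) hA hB
    (by simp [hu]) (by simp [hv]; omega) (by simp [hs]) (by simp [ht]; omega)
  obtain ⟨z1, z2⟩ := z
  rcases hzA.2 with ⟨⟨x, y⟩, hz⟩ | ⟨⟨x, y⟩, ⟨x', y'⟩, ho, hz⟩ <;>
  rcases hzB.2 with ⟨⟨p, q⟩, hz'⟩ | ⟨⟨p, q⟩, ⟨p', q'⟩, ho', hz'⟩ <;>
  simp only [Prod.mk_add_mk, Prod.mk.injEq] at hz hz'
  · omega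
  · have := lAdj_iff.1 ho'.lAdj
    simp only [Prod.mk.injEq] at this
    omega
  · have := lAdj_iff.1 ho.lAdj
    simp only [Prod.mk.injEq] at this
    omega
  · have key : ∀ x y : ℤ, ω (x, y + 1, true) = true → dualConfig ω (x, y, false) = true → False := by
      intro x y h1 h2
      simp [dualConfig_false, h1] at h2
    have key' : ∀ x y : ℤ, ω (x + 1, y, false) = true → dualConfig ω (x, y, true) = true → False := by
      intro x y h1 h2
      simp [dualConfig_true, h1] at h2
    rw [oAdj_iff] at ho ho'
    simp only [Prod.mk.injEq] at ho ho'
    rcases ho with ⟨⟨e1, e2⟩, e3⟩ | ⟨⟨e1, e2⟩, e3⟩ | ⟨⟨e1, e2⟩, e3⟩ | ⟨⟨e1, e2⟩, e3⟩ <;>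
    rcases ho' with ⟨⟨d1, d2⟩, d3⟩ | ⟨⟨d1, d2⟩, d3⟩ | ⟨⟨d1, d2⟩, d3⟩ | ⟨⟨d1, d2⟩, d3⟩ <;>
    first
    | omega
    | (refine key _ _ ?_ d3
       convert e3 using 2
       simp only [Prod.mk.injEq, and_true]; omega)
    | (refine key' _ _ ?_ d3
       convert e3 using 2
       simp only [Prod.mk.injEq, and_true]; omega)

variable {P : Measure (Config SqE)} {ph : ℝ}

lemma IsCritical.real_VC (h : IsCritical ph P) {x₀ x₁ y₀ y₁ : ℤ} (hx : x₀ ≤ x₁) (hy : y₀ < y₁) :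
    P.real (VC x₀ x₁ y₀ y₁) = 1 - hc P (x₁ - x₀ + 1) (y₁ - y₀) := by
  obtain ⟨Q, hQ, hPQ⟩ := h.exists_swap
  have := h.isProbabilityMeasure
  have e1 : P.real (VC x₀ x₁ y₀ y₁) = P.real (VC 0 (x₁ - x₀) (-1) (y₁ - y₀ - 1)) := by
    rw [← hPQ, ← hPQ, hQ.real_HC, hQ.real_HC]
    congr 1 <;> ring
  have e2 : {ω : Config SqE | (fun e => xor true (ω (dualE e))) ∈
      VC 0 (x₁ - x₀) (-1) (y₁ - y₀ - 1)} = (HC 0 (x₁ - x₀ + 1) 0 (y₁ - y₀ - 1))ᶜ := by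
    have hd : ∀ ω : Config SqE, (fun e => xor true (ω (dualE e))) = dualConfig ω := by
      intro ω; ext e; simp [dualConfig]
    ext ω
    simp only [mem_ofPred_eq, mem_compl_iff, hd]
    have h1 := HC_or_dual_VC ω (a := x₁ - x₀ + 1) (b := y₁ - y₀) (by omega) (by omega)
    have h2 := not_HC_and_dual_VC ω (a := x₁ - x₀ + 1) (b := y₁ - y₀)
    rw [add_sub_cancel_right] at h1 h2
    tauto
  have e3 := h.law.real_relabel h.law h.int_mem dualE true (by
    rintro ⟨x, y, b⟩; cases b <;> simp [sqInt, dualE]) (VC_isLocal 0 (x₁ - x₀) (-1) (y₁ - y₀ - 1))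
  rw [e1, ← e3, e2, h.law.real_compl (HC_isLocal _ _ _ _)]
  rfl

/-- Exchanging the two coordinates. -/
lemma IsCritical.exists_swap_hc (h : IsCritical ph P) : ∃ Q, IsCritical (1 - ph) Q ∧
    ∀ a b : ℤ, 1 ≤ a → 1 ≤ b → hc Q a b = 1 - hc P b a := by
  obtain ⟨Q, hQ, hPQ⟩ := h.exists_swap
  refine ⟨Q, hQ, fun a b ha hb => ?_⟩
  have h1 := hPQ 0 a 0 (b - 1)
  rw [h.real_VC (by omega) (by omega)] at h1
  rw [hc, h1]
  congr 2 <;> ring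

end Duality

section Barrier

/-- A set `k` that carries a barrier from the left side of `[0,a] × [0,b-1]`, extended by a
barrier separating the bottom of `[0,m] × [0, 2 * b - 1]` from its top and from the left side. -/
structure IsBarrier (a b m : ℤ) (ω : Config SqE) (k : Set (ℤ × ℤ)) : Prop where
  left : ∀ y, 0 ≤ y → y ≤ b - 1 → (0, y) ∈ k
  sub : k ⊆ Box 0 a 0 (b - 1)
  right : ∀ z ∈ k, z.1 ≠ a
  closed : ∀ z ∈ k, ∀ w ∈ Box 0 a 0 (b - 1), OAdj ω z w → w ∈ k
  block : ∀ u v : ℤ × ℤ, (u.2 = 2 * b - 1 ∨ (u.1 = 0 ∧ b ≤ u.2) ∨ (u.2 = b ∧ (u.1, b - 1) ∈ k)) →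
    v.2 = 0 → ¬ OConn ω (Box 0 m 0 (2 * b - 1) \ k) u v

/-- The event that a barrier exists. -/
def BarrierEvent (a b m : ℤ) : Set (Config SqE) := {ω | ∃ k, IsBarrier a b m ω k}

variable {a b m : ℤ} {ω : Config SqE} {k : Set (ℤ × ℤ)}

lemma IsBarrier.anti {ω' : Config SqE} (h : IsBarrier a b m ω' k) (ham : a ≤ m) (hb : 1 ≤ b)
    (hω : ∀ e ∈ edgesIn (Box 0 m 0 (2 * b - 1)), ω e = true → ω' e = true) :
    IsBarrier a b m ω k where
  left := h.left
  sub := h.sub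
  right := h.right
  closed z hz w hw hzw := h.closed z hz w hw
    (hzw.congr hω (box_mono le_rfl ham le_rfl (by omega) (h.sub hz))
      (box_mono le_rfl ham le_rfl (by omega) hw))
  block u v hu hv huv := h.block u v hu hv (huv.congr fun e he => hω e ⟨he.1.1, he.2.1⟩)

lemma barrierEvent_isDecr (ham : a ≤ m) (hb : 1 ≤ b) : IsDecr (BarrierEvent a b m) := by
  rintro ω ω' h ⟨k, hk⟩
  exact ⟨k, hk.anti ham hb fun e _ => h e⟩

lemma barrierEvent_isLocal (ham : a ≤ m) (hb : 1 ≤ b) : IsLocal (BarrierEvent a b m) := by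
  refine IsLocal.of_finite (edgesIn_finite (box_finite 0 m 0 (2 * b - 1))) ?_
  intro ω ω' h
  constructor
  · rintro ⟨k, hk⟩
    exact ⟨k, hk.anti ham hb fun e he => by simp [h e he]⟩
  · rintro ⟨k, hk⟩
    exact ⟨k, hk.anti ham hb fun e he => by simp [h e he]⟩

lemma IsBarrier.bottom_mem (h : IsBarrier a b m ω k) (hb : 1 ≤ b) (ham : a ≤ m)
    {x₀ : ℤ} {t v : ℤ × ℤ} (ht : t.2 = 2 * b - 1) (hv : v.2 = 0) (hv0 : 0 ≤ v.1)
    (htv : OConn ω (Box x₀ m 0 (2 * b - 1)) t v) : v ∈ k := by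
  by_contra hvk
  have hsub : Box x₀ m 0 (2 * b - 1) \ (k ∪ {z | z.1 < 0}) ⊆ Box 0 m 0 (2 * b - 1) \ k := by
    rintro z ⟨hz, hz'⟩
    simp only [mem_union, mem_ofPred_eq, not_or, not_lt] at hz'
    exact ⟨⟨hz'.2, hz.2⟩, hz'.1⟩
  rcases Conn.last_visit htv (k ∪ {z | z.1 < 0}) with h1 | ⟨w, hw, -, rfl | ⟨w', h1, h2⟩⟩
  · exact h.block t v (Or.inl ht) hv (h1.mono hsub)
  · simp only [mem_union, mem_ofPred_eq, hvk, false_or] at hw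
    omega
  · have h3 := Conn.mono h2 hsub
    have h4 := h3.left_mem
    have h4' := h4.1
    have hadj := lAdj_iff.1 h1.lAdj
    obtain ⟨x, y⟩ := w
    obtain ⟨x', y'⟩ := w'
    simp only [mem_box, Prod.mk.injEq] at h4' hadj
    rcases hw with hw | hw
    · have hwS := h.sub hw
      simp only [mem_box] at hwS
      have hwr := h.right _ hw
      have hnot : ¬ ((x', y') ∈ Box 0 a 0 (b - 1)) := fun hS => h4.2 (h.closed _ hw _ hS h1)
      simp only [mem_box] at hnot
      have hx : x' = x ∧ y' = b ∧ y = b - 1 := by simp at hwr; omega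
      refine h.block _ _ (Or.inr (Or.inr ⟨hx.2.1, ?_⟩)) hv h3
      simp only [hx.1]
      rw [← hx.2.2]
      exact hw
    · simp only [mem_ofPred_eq] at hw
      by_cases hy : y' ≤ b - 1
      · apply h4.2
        have := h.left y' (by omega) hy
        convert this using 2
        omega
      · exact h.block _ _ (Or.inr (Or.inl ⟨by simp; omega, by simp; omega⟩)) hv h3

/-- Two barriers, from the left and from the right, together with the absence of a crossing of
the middle rectangle, prevent crossings of the large rectangle. -/
lemma not_VC_of_barriers (hb : 1 ≤ b) (ha : 0 ≤ a) (ham : a ≤ m) (h1 : ω ∈ BarrierEvent a b m)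
    (h2 : (fun e => ω (reflXE a e)) ∈ BarrierEvent a b m) (h3 : ω ∉ VC 0 a 0 (b - 1)) :
    ω ∉ VC (a - m) m 0 (2 * b - 1) := by
  obtain ⟨k, hk⟩ := h1
  obtain ⟨l, hl⟩ := h2
  intro hVC
  obtain ⟨v, t, hv, ht, hvt⟩ := mem_VC.1 hVC
  have htv := hvt.symm
  have hrefl : (fun e => (fun e => ω (reflXE a e)) (reflXE a e)) = ω := by
    funext e
    exact congrArg ω ((reflXE a).left_inv e)
  have htv' : OConn (fun e => ω (reflXE a e)) (Box (a - m) m 0 (2 * b - 1))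
      (reflXV a t) (reflXV a v) := by
    refine OConn.relabel (reflXE a) _ (reflXE_ends a) (R := Box (a - m) m 0 (2 * b - 1)) ?_ ?_
    · intro z hz
      simp only [mem_box, reflXV] at hz ⊢
      omega
    · rw [hrefl]; exact htv
  have hvk : 0 ≤ v.1 → v ∈ k := fun h => hk.bottom_mem hb ham ht hv h htv
  have hvl : v.1 ≤ a → reflXV a v ∈ l := fun h =>
    hl.bottom_mem hb ham (by simp [reflXV, ht]) (by simp [reflXV, hv]) (by simp [reflXV, h]) htv'
  have hv2 : v ∈ k ∧ reflXV a v ∈ l := by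
    rcases le_or_gt 0 v.1 with h | h
    · have := hvk h
      exact ⟨this, hvl (hk.sub this).2.1⟩
    · have := hvl (by omega)
      have h5 := (hl.sub this).2.1
      exact ⟨hvk (by simp [reflXV] at h5; omega), this⟩
  rcases Conn.last_visit htv {z | z ∈ k ∧ reflXV a z ∈ l}ᶜ with h4 | ⟨w, hw, hw1, rfl | ⟨w', h5, h6⟩⟩
  · have h5 := h4.left_mem.2
    simp only [mem_compl_iff, mem_ofPred_eq, not_not] at h5
    have := (hk.sub h5.1).2.2.2
    omega
  · exact hw hv2
  · have h7 := h6.left_mem.2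
    simp only [mem_compl_iff, mem_ofPred_eq, not_not] at h7 hw
    have h8 : w ∉ Box 0 a 0 (b - 1) := by
      intro hwS
      apply hw
      refine ⟨hk.closed _ h7.1 _ hwS h5.symm, hl.closed _ h7.2 _ ?_ ?_⟩
      · simp only [mem_box, reflXV] at hwS ⊢
        omega
      · refine OAdj.relabel (reflXE a) _ (reflXE_ends a) ?_
        rw [hrefl]
        exact h5.symm
    have h9 := hk.sub h7.1
    have hr1 := hk.right _ h7.1
    have hr2 := hl.right _ h7.2
    have hadj := lAdj_iff.1 h5.lAdj
    have hwT := hw1.right_mem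
    have htop : w'.2 = b - 1 := by
      obtain ⟨x, y⟩ := w
      obtain ⟨x', y'⟩ := w'
      simp only [mem_box, Prod.mk.injEq, reflXV] at h8 h9 hr1 hr2 hadj hwT ⊢
      omega
    refine h3 (mem_VC.2 ⟨v, w', hv, htop, OConn.symm (Conn.mono h6 ?_)⟩)
    intro z hz
    have := hz.2
    simp only [mem_compl_iff, mem_ofPred_eq, not_not] at this
    exact hk.sub this.1

/-- The vertices of `[0,a] × [0,b-1]` connected to the left side. -/
def leftCluster (a b : ℤ) (ω : Config SqE) : Set (ℤ × ℤ) :=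
  {z | ∃ u : ℤ × ℤ, u.1 = 0 ∧ OConn ω (Box 0 a 0 (b - 1)) u z}

/-- The vertices of `[0,m] × [0, 2 * b - 1]` avoiding `k` and its mirror image. -/
def freeRegion (b m : ℤ) (k : Set (ℤ × ℤ)) : Set (ℤ × ℤ) :=
  {z | z ∈ Box 0 m 0 (2 * b - 1) ∧ z ∉ k ∧ reflYV (2 * b - 1) z ∉ k}

/-- In the free region, the bottom is not connected to the top nor to the mirror image of `k`. -/
def Separated (b m : ℤ) (k : Set (ℤ × ℤ)) : Set (Config SqE) :=
  (ConnEvent (freeRegion b m k)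
    {z | z.2 = 2 * b - 1 ∨ ∃ w, reflYV (2 * b - 1) w ∈ k ∧ LAdj w z} {z | z.2 = 0})ᶜ

lemma freeRegion_finite (b m : ℤ) (k : Set (ℤ × ℤ)) : (freeRegion b m k).Finite :=
  (box_finite 0 m 0 (2 * b - 1)).subset fun _ h => h.1

lemma leftCluster_subset : leftCluster a b ω ⊆ Box 0 a 0 (b - 1) :=
  fun _ ⟨_, _, h⟩ => h.right_mem

lemma left_mem_leftCluster (ha : 0 ≤ a) (y : ℤ) (h0 : 0 ≤ y) (h1 : y ≤ b - 1) :
    (0, y) ∈ leftCluster a b ω := ⟨(0, y), rfl, Conn.refl ⟨le_rfl, ha, h0, h1⟩⟩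

lemma leftCluster_conn {z : ℤ × ℤ} (hz : z ∈ leftCluster a b ω) :
    ∃ u : ℤ × ℤ, u.1 = 0 ∧ OConn ω (leftCluster a b ω) u z := by
  obtain ⟨u, hu, h⟩ := hz
  refine ⟨u, hu, ?_⟩
  induction h with
  | refl h => exact Conn.refl ⟨u, hu, Conn.refl h⟩
  | tail h1 h2 h3 ih => exact ih.tail h2 ⟨u, hu, h1.tail h2 h3⟩

lemma reflYV_reflYV (c : ℤ) (z : ℤ × ℤ) : reflYV c (reflYV c z) = z := by
  simp [reflYV]

lemma leftCluster_depOn (k : Set (ℤ × ℤ)) :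
    DepOn {e | esrc e ∈ k ∨ etgt e ∈ k} {ω | leftCluster a b ω = k} := by
  have key : ∀ ω ω' : Config SqE, (∀ e ∈ {e | esrc e ∈ k ∨ etgt e ∈ k}, ω e = ω' e) →
      leftCluster a b ω = k → leftCluster a b ω' = k := by
    intro ω ω' h hk
    apply Set.Subset.antisymm
    · rintro z ⟨u, hu, hz⟩
      induction hz with
      | refl hz => rw [← hk]; exact ⟨u, hu, Conn.refl hz⟩
      | @tail v w h1 h2 h3 ih =>
        have h4 := ih
        rw [← hk] at h4 ⊢
        obtain ⟨u', hu', h4⟩ := h4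
        refine ⟨u', hu', h4.tail ?_ h3⟩
        obtain ⟨e, he, h5⟩ := h2
        refine ⟨e, ?_, h5⟩
        rw [h e, he]
        rcases h5 with ⟨rfl, rfl⟩ | ⟨rfl, rfl⟩
        · exact Or.inl ih
        · exact Or.inr ih
    · intro z hz
      have hz' := hz
      rw [← hk] at hz'
      obtain ⟨u, hu, h1⟩ := leftCluster_conn hz'
      refine ⟨u, hu, ?_⟩
      rw [hk] at h1
      have h2 : OConn ω' k u z := h1.congr fun e he he' => by
        rw [← h e (Or.inl he.1)]; exact he'
      refine h2.mono ?_
      rw [← hk]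
      exact leftCluster_subset
  intro ω ω' h
  exact ⟨key ω ω' h, key ω' ω fun e he => (h e he).symm⟩

lemma leftCluster_isLocal (k : Set (ℤ × ℤ)) : IsLocal {ω | leftCluster a b ω = k} := by
  refine IsLocal.of_finite (edgesIn_finite (box_finite 0 a 0 (b - 1))) ?_
  intro ω ω' h
  have : leftCluster a b ω = leftCluster a b ω' := by
    ext z
    constructor
    · rintro ⟨u, hu, h1⟩
      exact ⟨u, hu, h1.congr fun e he => by simp [h e he]⟩
    · rintro ⟨u, hu, h1⟩
      exact ⟨u, hu, h1.congr fun e he => by simp [h e he]⟩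
  simp only [mem_ofPred_eq, this]

lemma isBarrier_of_separated (hb : 1 ≤ b) (ha : 0 ≤ a) (hHC : ω ∉ HC 0 a 0 (b - 1))
    (hY : ω ∈ Separated b m (leftCluster a b ω)) :
    IsBarrier a b m ω (leftCluster a b ω) where
  left := left_mem_leftCluster ha
  sub := leftCluster_subset
  right := by
    rintro z ⟨u, hu, h⟩ hz
    exact hHC (mem_HC.2 ⟨u, z, hu, hz, h⟩)
  closed := by
    rintro z ⟨u, hu, h⟩ w hw hzw
    exact ⟨u, hu, h.tail hzw hw⟩
  block := by
    intro u v hu hv huv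
    apply hY
    have hsub : (Box 0 m 0 (2 * b - 1) \ leftCluster a b ω) \
        {z | reflYV (2 * b - 1) z ∈ leftCluster a b ω} ⊆
        freeRegion b m (leftCluster a b ω) := fun z hz => ⟨hz.1.1, hz.1.2, hz.2⟩
    rcases Conn.last_visit huv {z | reflYV (2 * b - 1) z ∈ leftCluster a b ω} with
      h1 | ⟨w, hw, -, rfl | ⟨w', h1, h2⟩⟩
    · refine ⟨u, ?_, v, hv, h1.mono hsub⟩
      rcases hu with hu | hu | hu
      · exact Or.inl hu
      · exfalso
        apply h1.left_mem.2
        obtain ⟨x, y⟩ := u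
        obtain ⟨rfl, hu⟩ := hu
        have h2 := h1.left_mem.1.1.2.2.2
        exact left_mem_leftCluster ha _ (by omega) (by simp only; simp only at hu; omega)
      · exfalso
        apply h1.left_mem.2
        obtain ⟨x, y⟩ := u
        obtain ⟨hu1, hu2⟩ := hu
        simp only at hu1 hu2
        simp only [mem_ofPred_eq, reflYV]
        convert hu2 using 2
        omega
    · have := (leftCluster_subset hw).2.2.2
      simp only [reflYV, hv] at this
      omega
    · exact ⟨w', Or.inr ⟨w, hw, h1.lAdj⟩, v, hv, h2.mono hsub⟩

/-- Without a bottom-top crossing, the free region is separated in one of the two directions. -/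
lemma separated_or_reflected (hb : 1 ≤ b) (ha : 0 ≤ a) (ham : a ≤ m) {ω₀ : Config SqE}
    (hVC : ω ∉ VC 0 m 0 (2 * b - 1)) :
    ω ∈ Separated b m (leftCluster a b ω₀) ∨
      (fun e => ω (reflYE (2 * b - 1) e)) ∈ Separated b m (leftCluster a b ω₀) := by
  set k := leftCluster a b ω₀ with hk
  by_contra hcon
  simp only [Separated, mem_compl_iff, not_or, not_not] at hcon
  obtain ⟨⟨v₁, hv₁, b₁, hb₁, hc₁⟩, ⟨v₂, hv₂, b₂, hb₂, hc₂⟩⟩ := hcon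
  have hkS : k ⊆ Box 0 a 0 (b - 1) := leftCluster_subset
  have hF : ∀ z ∈ freeRegion b m k, reflYV (2 * b - 1) z ∈ freeRegion b m k := by
    rintro z ⟨h1, h2, h3⟩
    refine ⟨?_, h3, by rwa [reflYV_reflYV]⟩
    simp only [mem_box, reflYV] at h1 ⊢
    omega
  have hc₂' := OConn.relabel (reflYE (2 * b - 1)) _ (reflYE_ends _) hF hc₂
  simp only [mem_ofPred_eq] at hb₁ hb₂
  have hsub : freeRegion b m k ⊆ Box 0 m 0 (2 * b - 1) := fun z hz => hz.1
  rcases hv₁ with hv₁ | ⟨w₁, hw₁, hadj₁⟩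
  · exact hVC (mem_VC.2 ⟨b₁, v₁, hb₁, hv₁, (Conn.mono hc₁ hsub).symm fun _ _ h => h.symm⟩)
  rcases hv₂ with hv₂ | ⟨w₂, hw₂, hadj₂⟩
  · exact hVC (mem_VC.2 ⟨reflYV (2 * b - 1) v₂, reflYV (2 * b - 1) b₂, by simp [reflYV, hv₂],
      by simp [reflYV, hb₂], Conn.mono hc₂' hsub⟩)
  obtain ⟨u₁, hu₁, hk₁⟩ := leftCluster_conn hw₁
  obtain ⟨u₂, hu₂, hk₂⟩ := leftCluster_conn hw₂
  rw [← hk] at hk₁ hk₂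
  let C₁ : Set (ℤ × ℤ) := {z | OConn ω (freeRegion b m k) v₁ z}
  let C₂ : Set (ℤ × ℤ) := {z | OConn ω (freeRegion b m k) (reflYV (2 * b - 1) v₂) z}
  have hCC : ∀ (v z : ℤ × ℤ), OConn ω (freeRegion b m k) v z →
      Conn LAdj {z | OConn ω (freeRegion b m k) v z} v z := by
    intro v z h
    induction h with
    | refl h => exact Conn.refl (Conn.refl h)
    | tail h1 h2 h3 ih => exact ih.tail h2.lAdj (h1.tail h2 h3)
  have hC : ∀ z, z ∈ C₁ → z ∈ C₂ → False := by
    intro z h1 h2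
    have h3 : OConn ω (freeRegion b m k) b₁ (reflYV (2 * b - 1) b₂) :=
      ((OConn.symm hc₁).trans h1).trans ((OConn.symm h2).trans hc₂')
    exact hVC (mem_VC.2 ⟨_, _, hb₁, by simp [reflYV, hb₂], Conn.mono h3 hsub⟩)
  let A : Set (ℤ × ℤ) := {z | reflYV (2 * b - 1) z ∈ k} ∪ C₁ ∪ {z | z.1 = -1 ∧ b ≤ z.2 ∧ z.2 ≤ 2 * b - 1} ∪
    {z | z.2 = -1 ∧ 0 ≤ z.1 ∧ z.1 ≤ m}
  let B : Set (ℤ × ℤ) := k ∪ C₂ ∪ {z | z.1 = -1 ∧ -1 ≤ z.2 ∧ z.2 ≤ b - 1}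
  have hAbox : A ⊆ Box (-1) m (-1) (2 * b - 1) := by
    rintro z (((hz | hz) | hz) | hz)
    · have := hkS hz
      simp only [mem_box, reflYV] at this ⊢
      omega
    · have := hsub (Conn.right_mem hz)
      simp only [mem_box] at this ⊢
      omega
    · simp only [mem_ofPred_eq] at hz
      simp only [mem_box]
      omega
    · simp only [mem_ofPred_eq] at hz
      simp only [mem_box]
      omega
  have hBbox : B ⊆ Box (-1) m (-1) (2 * b - 1) := by
    rintro z ((hz | hz) | hz)
    · have := hkS hz
      simp only [mem_box] at this ⊢
      omega
    · have := hsub (Conn.right_mem hz)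
      simp only [mem_box] at this ⊢
      omega
    · simp only [mem_ofPred_eq] at hz
      simp only [mem_box]
      omega
  -- the left-right path
  have hu₁S := hkS hk₁.left_mem
  have hb₁S := hsub hc₁.right_mem
  have hrow : ∀ x, b₁.1 ≤ x → x ≤ m → Conn LAdj A (b₁.1, -1) (x, -1) := by
    intro x hx
    have h0 := hb₁S.1
    induction x, hx using Int.leInduction with
    | base => intro h; exact Conn.refl (Or.inr ⟨rfl, h0, h⟩)
    | succ x hx ih =>
      intro h
      exact (ih (by omega)).tail (lAdj_iff.2 (Or.inl rfl)) (Or.inr ⟨rfl, by simp; omega, h⟩)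
  have hp1 : Conn LAdj A (reflYV (2 * b - 1) u₁) w₁ := by
    have := Conn.map (s := LAdj) (T := A) (reflYV (2 * b - 1)) hk₁ (fun z hz => Or.inl (Or.inl (Or.inl (by
      simpa [reflYV_reflYV] using hz)))) (fun z _ w _ h => by
        have := h.lAdj
        rw [lAdj_iff] at this ⊢
        obtain ⟨z1, z2⟩ := z
        obtain ⟨w1, w2⟩ := w
        simp only [Prod.mk.injEq, reflYV] at this ⊢
        omega)
    rwa [reflYV_reflYV] at this
  have hp2 : Conn LAdj A v₁ b₁ := (hCC _ _ hc₁).mono fun z hz => Or.inl (Or.inl (Or.inr hz))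
  have hA : Conn LAdj A (-1, 2 * b - 1 - u₁.2) (m, -1) := by
    refine Conn.head (v := reflYV (2 * b - 1) u₁) ?_ ?_ (hp1.trans (Conn.head hadj₁ hp1.right_mem
      (hp2.trans (Conn.head (v := (b₁.1, -1)) ?_ hp2.right_mem (hrow m hb₁S.2.1 le_rfl)))))
    · simp [lAdj_iff, reflYV, hu₁]
    · refine Or.inl (Or.inr ⟨rfl, ?_, ?_⟩) <;> simp only [mem_box] at hu₁S <;> simp only <;> omega
    · rw [lAdj_iff]
      right; right; right
      ext <;> simp [hb₁]
  -- the bottom-top path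
  have hu₂S := hkS hk₂.left_mem
  have hcolumn : ∀ y, -1 ≤ y → y ≤ u₂.2 → Conn LAdj B (-1, -1) (-1, y) := by
    intro y hy
    have h0 := hu₂S.2.2
    induction y, hy using Int.leInduction with
    | base => intro h; exact Conn.refl (Or.inr ⟨rfl, le_rfl, by simp; omega⟩)
    | succ y hy ih =>
      intro h
      exact (ih (by omega)).tail (lAdj_iff.2 (Or.inr (Or.inl rfl)))
        (Or.inr ⟨rfl, by simp; omega, by simp; omega⟩)
  have hq1 : Conn LAdj B u₂ (reflYV (2 * b - 1) w₂) :=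
    (OConn.lConn hk₂).mono fun z hz => Or.inl (Or.inl hz)
  have hq2 : Conn LAdj B (reflYV (2 * b - 1) v₂) (reflYV (2 * b - 1) b₂) :=
    (hCC _ _ hc₂').mono fun z hz => Or.inl (Or.inr hz)
  have hadj₂' : LAdj (reflYV (2 * b - 1) w₂) (reflYV (2 * b - 1) v₂) := by
    rw [lAdj_iff] at hadj₂ ⊢
    obtain ⟨z1, z2⟩ := w₂
    obtain ⟨w1, w2⟩ := v₂
    simp only [Prod.mk.injEq, reflYV] at hadj₂ ⊢
    omega
  have hB : Conn LAdj B (-1, -1) (reflYV (2 * b - 1) b₂) := by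
    refine ((hcolumn u₂.2 (by have := hu₂S.2.2.1; omega) le_rfl).tail (w := u₂) ?_ hq1.left_mem).trans
      (hq1.trans (Conn.head hadj₂' hq1.right_mem hq2))
    rw [lAdj_iff]
    left
    ext <;> simp [hu₂]
  obtain ⟨z, hzA, hzB⟩ := paths_meet hAbox hBbox hA hB rfl rfl rfl (by simp [reflYV, hb₂])
  have hzk : z ∈ k → reflYV (2 * b - 1) z ∉ k := by
    intro h1 h2
    have h1 := hkS h1
    have h2 := hkS h2
    simp only [mem_box, reflYV] at h1 h2
    omega
  rcases hzA with ((hz | hz) | hz) | hz <;> rcases hzB with (hz' | hz') | hz'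
  · exact hzk hz' hz
  · exact (Conn.right_mem hz').2.2 hz
  · have := hkS hz
    simp only [mem_box, reflYV] at this
    simp only [mem_ofPred_eq] at hz'
    omega
  · exact (Conn.right_mem hz).2.1 hz'
  · exact hC z hz hz'
  · have := hsub (Conn.right_mem hz)
    simp only [mem_box] at this
    simp only [mem_ofPred_eq] at hz'
    omega
  · have := hkS hz'
    simp only [mem_box] at this
    simp only [mem_ofPred_eq] at hz
    omega
  · have := hsub (Conn.right_mem hz')
    simp only [mem_box] at this
    simp only [mem_ofPred_eq] at hz
    omega
  · simp only [mem_ofPred_eq] at hz hz'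
    omega
  · have := hkS hz'
    simp only [mem_box] at this
    simp only [mem_ofPred_eq] at hz
    omega
  · have := hsub (Conn.right_mem hz')
    simp only [mem_box] at this
    simp only [mem_ofPred_eq] at hz
    omega
  · simp only [mem_ofPred_eq] at hz hz'
    omega

variable {P : Measure (Config SqE)} {ph : ℝ}

lemma IsCritical.real_separated_ge (h : IsCritical ph P) (hb : 1 ≤ b) (ha : 0 ≤ a) (ham : a ≤ m)
    (ω₀ : Config SqE) :
    P.real (VC 0 m 0 (2 * b - 1))ᶜ / 2 ≤ P.real (Separated b m (leftCluster a b ω₀)) := by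
  have := h.isProbabilityMeasure
  have hloc : IsLocal (Separated b m (leftCluster a b ω₀)) :=
    (connEvent_isLocal (freeRegion_finite _ _ _) _ _).compl
  have h1 := h.real_relabel_self (reflYE (2 * b - 1)) (reflYE_snd _) hloc
  have h2 : (VC 0 m 0 (2 * b - 1))ᶜ ⊆ Separated b m (leftCluster a b ω₀) ∪
      {ω | (fun e => ω (reflYE (2 * b - 1) e)) ∈ Separated b m (leftCluster a b ω₀)} :=
    fun ω hω => separated_or_reflected hb ha ham hω
  have h3 := (measureReal_mono (μ := P) h2).trans (measureReal_union_le _ _)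
  rw [h1] at h3
  linarith

lemma IsCritical.real_barrier_ge (h : IsCritical ph P) (hb : 1 ≤ b) (ha : 0 ≤ a) (ham : a ≤ m) :
    P.real (VC 0 m 0 (2 * b - 1))ᶜ / 2 * P.real (HC 0 a 0 (b - 1))ᶜ ≤
      P.real (BarrierEvent a b m) := by
  classical
  have := h.isProbabilityMeasure
  let S := (box_finite 0 a 0 (b - 1)).toFinset.powerset
  have hS : ∀ ω, ∃ k ∈ S, leftCluster a b ω = (k : Set (ℤ × ℤ)) := by
    intro ω
    have hf : (leftCluster a b ω).Finite := (box_finite 0 a 0 (b - 1)).subset leftCluster_subset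
    refine ⟨hf.toFinset, ?_, by simp⟩
    simp only [S, Finset.mem_powerset]
    intro z hz
    simp only [Finite.mem_toFinset] at hz ⊢
    exact leftCluster_subset hz
  let F := S.filter fun k => ∀ z ∈ k, z.1 ≠ a
  have hdisj : Set.PairwiseDisjoint (F : Set (Finset (ℤ × ℤ)))
      fun k => {ω | leftCluster a b ω = (k : Set (ℤ × ℤ))} := by
    intro k _ k' _ hkk'
    refine Set.disjoint_left.2 fun ω h1 h2 => hkk' ?_
    simp only [mem_ofPred_eq] at h1 h2
    exact Finset.coe_injective (h1.symm.trans h2)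
  have h1 : P.real (HC 0 a 0 (b - 1))ᶜ ≤
      ∑ k ∈ F, P.real {ω | leftCluster a b ω = (k : Set (ℤ × ℤ))} := by
    rw [← measureReal_biUnion_finset hdisj fun k _ => (leftCluster_isLocal _).measurableSet]
    refine measureReal_mono ?_ (measure_ne_top _ _)
    intro ω hω
    obtain ⟨k, hk, hk'⟩ := hS ω
    simp only [mem_iUnion, exists_prop]
    refine ⟨k, ?_, hk'⟩
    simp only [F, Finset.mem_filter, hk, true_and]
    intro z hz hza
    rw [← Finset.mem_coe, ← hk'] at hz
    obtain ⟨u, hu, h⟩ := hz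
    exact hω (mem_HC.2 ⟨u, z, hu, hza, h⟩)
  have hlocS : ∀ k : Set (ℤ × ℤ), IsLocal (Separated b m k) := fun k =>
    (connEvent_isLocal (freeRegion_finite _ _ _) _ _).compl
  have h2 : ∑ k ∈ F, P.real ({ω | leftCluster a b ω = (k : Set (ℤ × ℤ))} ∩
      Separated b m (k : Set (ℤ × ℤ))) ≤ P.real (BarrierEvent a b m) := by
    rw [← measureReal_biUnion_finset]
    · refine measureReal_mono ?_
      intro ω hω
      simp only [mem_iUnion, exists_prop] at hω
      obtain ⟨k, hk, hω1, hω2⟩ := hω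
      simp only [mem_ofPred_eq] at hω1
      rw [← hω1] at hω2
      refine ⟨_, isBarrier_of_separated hb ha ?_ hω2⟩
      intro hHC
      obtain ⟨u, v, hu, hv, huv⟩ := mem_HC.1 hHC
      have hvk : v ∈ leftCluster a b ω := ⟨u, hu, huv⟩
      rw [hω1] at hvk
      simp only [F, Finset.mem_filter] at hk
      exact hk.2 v hvk hv
    · exact hdisj.mono fun k => Set.inter_subset_left
    · exact fun k _ => ((leftCluster_isLocal _).inter (hlocS _)).measurableSet
  refine le_trans ?_ h2
  refine (mul_le_mul_of_nonneg_left h1 (by positivity)).trans ?_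
  rw [Finset.mul_sum]
  refine Finset.sum_le_sum fun k _ => ?_
  rw [h.law.indep h.int_mem (leftCluster_isLocal _) (hlocS _) (s := {e | esrc e ∈ (k : Set (ℤ × ℤ)) ∨
    etgt e ∈ (k : Set (ℤ × ℤ))}) (t := edgesIn (freeRegion b m (k : Set (ℤ × ℤ)))) ?_
    (leftCluster_depOn _) (connEvent_depOn _ _ _).compl]
  · rw [mul_comm]
    by_cases hne : ∃ ω₀, leftCluster a b ω₀ = (k : Set (ℤ × ℤ))
    · obtain ⟨ω₀, hω₀⟩ := hne
      rw [← hω₀]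
      exact mul_le_mul_of_nonneg_left (h.real_separated_ge hb ha ham ω₀) (by positivity)
    · have : {ω | leftCluster a b ω = (k : Set (ℤ × ℤ))} = ∅ := by
        ext ω
        simp only [mem_ofPred_eq, mem_empty_iff_false, iff_false]
        exact fun h => hne ⟨ω, h⟩
      simp [this]
  · refine Set.disjoint_left.2 ?_
    rintro e (h1 | h1) ⟨h2, h3⟩
    · exact h2.2.1 h1
    · exact h3.2.1 h1

/-- The Bollobás–Riordan extension of crossings. -/
theorem IsCritical.hc_extend (h : IsCritical ph P) (hb : 2 ≤ b) (ha : 0 ≤ a) (ham : a ≤ m) :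
    (hc P (m + 1) (2 * b - 1) / 2 * (1 - hc P a b)) ^ 2 * hc P (a + 1) (b - 1) ≤
      hc P (2 * m - a + 1) (2 * b - 1) := by
  have := h.isProbabilityMeasure
  have hVC : ∀ x₀ x₁ y₁ : ℤ, x₀ ≤ x₁ → 0 < y₁ → P.real (VC x₀ x₁ 0 y₁)ᶜ = hc P (x₁ - x₀ + 1) y₁ := by
    intro x₀ x₁ y₁ h1 h2
    rw [h.law.real_compl (VC_isLocal _ _ _ _), h.real_VC h1 h2]
    simp
  have hHC : P.real (HC 0 a 0 (b - 1))ᶜ = 1 - hc P a b := h.law.real_compl (HC_isLocal _ _ _ _)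
  have h1 := h.real_barrier_ge (a := a) (b := b) (m := m) (by omega) ha ham
  rw [hHC, hVC _ _ _ (by omega) (by omega), sub_zero] at h1
  have hl := barrierEvent_isLocal (a := a) (b := b) (m := m) ham (by omega)
  have hd := barrierEvent_isDecr (a := a) (b := b) (m := m) ham (by omega)
  let J' := {ω : Config SqE | (fun e => ω (reflXE a e)) ∈ BarrierEvent a b m}
  have hl' : IsLocal J' := by
    have := isLocal_relabel (reflXE a) false hl
    simpa [J'] using this
  have hd' : IsDecr J' := fun ω ω' hh hA => hd _ _ (fun e => hh _) hA
  have hJ' : P.real J' = P.real (BarrierEvent a b m) :=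
    h.real_relabel_self (reflXE a) (reflXE_snd a) hl
  have h2 := h.law.harris_decr h.int_mem hl hl' hd hd'
  have h3 := h.law.harris_decr h.int_mem (hl.inter hl') (VC_isLocal 0 a 0 (b - 1)).compl
    (hd.inter hd') (VC_isIncr _ _ _ _).compl
  rw [hVC _ _ _ ha (by omega), sub_zero] at h3
  have h4 : P.real (BarrierEvent a b m ∩ J' ∩ (VC 0 a 0 (b - 1))ᶜ) ≤
      P.real (VC (a - m) m 0 (2 * b - 1))ᶜ :=
    measureReal_mono fun ω hω => not_VC_of_barriers (by omega) ha ham hω.1.1 hω.1.2 hω.2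
  rw [hVC _ _ _ (by omega) (by omega)] at h4
  have e : m - (a - m) + 1 = 2 * m - a + 1 := by ring
  rw [e] at h4
  rw [hJ'] at h2
  have h0 : 0 ≤ hc P (a + 1) (b - 1) := measureReal_nonneg
  have h0' : 0 ≤ hc P (m + 1) (2 * b - 1) / 2 * (1 - hc P a b) := by
    rw [← hHC]
    have : 0 ≤ hc P (m + 1) (2 * b - 1) := measureReal_nonneg
    positivity
  calc _ ≤ (P.real (BarrierEvent a b m) * P.real (BarrierEvent a b m)) * hc P (a + 1) (b - 1) := by
        rw [sq]
        gcongr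
    _ ≤ P.real (BarrierEvent a b m ∩ J') * hc P (a + 1) (b - 1) := by gcongr
    _ ≤ _ := h3.trans h4

end Barrier

section RSW

/-- A path stays in the set of points it reaches. -/
lemma Conn.self_restrict {α : Type*} {r : α → α → Prop} {R : Set α} {u v : α} (h : Conn r R u v) :
    Conn r {z | Conn r R u z} u v := by
  induction h with
  | refl h => exact Conn.refl (Conn.refl h)
  | tail h1 h2 h3 ih => exact ih.tail h2 (h1.tail h2 h3)

/-- A horizontal and a vertical open crossing of a box are connected to each other. -/
lemma OConn.meet {ω : Config SqE} {x₀ x₁ y₀ y₁ : ℤ} {u v b t : ℤ × ℤ}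
    (h1 : OConn ω (Box x₀ x₁ y₀ y₁) u v) (h2 : OConn ω (Box x₀ x₁ y₀ y₁) b t)
    (hu : u.1 = x₀) (hv : v.1 = x₁) (hb : b.2 = y₀) (ht : t.2 = y₁) :
    OConn ω (Box x₀ x₁ y₀ y₁) u b := by
  obtain ⟨z, hz, hz'⟩ := paths_meet (A := {z | OConn ω (Box x₀ x₁ y₀ y₁) u z})
    (B := {z | OConn ω (Box x₀ x₁ y₀ y₁) b z}) (fun z hz => Conn.right_mem hz)
    (fun z hz => Conn.right_mem hz) (OConn.lConn (Conn.self_restrict h1))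
    (OConn.lConn (Conn.self_restrict h2)) hu hv hb ht
  exact Conn.trans hz (OConn.symm hz')

variable {P : Measure (Config SqE)} {ph : ℝ} {a a' b b' : ℤ}

lemma hc_nonneg : 0 ≤ hc P a b := measureReal_nonneg

lemma IsCritical.hc_anti (h : IsCritical ph P) (ha : 0 ≤ a) (haa : a ≤ a') :
    hc P a' b ≤ hc P a b := by
  have := h.isProbabilityMeasure
  exact measureReal_mono (HC_subset le_rfl haa le_rfl le_rfl ha) (measure_ne_top _ _)

lemma IsCritical.hc_mono (h : IsCritical ph P) (ha : 0 ≤ a) (hbb : b ≤ b') :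
    hc P a b ≤ hc P a b' := by
  have := h.isProbabilityMeasure
  exact measureReal_mono (HC_subset le_rfl le_rfl le_rfl (by omega) ha) (measure_ne_top _ _)

lemma disjoint_edgesIn {R S : Set (ℤ × ℤ)} (h : Disjoint R S) :
    Disjoint (edgesIn R) (edgesIn S) :=
  Set.disjoint_left.2 fun _ h1 h2 => Set.disjoint_left.1 h h1.1 h2.1

lemma IsCritical.hc_submul (h : IsCritical ph P) (ha : 0 ≤ a) (ha' : 0 ≤ a') :
    hc P (a + a' + 1) b ≤ hc P a b * hc P a' b := by
  have := h.isProbabilityMeasure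
  have h1 : P.real (HC (a + 1) (a + a' + 1) 0 (b - 1)) = hc P a' b := by
    rw [h.real_HC]; congr 1 <;> ring
  rw [← h1, hc, hc, ← h.law.indep h.int_mem (HC_isLocal _ _ _ _) (HC_isLocal _ _ _ _)
    (disjoint_edgesIn ?_) (connEvent_depOn _ _ _) (connEvent_depOn _ _ _)]
  · refine measureReal_mono (fun ω hω => ?_) (measure_ne_top _ _)
    exact ⟨HC_subset le_rfl (by omega) le_rfl le_rfl ha hω,
      HC_subset (by omega) le_rfl le_rfl le_rfl (by omega) hω⟩
  · refine Set.disjoint_left.2 fun z h1 h2 => ?_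
    simp only [mem_box] at h1 h2
    omega

/-- Opening one more edge extends a crossing by one column. -/
lemma IsCritical.hc_finite_energy (h : IsCritical ph P) (ha : 0 ≤ a) :
    ph * hc P a b ≤ hc P (a + 1) b := by
  classical
  have := h.isProbabilityMeasure
  set A : ℤ → Set (Config SqE) := fun y =>
    ConnEvent (Box 0 a 0 (b - 1)) {v | v.1 = 0} {(a, y)} with hA
  have hAl : ∀ y, IsLocal (A y) := fun y => connEvent_isLocal (box_finite _ _ _ _) _ _
  have hAd : ∀ y, DepOn (edgesIn (Box 0 a 0 (b - 1))) (A y) := fun y => connEvent_depOn _ _ _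
  set D : ℤ → Set (Config SqE) := fun y => A y ∩ ⋂ y' ∈ Finset.Ico 0 y, (A y')ᶜ with hD
  have hDl : ∀ y, IsLocal (D y) := fun y =>
    (hAl y).inter (isLocal_biInter _ fun y' _ => (hAl y').compl)
  have hDd : ∀ y, DepOn (edgesIn (Box 0 a 0 (b - 1))) (D y) := by
    intro y
    refine (hAd y).inter ?_
    intro ω ω' hh
    simp only [mem_iInter, mem_compl_iff]
    exact forall_congr' fun y' => forall_congr' fun _ => not_congr (hAd y' ω ω' hh)
  have hdisj : Set.PairwiseDisjoint (↑(Finset.Ico 0 b)) D := by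
    intro y hy y' hy' hne
    simp only [Finset.coe_Ico, mem_Ico] at hy hy'
    refine Set.disjoint_left.2 fun ω h1 h2 => ?_
    simp only [hD, mem_inter_iff, mem_iInter, mem_compl_iff, Finset.mem_Ico] at h1 h2
    rcases lt_trichotomy y y' with hl | hl | hl
    · exact h2.2 y ⟨hy.1, hl⟩ h1.1
    · exact hne hl
    · exact h1.2 y' ⟨hy'.1, hl⟩ h2.1
  have hun : hc P a b ≤ ∑ y ∈ Finset.Ico 0 b, P.real (D y) := by
    rw [← measureReal_biUnion_finset hdisj fun y _ => (hDl y).measurableSet]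
    refine measureReal_mono (fun ω hω => ?_) (measure_ne_top _ _)
    obtain ⟨u, v, hu, hv, huv⟩ := mem_HC.1 hω
    have hmem := huv.right_mem
    simp only [mem_box] at hmem
    have hex : ∃ n : ℕ, ω ∈ A n := by
      refine ⟨v.2.toNat, u, hu, (a, v.2), ?_, ?_⟩
      · simp only [mem_singleton_iff, Prod.mk.injEq, true_and]; omega
      · have hv2 : (a, v.2) = v := Prod.ext hv.symm rfl
        rw [hv2]; exact huv
    have h1 := Nat.find_spec hex
    obtain ⟨u', hu', v', hv', huv'⟩ := h1
    have hmem' := huv'.right_mem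
    rw [mem_singleton_iff.1 hv'] at hmem'
    simp only [mem_box] at hmem'
    simp only [mem_iUnion, exists_prop]
    refine ⟨Nat.find hex, by simp; omega, Nat.find_spec hex, ?_⟩
    simp only [mem_iInter, mem_compl_iff, Finset.mem_Ico]
    rintro y' ⟨h2, h3⟩ h4
    refine Nat.find_min hex (m := y'.toNat) (by omega) ?_
    rwa [Int.toNat_of_nonneg h2]
  set O : ℤ → Set (Config SqE) := fun y => {ω | ω (a, y, true) = true} with hO
  have hOd : ∀ y, DepOn {((a, y, true) : SqE)} (O y) := fun y ω ω' hh => by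
    simp [hO, hh (a, y, true) rfl]
  have hOl : ∀ y, IsLocal (O y) := fun y => IsLocal.of_finite (Set.finite_singleton _) (hOd y)
  have hOP : ∀ y, P.real (O y) = ph := by
    intro y
    have := h.law.real_cylinder h.int_mem {((a, y, true) : SqE)} (fun _ => true)
    simpa [sqInt, hO] using this
  have hind : ∀ y, P.real (D y ∩ O y) = P.real (D y) * ph := by
    intro y
    rw [h.law.indep h.int_mem (hDl y) (hOl y) ?_ (hDd y) (hOd y), hOP]
    refine Set.disjoint_left.2 fun e h1 h2 => ?_
    rw [mem_singleton_iff] at h2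
    subst h2
    have := h1.2
    simp [etgt, mem_box] at this
  calc ph * hc P a b ≤ ph * ∑ y ∈ Finset.Ico 0 b, P.real (D y) :=
        mul_le_mul_of_nonneg_left hun h.mem.1.le
    _ = ∑ y ∈ Finset.Ico 0 b, P.real (D y ∩ O y) := by
        rw [Finset.mul_sum]; exact Finset.sum_congr rfl fun y _ => by rw [hind, mul_comm]
    _ = P.real (⋃ y ∈ Finset.Ico 0 b, D y ∩ O y) := by
        rw [measureReal_biUnion_finset ?_ fun y _ => ((hDl y).inter (hOl y)).measurableSet]
        intro y hy y' hy' hne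
        exact (hdisj hy hy' hne).mono inter_subset_left inter_subset_left
    _ ≤ _ := by
        refine measureReal_mono (fun ω hω => ?_) (measure_ne_top _ _)
        simp only [mem_iUnion, exists_prop, Finset.mem_Ico] at hω
        obtain ⟨y, hy, ⟨⟨u, hu, v, hv, huv⟩, -⟩, hop⟩ := hω
        rw [mem_singleton_iff] at hv
        subst hv
        refine mem_HC.2 ⟨u, (a + 1, y), hu, rfl, ?_⟩
        refine (huv.mono (box_mono le_rfl (by omega) le_rfl le_rfl)).tail
          ⟨(a, y, true), hop, Or.inl ⟨rfl, rfl⟩⟩ ?_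
        simp only [mem_box]
        omega

/-- Two overlapping horizontal crossings and a vertical crossing of the overlap. -/
lemma IsCritical.hc_glue (h : IsCritical ph P) {s A B n : ℤ} (hs : 0 ≤ s) (hsA : s ≤ A)
    (hAB : A ≤ B) (hn : 2 ≤ n) :
    hc P A n * hc P (B - s) n * (1 - hc P (A - s + 1) (n - 1)) ≤ hc P B n := by
  have := h.isProbabilityMeasure
  have h1 : P.real (HC s B 0 (n - 1)) = hc P (B - s) n := by
    rw [h.real_HC]; congr 1; ring
  have h2 : P.real (VC s A 0 (n - 1)) = 1 - hc P (A - s + 1) (n - 1) := by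
    rw [h.real_VC hsA (by omega)]; congr 2; ring
  rw [← h1, ← h2]
  have hl := (HC_isLocal 0 A 0 (n - 1)).inter (HC_isLocal s B 0 (n - 1))
  have hi := (HC_isIncr 0 A 0 (n - 1)).inter (HC_isIncr s B 0 (n - 1))
  have e1 := h.law.harris h.int_mem (HC_isLocal 0 A 0 (n - 1)) (HC_isLocal s B 0 (n - 1))
    (HC_isIncr 0 A 0 (n - 1)) (HC_isIncr s B 0 (n - 1))
  have e2 := h.law.harris h.int_mem hl (VC_isLocal s A 0 (n - 1)) hi (VC_isIncr s A 0 (n - 1))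
  refine ((mul_le_mul_of_nonneg_right e1 measureReal_nonneg).trans e2).trans
    (measureReal_mono ?_ (measure_ne_top _ _))
  rintro ω ⟨⟨hω1, hω2⟩, hω3⟩
  obtain ⟨b₁, t₁, hb, ht, hbt⟩ := mem_VC.1 hω3
  obtain ⟨u, v, hu, hv, huv⟩ := mem_HC.1 hω1
  obtain ⟨u', v', hu', hv', huv'⟩ := mem_HC.1 hω2
  have c1 := OConn.meet (huv) (hbt.mono (box_mono hs le_rfl le_rfl le_rfl)) hu hv hb ht
  have c2 := OConn.meet (huv') (hbt.mono (box_mono le_rfl hAB le_rfl le_rfl)) hu' hv' hb ht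
  refine mem_HC.2 ⟨u, v', hu, hv', ?_⟩
  exact (c1.mono (box_mono le_rfl hAB le_rfl le_rfl)).trans
    ((c2.symm.trans huv').mono (box_mono hs le_rfl le_rfl le_rfl))

end RSW

section RSW

variable {P : Measure (Config SqE)} {ph : ℝ}

lemma IsCritical.hc_pow (h : IsCritical ph P) {a b : ℤ} (ha : 0 ≤ a) (j : ℕ) :
    hc P ((a + 1) * j + a) b ≤ hc P a b ^ (j + 1) := by
  induction j with
  | zero => simp
  | succ j ih =>
    have h1 := h.hc_submul (b := b) (a := (a + 1) * j + a) (a' := a) (by positivity) ha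
    have h2 : (a + 1) * ((j + 1 : ℕ) : ℤ) + a = (a + 1) * j + a + a + 1 := by push_cast; ring
    rw [h2, pow_succ]
    exact h1.trans (mul_le_mul_of_nonneg_right ih hc_nonneg)

/-- Rectangles of some fixed aspect ratio are crossed with probability bounded away from `1` in
the long direction and away from `0` in the short one. -/
def Isotropic (P : Measure (Config SqE)) : Prop :=
  ∃ C : ℤ, 1 ≤ C ∧ ∃ c : ℝ, 0 < c ∧ ∃ k₀ : ℤ, ∀ k, k₀ ≤ k →
    hc P (C * k) k ≤ 1 - c ∧ c ≤ hc P k (C * k)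

lemma IsCritical.half_of_le (h : IsCritical ph P) {C k₀ : ℤ} (hC : 1 ≤ C) {c : ℝ} (hc0 : 0 < c)
    (hk : ∀ k, k₀ ≤ k → hc P (C * k) k ≤ 1 - c) :
    ∃ e₀ : ℕ, ∀ e, e₀ ≤ e → ∀ k, max k₀ 1 ≤ k → hc P (2 ^ e * k) k < 1 / 2 := by
  have hc1 : c ≤ 1 := by
    have := (hc_nonneg (P := P)).trans (hk k₀ le_rfl)
    linarith
  obtain ⟨J, hJ⟩ := exists_pow_lt_of_lt_one (show (0 : ℝ) < 1 / 2 by norm_num)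
    (show 1 - c < 1 by linarith)
  obtain ⟨e₀, he₀⟩ := pow_unbounded_of_one_lt ((C + 1) * (J + 1)) (show (1 : ℤ) < 2 by norm_num)
  refine ⟨e₀, fun e he k hk1 => ?_⟩
  have hk1 := max_le_iff.1 hk1
  have hpos : 0 ≤ C * k := by nlinarith
  calc hc P (2 ^ e * k) k ≤ hc P ((C * k + 1) * J + C * k) k := by
        refine h.hc_anti (by positivity) ?_
        have h1 : (2 : ℤ) ^ e₀ ≤ 2 ^ e := pow_le_pow_right₀ (by norm_num) he
        have h2 : (C + 1) * (J + 1) * k ≤ 2 ^ e * k :=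
          mul_le_mul_of_nonneg_right (he₀.le.trans h1) (by omega)
        have hJ0 : (0 : ℤ) ≤ J := by positivity
        nlinarith
    _ ≤ hc P (C * k) k ^ (J + 1) := h.hc_pow hpos J
    _ ≤ (1 - c) ^ (J + 1) := pow_le_pow_left₀ hc_nonneg (hk k hk1.1) _
    _ ≤ (1 - c) ^ J := pow_le_pow_of_le_one (by linarith) (by linarith) (Nat.le_succ _)
    _ < 1 / 2 := hJ

lemma IsCritical.half_of_isotropic (h : IsCritical ph P) (hI : Isotropic P) :
    ∃ e : ℕ, ∃ k₀ : ℤ, 1 ≤ k₀ ∧ ∀ k, k₀ ≤ k →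
      hc P (2 ^ e * k) k < 1 / 2 ∧ 1 / 2 < hc P k (2 ^ e * k) := by
  obtain ⟨C, hC, c, hc0, k₀, hk⟩ := hI
  obtain ⟨Q, hQ, hQP⟩ := h.exists_swap_hc
  obtain ⟨e₁, h1⟩ := h.half_of_le hC hc0 fun k hkk => (hk k hkk).1
  obtain ⟨e₂, h2⟩ := hQ.half_of_le (k₀ := max k₀ 1) hC hc0 fun k hkk => by
    have hk1 := max_le_iff.1 hkk
    rw [hQP _ _ (by nlinarith) (by omega)]
    linarith [(hk k hk1.1).2]
  refine ⟨max e₁ e₂, max (max k₀ 1) 1, le_max_right _ _, fun k hkk => ?_⟩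
  have hk1 := max_le_iff.1 hkk
  refine ⟨h1 _ (le_max_left _ _) k hk1.1, ?_⟩
  have h3 := h2 _ (le_max_right e₁ e₂) k hkk
  have : (1 : ℤ) ≤ 2 ^ max e₁ e₂ := one_le_pow₀ (by norm_num)
  rw [hQP _ _ (by nlinarith) (by omega)] at h3
  linarith

/-- The least width crossed with probability less than one half. -/
noncomputable def threshold (P : Measure (Config SqE)) (n : ℤ) : ℕ :=
  sInf {a : ℕ | hc P a n < 1 / 2}

lemma threshold_le {P : Measure (Config SqE)} {n a : ℤ} (ha : 0 ≤ a) (h : hc P a n < 1 / 2) :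
    (threshold P n : ℤ) ≤ a := by
  lift a to ℕ using ha
  exact_mod_cast Nat.sInf_le h

lemma hc_threshold {n a : ℤ} (ha : 0 ≤ a) (h : hc P a n < 1 / 2) :
    hc P (threshold P n) n < 1 / 2 := by
  lift a to ℕ using ha
  exact Nat.sInf_mem (s := {a : ℕ | hc P a n < 1 / 2}) ⟨a, h⟩

lemma half_le_hc_threshold {n : ℤ} (h : 1 ≤ threshold P n) :
    1 / 2 ≤ hc P (threshold P n - 1) n := by
  have := Nat.notMem_of_lt_sInf (s := {a : ℕ | hc P a n < 1 / 2}) (m := threshold P n - 1)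
    (by unfold threshold at *; omega)
  simp only [mem_ofPred_eq, not_lt, Nat.cast_sub h] at this
  exact_mod_cast this

lemma IsCritical.lt_threshold (h : IsCritical ph P) {n a a' : ℤ} (ha : 0 ≤ a)
    (h' : 1 / 2 ≤ hc P a n) (ha' : 0 ≤ a') (h'' : hc P a' n < 1 / 2) : a < threshold P n := by
  by_contra! hlt
  have := h.hc_anti (b := n) (by positivity) hlt
  linarith [hc_threshold ha' h'']

lemma IsCritical.hc_long (h : IsCritical ph P) {N a g q : ℤ} (hN : 1 ≤ N) (ha : 1 ≤ a)
    (hg : 48 ≤ g) (hag : 3 * a ≤ 2 * g) (hq : 4 * q ≤ g) (hq0 : 0 ≤ q)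
    (h1 : 1 / 2 ≤ hc P (a - 1) N) (h2 : hc P a N < 1 / 2)
    (h3 : 1 / 2 ≤ hc P (g - 1) (2 * N)) (h4 : hc P g (2 * N) < 1 / 2) (j : ℕ) :
    (1 / 4 * ((1 - ph) / 2)) ^ 2 * (ph ^ 2 / 2) *
      ((1 / 4 * ((1 - ph) / 2)) ^ 2 * (ph ^ 2 / 2) * (1 / 2)) ^ j ≤
      hc P (g + j * q) (2 * N + 1) := by
  set c := (1 / 4 * ((1 - ph) / 2)) ^ 2 * (ph ^ 2 / 2) with hcdef
  have hph := h.mem.1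
  have hph1 := h.mem.2
  have hc0 : 0 ≤ c := by positivity
  have h5 : ph ^ 2 / 2 ≤ hc P (a + 1) N := by
    have e1 := h.hc_finite_energy (a := a - 1) (b := N) (by omega)
    have e2 := h.hc_finite_energy (a := a) (b := N) (by omega)
    rw [sub_add_cancel] at e1
    nlinarith
  have h6 : (1 - ph) / 2 ≤ 1 - hc P a (N + 1) := by
    obtain ⟨Q, hQ, hQP⟩ := h.exists_swap_hc
    have e1 := hQ.hc_finite_energy (a := N) (b := a) (by omega)
    rw [hQP _ _ (by omega) (by omega), hQP _ _ (by omega) (by omega)] at e1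
    nlinarith
  have hW : c ≤ hc P (2 * g - a - 3) (2 * N + 1) := by
    have e1 := h.hc_extend (a := a) (m := g - 2) (b := N + 1) (by omega) (by omega) (by omega)
    have e2 : hc P (g - 1) (2 * N) ≤ hc P (g - 1) (2 * N + 1) :=
      h.hc_mono (by omega) (by omega)
    rw [show g - 2 + 1 = g - 1 by ring, show 2 * (N + 1) - 1 = 2 * N + 1 by ring,
      show 2 * (g - 2) - a + 1 = 2 * g - a - 3 by ring, show N + 1 - 1 = N by ring] at e1
    refine le_trans ?_ e1
    rw [hcdef]
    have e3 : 1 / 4 ≤ hc P (g - 1) (2 * N + 1) / 2 := by linarith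
    gcongr
  induction j with
  | zero =>
    simp only [pow_zero, mul_one, Nat.cast_zero, zero_mul, add_zero]
    exact hW.trans (h.hc_anti (by omega) (by omega))
  | succ j ih =>
    have hjq : 0 ≤ (j : ℤ) * q := by positivity
    have e1 := h.hc_glue (s := j * q + 1) (A := g + j * q) (B := j * q + 1 + (2 * g - a - 3))
      (n := 2 * N + 1) (by omega) (by omega) (by omega) (by omega)
    rw [show j * q + 1 + (2 * g - a - 3) - (j * q + 1) = 2 * g - a - 3 by ring,
      show g + j * q - (j * q + 1) + 1 = g by ring, show 2 * N + 1 - 1 = 2 * N by ring] at e1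
    have e2 : hc P (j * q + 1 + (2 * g - a - 3)) (2 * N + 1) ≤
        hc P (g + ((j + 1 : ℕ) : ℤ) * q) (2 * N + 1) := by
      refine h.hc_anti (by positivity) ?_
      push_cast
      rw [add_mul]
      omega
    refine le_trans ?_ (e1.trans e2)
    have e3 : 1 / 2 ≤ 1 - hc P g (2 * N) := by linarith
    calc c * (c * (1 / 2)) ^ (j + 1) = c * (c * (1 / 2)) ^ j * c * (1 / 2) := by ring
      _ ≤ _ := by gcongr <;> first | exact hc_nonneg | exact mul_nonneg hc_nonneg hc_nonneg

/-- Crossing probabilities of long rectangles are bounded below. -/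
theorem IsCritical.rsw (h : IsCritical ph P) (hI : Isotropic P) (K : ℕ) :
    ∃ c : ℝ, 0 < c ∧ ∃ n₀ : ℤ, ∀ n, n₀ ≤ n → c ≤ hc P (K * n) n := by
  obtain ⟨e, k₀, hk₀, hk⟩ := h.half_of_isotropic hI
  have hph := h.mem.1
  have hph1 := h.mem.2
  obtain ⟨r, hr⟩ : ∃ r : ℕ, 3 ^ r * 4 ^ e ≤ (4 : ℤ) ^ r := by
    obtain ⟨r, hr⟩ := pow_unbounded_of_one_lt ((4 : ℝ) ^ e) (show (1 : ℝ) < 4 / 3 by norm_num)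
    refine ⟨r, ?_⟩
    rw [div_pow, lt_div_iff₀ (by positivity)] at hr
    have : (3 : ℝ) ^ r * 4 ^ e ≤ 4 ^ r := by linarith
    exact_mod_cast this
  have her : e ≤ r := by
    by_contra! hlt
    have h1 : (4 : ℤ) ^ r < 4 ^ e := pow_lt_pow_right₀ (by norm_num) hlt
    have h2 : (1 : ℤ) ≤ 3 ^ r := one_le_pow₀ (by norm_num)
    have h3 : (0 : ℤ) < 4 ^ e := by positivity
    nlinarith
  set M : ℤ := 2 ^ r * (4 * 2 ^ e) with hM
  have hM0 : 0 < M := by positivity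
  set j : ℕ := K * (2 * (2 ^ r * (4 * 2 ^ e))) with hj
  set c := (1 / 4 * ((1 - ph) / 2)) ^ 2 * (ph ^ 2 / 2) with hcdef
  have hc0 : 0 < c := by
    have : 0 < 1 - ph := by linarith
    positivity
  refine ⟨c * (c * (1 / 2)) ^ j, by positivity, M * (k₀ + 12) + 1, fun n hn => ?_⟩
  set q : ℤ := (n - 1) / M with hq
  have hq1 : k₀ + 12 ≤ q := (Int.le_ediv_iff_mul_le hM0).2 (by linarith)
  have hq2 : q * M ≤ n - 1 := Int.ediv_mul_le _ hM0.ne'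
  have hq3 : n - 1 < (q + 1) * M := Int.lt_ediv_add_one_mul_self _ hM0
  set t : ℤ := 4 * 2 ^ e * q with ht
  have h2e : (1 : ℤ) ≤ 2 ^ e := one_le_pow₀ (by norm_num)
  have ht1 : 4 * q ≤ t := by nlinarith
  set F : ℕ → ℕ := fun i => threshold P (2 ^ i * t) with hF
  have hit : ∀ i : ℕ, t ≤ 2 ^ i * t := fun i => by
    have : (1 : ℤ) ≤ 2 ^ i := one_le_pow₀ (by norm_num)
    nlinarith
  have hex : ∀ i : ℕ, hc P (2 ^ e * (2 ^ i * t)) (2 ^ i * t) < 1 / 2 := fun i =>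
    (hk _ (by have := hit i; omega)).1
  have hex0 : ∀ i : ℕ, 0 ≤ (2 : ℤ) ^ e * (2 ^ i * t) := fun i => by
    have := hit i
    have : 0 ≤ (2 : ℤ) ^ i * t := by omega
    positivity
  have hFl : ∀ i, 4 * q < F i := by
    intro i
    refine h.lt_threshold (by omega) ?_ (hex0 i) (hex i)
    refine (hk (4 * q) (by omega)).2.le.trans (h.hc_mono (by omega) ?_)
    have := hit i
    linarith
  have hFr : 2 ^ (r - e) * t < F r := by
    have h0 : t ≤ 2 ^ (r - e) * t := hit (r - e)
    refine h.lt_threshold (by omega) ?_ (hex0 r) (hex r)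
    refine (hk (2 ^ (r - e) * t) (by omega)).2.le.trans (h.hc_mono (by omega) ?_)
    rw [← mul_assoc, ← pow_add, Nat.add_sub_cancel' her]
  have hF0 : (F 0 : ℤ) ≤ 2 ^ e * t := by
    have := threshold_le (hex0 0) (hex 0)
    simpa [hF] using this
  obtain ⟨i, hir, hi⟩ : ∃ i < r, 3 * (F i : ℤ) ≤ 2 * F (i + 1) := by
    by_contra! hcon
    have hind : ∀ i ≤ r, (2 : ℤ) ^ i * F i ≤ 3 ^ i * F 0 := by
      intro i
      induction i with
      | zero => simp
      | succ i ih =>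
        intro hir
        have h1 := ih (by omega)
        have h2 := hcon i (by omega)
        have h3 : (0 : ℤ) < 2 ^ i := by positivity
        calc (2 : ℤ) ^ (i + 1) * F (i + 1) = 2 ^ i * (2 * F (i + 1)) := by ring
          _ ≤ 2 ^ i * (3 * F i) := by gcongr
          _ = 3 * (2 ^ i * F i) := by ring
          _ ≤ 3 * (3 ^ i * F 0) := by gcongr
          _ = _ := by ring
    have h1 := hind r le_rfl
    have h2 : (2 : ℤ) ^ r * 2 ^ r = 4 ^ r := by rw [← mul_pow]; norm_num
    have h3 : (2 : ℤ) ^ e * 2 ^ e = 4 ^ e := by rw [← mul_pow]; norm_num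
    have h4 : (2 : ℤ) ^ (r - e) * 2 ^ e = 2 ^ r := by rw [← pow_add, Nat.sub_add_cancel her]
    have h5 : (2 : ℤ) ^ r * (2 ^ (r - e) * t) < 3 ^ r * (2 ^ e * t) :=
      calc (2 : ℤ) ^ r * (2 ^ (r - e) * t) < 2 ^ r * F r := by gcongr
        _ ≤ 3 ^ r * F 0 := h1
        _ ≤ _ := by gcongr
    have h6 : (4 : ℤ) ^ r * t < 3 ^ r * 4 ^ e * t :=
      calc (4 : ℤ) ^ r * t = 2 ^ r * (2 ^ (r - e) * t) * 2 ^ e := by rw [← h2, ← h4]; ring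
        _ < 3 ^ r * (2 ^ e * t) * 2 ^ e := by gcongr
        _ = _ := by rw [← h3]; ring
    have h7 : 3 ^ r * 4 ^ e * t ≤ (4 : ℤ) ^ r * t := mul_le_mul_of_nonneg_right hr (by omega)
    omega
  have hi0 := hFl i
  have hi1 := hFl (i + 1)
  have hN := hit i
  have hdouble : (2 : ℤ) ^ (i + 1) * t = 2 * (2 ^ i * t) := by ring
  have key := h.hc_long (N := 2 ^ i * t) (a := F i) (g := F (i + 1)) (q := q) (by omega)
    (by omega) (by omega) hi (by omega) (by omega)
    (half_le_hc_threshold (show 1 ≤ F i by omega))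
    (hc_threshold (hex0 i) (hex i)) (by rw [← hdouble]; exact half_le_hc_threshold (show 1 ≤ F (i + 1) by omega))
    (by rw [← hdouble]; exact hc_threshold (hex0 (i + 1)) (hex (i + 1))) j
  have hn0 : 0 ≤ n := by
    have : 0 ≤ M * (k₀ + 12) := by positivity
    omega
  refine key.trans ((h.hc_anti (by positivity) ?_).trans (h.hc_mono (by positivity) ?_))
  · have h1 : (K : ℤ) * n ≤ j * q := by
      have : n ≤ 2 * M * q := by nlinarith
      calc (K : ℤ) * n ≤ K * (2 * M * q) := by gcongr
        _ = j * q := by rw [hj, hM]; push_cast; ring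
    omega
  · rw [← hdouble]
    have h1 : (2 : ℤ) ^ (i + 1) ≤ 2 ^ r := pow_le_pow_right₀ (by norm_num) hir
    have h2 : (2 : ℤ) ^ (i + 1) * t ≤ 2 ^ r * t := mul_le_mul_of_nonneg_right h1 (by omega)
    have h3 : 2 ^ r * t = q * M := by rw [ht, hM]; ring
    omega

end RSW

section TemperleyLieb

variable {X : Type*}

/-- Remove `x` from its class. -/
def isolate (x : X) (σ : Setoid X) : Setoid X where
  r a b := a = b ∨ (σ a b ∧ a ≠ x ∧ b ≠ x)
  iseqv := by
    refine ⟨fun a => Or.inl rfl, fun {a b} h => ?_, fun {a b c} h1 h2 => ?_⟩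
    · rcases h with h | ⟨h1, h2, h3⟩
      · exact Or.inl h.symm
      · exact Or.inr ⟨σ.symm h1, h3, h2⟩
    · rcases h1 with rfl | ⟨h1, h3, h4⟩
      · exact h2
      · rcases h2 with rfl | ⟨h2, h5, h6⟩
        · exact Or.inr ⟨h1, h3, h4⟩
        · exact Or.inr ⟨σ.trans h1 h2, h3, h6⟩

/-- Unite the classes of `x` and `y`. -/
def merge (x y : X) (σ : Setoid X) : Setoid X where
  r a b := σ a b ∨ (σ a x ∧ σ y b) ∨ (σ a y ∧ σ x b)
  iseqv := by
    have hs : ∀ {a b}, σ a b → σ b a := fun h => σ.symm h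
    have ht : ∀ {a b c}, σ a b → σ b c → σ a c := fun h h' => σ.trans h h'
    refine ⟨fun a => Or.inl (σ.refl a), fun {a b} h => ?_, fun {a b c} h1 h2 => ?_⟩
    · rcases h with h | ⟨h1, h2⟩ | ⟨h1, h2⟩
      · exact Or.inl (hs h)
      · exact Or.inr (Or.inr ⟨hs h2, hs h1⟩)
      · exact Or.inr (Or.inl ⟨hs h2, hs h1⟩)
    · rcases h1 with h1 | ⟨h1, h3⟩ | ⟨h1, h3⟩ <;> rcases h2 with h2 | ⟨h2, h4⟩ | ⟨h2, h4⟩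
      · exact Or.inl (ht h1 h2)
      · exact Or.inr (Or.inl ⟨ht h1 h2, h4⟩)
      · exact Or.inr (Or.inr ⟨ht h1 h2, h4⟩)
      · exact Or.inr (Or.inl ⟨h1, ht h3 h2⟩)
      · exact Or.inr (Or.inl ⟨h1, h4⟩)
      · exact Or.inl (ht h1 h4)
      · exact Or.inr (Or.inr ⟨h1, ht h3 h2⟩)
      · exact Or.inl (ht h1 h4)
      · exact Or.inr (Or.inr ⟨h1, h4⟩)

lemma isolate_iff {x : X} {σ : Setoid X} {a b : X} :
    isolate x σ a b ↔ a = b ∨ (σ a b ∧ a ≠ x ∧ b ≠ x) := Iff.rfl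

lemma merge_iff {x y : X} {σ : Setoid X} {a b : X} :
    merge x y σ a b ↔ σ a b ∨ (σ a x ∧ σ y b) ∨ (σ a y ∧ σ x b) := Iff.rfl

lemma isolate_isolate (x : X) (σ : Setoid X) : isolate x (isolate x σ) = isolate x σ := by
  ext a b
  simp only [isolate_iff]
  tauto

lemma merge_comm (x y : X) (σ : Setoid X) : merge x y σ = merge y x σ := by
  ext a b
  simp only [merge_iff]
  tauto

lemma merge_of_rel {x y : X} {σ : Setoid X} (h : σ x y) : merge x y σ = σ := by
  ext a b
  simp only [merge_iff]
  refine ⟨?_, Or.inl⟩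
  rintro (h1 | ⟨h1, h2⟩ | ⟨h1, h2⟩)
  · exact h1
  · exact σ.trans h1 (σ.trans h h2)
  · exact σ.trans h1 (σ.trans (σ.symm h) h2)

lemma merge_rel (x y : X) (σ : Setoid X) : merge x y σ x y :=
  Or.inr (Or.inl ⟨σ.refl x, σ.refl y⟩)

lemma le_merge (x y : X) (σ : Setoid X) {a b : X} (h : σ a b) : merge x y σ a b := Or.inl h

lemma merge_merge (x y : X) (σ : Setoid X) : merge x y (merge x y σ) = merge x y σ :=
  merge_of_rel (merge_rel x y σ)

lemma merge_eq_sup (x y : X) (σ : Setoid X) :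
    merge x y σ = σ ⊔ Relation.EqvGen.setoid fun a b => a = x ∧ b = y := by
  apply le_antisymm
  · have h1 : (σ ⊔ Relation.EqvGen.setoid fun a b => a = x ∧ b = y) x y :=
      (le_sup_right : _ ≤ σ ⊔ Relation.EqvGen.setoid fun a b => a = x ∧ b = y)
        (Relation.EqvGen.rel _ _ ⟨rfl, rfl⟩)
    have h2 : ∀ {a b}, σ a b → (σ ⊔ Relation.EqvGen.setoid fun a b => a = x ∧ b = y) a b :=
      fun h => (le_sup_left : σ ≤ _) h
    rintro a b (h | ⟨h3, h4⟩ | ⟨h3, h4⟩)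
    · exact h2 h
    · exact Setoid.trans' _ (h2 h3) (Setoid.trans' _ h1 (h2 h4))
    · exact Setoid.trans' _ (h2 h3) (Setoid.trans' _ (Setoid.symm' _ h1) (h2 h4))
  · refine sup_le (fun a b h => Or.inl h) ?_
    refine Setoid.eqvGen_le ?_
    rintro a b ⟨rfl, rfl⟩
    exact merge_rel _ _ _

lemma merge_merge_comm (x y z w : X) (σ : Setoid X) :
    merge x y (merge z w σ) = merge z w (merge x y σ) := by
  simp only [merge_eq_sup]
  exact sup_right_comm _ _ _

lemma isolate_isolate_comm (x y : X) (σ : Setoid X) :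
    isolate x (isolate y σ) = isolate y (isolate x σ) := by
  ext a b
  simp only [isolate_iff]
  tauto

lemma isolate_merge_comm {x y z : X} (hy : y ≠ x) (hz : z ≠ x) (σ : Setoid X) :
    isolate x (merge y z σ) = merge y z (isolate x σ) := by
  have hs : ∀ {a b}, σ a b → σ b a := fun h => σ.symm h
  have ht : ∀ {a b c}, σ a b → σ b c → σ a c := fun h h' => σ.trans h h'
  ext a b
  simp only [merge_iff, isolate_iff]
  constructor
  · rintro (rfl | ⟨h | ⟨h1, h2⟩ | ⟨h1, h2⟩, h3, h4⟩)
    · exact Or.inl (Or.inl rfl)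
    · exact Or.inl (Or.inr ⟨h, h3, h4⟩)
    · exact Or.inr (Or.inl ⟨Or.inr ⟨h1, h3, hy⟩, Or.inr ⟨h2, hz, h4⟩⟩)
    · exact Or.inr (Or.inr ⟨Or.inr ⟨h1, h3, hz⟩, Or.inr ⟨h2, hy, h4⟩⟩)
  · rintro ((rfl | ⟨h1, h2, h3⟩) | ⟨h1, h2⟩ | ⟨h1, h2⟩)
    · exact Or.inl rfl
    · exact Or.inr ⟨Or.inl h1, h2, h3⟩
    · have h3 : a ≠ x ∧ σ a y := by
        rcases h1 with rfl | h1
        exacts [⟨hy, σ.refl _⟩, ⟨h1.2.1, h1.1⟩]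
      have h4 : b ≠ x ∧ σ z b := by
        rcases h2 with rfl | h2
        exacts [⟨hz, σ.refl _⟩, ⟨h2.2.2, h2.1⟩]
      exact Or.inr ⟨Or.inr (Or.inl ⟨h3.2, h4.2⟩), h3.1, h4.1⟩
    · have h3 : a ≠ x ∧ σ a z := by
        rcases h1 with rfl | h1
        exacts [⟨hz, σ.refl _⟩, ⟨h1.2.1, h1.1⟩]
      have h4 : b ≠ x ∧ σ y b := by
        rcases h2 with rfl | h2
        exacts [⟨hy, σ.refl _⟩, ⟨h2.2.2, h2.1⟩]
      exact Or.inr ⟨Or.inr (Or.inr ⟨h3.2, h4.2⟩), h3.1, h4.1⟩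

lemma isolate_merge_isolate {x y : X} (hxy : x ≠ y) (σ : Setoid X) :
    isolate x (merge x y (isolate x σ)) = isolate x σ := by
  ext a b
  simp only [merge_iff, isolate_iff]
  tauto

lemma merge_isolate_merge {x y : X} (hxy : x ≠ y) (σ : Setoid X) :
    merge x y (isolate x (merge x y σ)) = merge x y σ := by
  set τ := merge x y σ with hτ
  have hxy' : τ x y := merge_rel x y σ
  ext a b
  simp only [merge_iff (σ := isolate x τ), isolate_iff]
  constructor
  · rintro ((rfl | ⟨h, -⟩) | ⟨h1, h2⟩ | ⟨h1, h2⟩)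
    · exact τ.refl _
    · exact h
    · have h3 : τ a x := by
        rcases h1 with rfl | h1
        exacts [τ.refl _, h1.1]
      have h4 : τ y b := by
        rcases h2 with rfl | h2
        exacts [τ.refl _, h2.1]
      exact τ.trans h3 (τ.trans hxy' h4)
    · have h3 : τ a y := by
        rcases h1 with rfl | h1
        exacts [τ.refl _, h1.1]
      have h4 : τ x b := by
        rcases h2 with rfl | h2
        exacts [τ.refl _, h2.1]
      exact τ.trans h3 (τ.trans (τ.symm hxy') h4)
  · intro h
    by_cases ha : a = x
    · subst ha
      by_cases hb : b = a
      · exact Or.inl (Or.inl hb.symm)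
      · exact Or.inr (Or.inl ⟨Or.inl rfl, Or.inr ⟨τ.trans (τ.symm hxy') h, hxy.symm, hb⟩⟩)
    · by_cases hb : b = x
      · subst hb
        exact Or.inr (Or.inr ⟨Or.inr ⟨τ.trans h hxy', ha, hxy.symm⟩, Or.inl rfl⟩)
      · exact Or.inl (Or.inr ⟨h, ha, hb⟩)

/-- Labels: positions on the interface, together with two marks. -/
abbrev Label := ℤ ⊕ Bool

/-- Connectivity states. -/
abbrev State := Setoid Label

/-- The Temperley–Lieb generators acting on connectivity states: at even positions a site is
detached, at odd positions the two neighbouring sites are joined. -/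
def tl (j : ℤ) (σ : State) : State :=
  if Even j then isolate (.inl j) σ else merge (.inl (j - 1)) (.inl (j + 1)) σ

lemma tl_even {j : ℤ} (h : Even j) (σ : State) : tl j σ = isolate (.inl j) σ := if_pos h

lemma tl_odd {j : ℤ} (h : ¬ Even j) (σ : State) :
    tl j σ = merge (.inl (j - 1)) (.inl (j + 1)) σ := if_neg h

lemma tl_tl (j : ℤ) (σ : State) : tl j (tl j σ) = tl j σ := by
  by_cases h : Even j
  · simp only [tl_even h, isolate_isolate]
  · simp only [tl_odd h, merge_merge]

lemma tl_succ_braid (j : ℤ) (σ : State) : tl j (tl (j + 1) (tl j σ)) = tl j σ := by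
  by_cases h : Even j
  · have h' : ¬ Even (j + 1) := by simpa [Int.even_add_one] using h
    simp only [tl_even h, tl_odd h', add_sub_cancel_right]
    exact isolate_merge_isolate (by simp; omega) σ
  · have h' : Even (j + 1) := by simpa [Int.even_add_one] using h
    simp only [tl_odd h, tl_even h', merge_comm (Sum.inl (j - 1) : Label)]
    exact merge_isolate_merge (by simp; omega) σ

lemma tl_pred_braid (j : ℤ) (σ : State) : tl (j + 1) (tl j (tl (j + 1) σ)) = tl (j + 1) σ := by
  by_cases h : Even j
  · have h' : ¬ Even (j + 1) := by simpa [Int.even_add_one] using h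
    simp only [tl_even h, tl_odd h', add_sub_cancel_right]
    exact merge_isolate_merge (by simp; omega) σ
  · have h' : Even (j + 1) := by simpa [Int.even_add_one] using h
    simp only [tl_odd h, tl_even h', merge_comm (Sum.inl (j - 1) : Label)]
    exact isolate_merge_isolate (by simp; omega) σ

lemma tl_comm {i j : ℤ} (h : i + 2 ≤ j) (σ : State) : tl i (tl j σ) = tl j (tl i σ) := by
  by_cases hi : Even i <;> by_cases hj : Even j
  · simp only [tl_even hi, tl_even hj]
    exact isolate_isolate_comm _ _ _
  · simp only [tl_even hi, tl_odd hj]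
    exact isolate_merge_comm (by simp; omega) (by simp; omega) _
  · simp only [tl_odd hi, tl_even hj]
    exact (isolate_merge_comm (by simp; omega) (by simp; omega) _).symm
  · simp only [tl_odd hi, tl_odd hj]
    exact merge_merge_comm _ _ _ _ _

end TemperleyLieb

section RandomActions

variable {S T : Type*}

/-- Expectation of `f` after performing a list of independent random steps: the step `(j, y)`
applies `act j` with probability `y`. -/
noncomputable def run (act : ℤ → S → S) : List (ℤ × ℝ) → (S → ℝ) → S → ℝ
  | [], f, s => f s
  | (j, y) :: l, f, s => (1 - y) * run act l f s + y * run act l f (act j s)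

variable {act : ℤ → S → S} {l l' : List (ℤ × ℝ)} {f g : S → ℝ}

/-- All step probabilities lie in `[0, 1]`. -/
def ProbSteps (l : List (ℤ × ℝ)) : Prop := ∀ x ∈ l, x.2 ∈ Icc (0 : ℝ) 1

lemma ProbSteps.append (h : ProbSteps l) (h' : ProbSteps l') : ProbSteps (l ++ l') := by
  intro x hx
  rcases List.mem_append.1 hx with hx | hx
  exacts [h x hx, h' x hx]

lemma run_append (l l' : List (ℤ × ℝ)) (f : S → ℝ) :
    run act (l ++ l') f = run act l (run act l' f) := by
  induction l with
  | nil => rfl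
  | cons x l ih => ext s; simp only [List.cons_append, run, ih]

lemma run_mono (hl : ProbSteps l) (h : ∀ s, f s ≤ g s) (s : S) : run act l f s ≤ run act l g s := by
  induction l generalizing s with
  | nil => exact h s
  | cons x l ih =>
    have h1 := hl x (by simp)
    have h2 := sub_nonneg.2 h1.2
    have h3 := h1.1
    have ih := ih fun x hx => hl x (by simp [hx])
    simp only [run]
    have := ih s
    have := ih (act x.1 s)
    gcongr

lemma run_add (l : List (ℤ × ℝ)) (f g : S → ℝ) (s : S) :
    run act l (fun s => f s + g s) s = run act l f s + run act l g s := by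
  induction l generalizing s with
  | nil => rfl
  | cons x l ih => simp only [run, ih]; ring

lemma run_const_mul (l : List (ℤ × ℝ)) (c : ℝ) (f : S → ℝ) (s : S) :
    run act l (fun s => c * f s) s = c * run act l f s := by
  induction l generalizing s with
  | nil => rfl
  | cons x l ih => simp only [run, ih]; ring

lemma run_sub (l : List (ℤ × ℝ)) (f g : S → ℝ) (s : S) :
    run act l (fun s => f s - g s) s = run act l f s - run act l g s := by
  induction l generalizing s with
  | nil => rfl
  | cons x l ih => simp only [run, ih]; ring

lemma run_const (l : List (ℤ × ℝ)) (c : ℝ) (s : S) : run act l (fun _ => c) s = c := by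
  induction l generalizing s with
  | nil => rfl
  | cons x l ih => simp only [run, ih]; ring

lemma run_nonneg (hl : ProbSteps l) (h : ∀ s, 0 ≤ f s) (s : S) : 0 ≤ run act l f s := by
  simpa [run_const] using run_mono (act := act) (f := fun _ => 0) hl h s

lemma run_le_one (hl : ProbSteps l) (h : ∀ s, f s ≤ 1) (s : S) : run act l f s ≤ 1 := by
  simpa [run_const] using run_mono (act := act) (g := fun _ => 1) hl h s

/-- Random steps commute with equivariant maps. -/
lemma run_map {act' : ℤ → T → T} (φ : S → T) (h : ∀ j s, φ (act j s) = act' j (φ s))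
    (l : List (ℤ × ℝ)) (f : T → ℝ) (s : S) :
    run act l (fun s => f (φ s)) s = run act' l f (φ s) := by
  induction l generalizing s with
  | nil => rfl
  | cons x l ih => simp only [run, ih, h]

/-- Comparison of expectations along an invariant of the steps. -/
lemma run_mono_of_inv (I : S → Prop) (hI : ∀ x ∈ l, ∀ s, I s → I (act x.1 s))
    (hl : ProbSteps l) (h : ∀ s, I s → f s ≤ g s) {s : S} (hs : I s) :
    run act l f s ≤ run act l g s := by
  induction l generalizing s with
  | nil => exact h s hs
  | cons x l ih =>
    have h1 := hl x (by simp)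
    have h2 := sub_nonneg.2 h1.2
    have h3 := h1.1
    have ih := fun s hs => ih (fun x hx => hI x (by simp [hx])) (fun x hx => hl x (by simp [hx]))
      (s := s) hs
    simp only [run]
    have := ih s hs
    have := ih _ (hI x (by simp) s hs)
    gcongr

end RandomActions

section YangBaxter

lemma run_cons {S : Type*} (act : ℤ → S → S) (x : ℤ × ℝ) (l : List (ℤ × ℝ)) (f : S → ℝ) :
    run act (x :: l) f = run act [x] (run act l f) := rfl

/-- The Yang–Baxter (star–triangle) relation. -/
lemma run_yang_baxter {q a b : ℝ} (h : b * (1 - q * a) = q + a - q * a) (j : ℤ) (f : State → ℝ)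
    (σ : State) :
    run tl [(j, q), (j + 1, b), (j, a)] f σ = run tl [(j + 1, a), (j, b), (j + 1, q)] f σ := by
  simp only [run, tl_tl, tl_succ_braid, tl_pred_braid]
  linear_combination (f (tl (j + 1) σ) - f (tl j σ)) * h

/-- Distant steps commute. -/
lemma run_comm {i j : ℤ} (h : i + 2 ≤ j) (x y : ℝ) (f : State → ℝ) :
    run tl [(i, x)] (run tl [(j, y)] f) = run tl [(j, y)] (run tl [(i, x)] f) := by
  ext σ
  simp only [run, tl_comm h]
  ring

/-- The probability of a non-trivial step of a horizontal track across an increasing column. -/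
noncomputable def yUp : ℝ := 1 / 2

/-- The probability of a non-trivial step of a horizontal track across a decreasing column. -/
noncomputable def yDown (q : ℝ) : ℝ := (1 + q) / (2 - q)

lemma yDown_spec {q : ℝ} (hq : q < 1 / 2) : yDown q * (1 - q * yUp) = q + yUp - q * yUp := by
  have : 2 - q ≠ 0 := by linarith
  rw [yDown, yUp]
  field_simp
  ring

lemma yDown_lt_one {q : ℝ} (hq : q < 1 / 2) : yDown q < 1 := by
  rw [yDown, div_lt_one] <;> linarith

lemma le_yDown {q : ℝ} (h0 : 0 < q) (hq : q < 1 / 2) : 1 / 2 ≤ yDown q := by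
  rw [yDown, le_div_iff₀] <;> linarith

/-- The step probability of a track across column `c` of the interface with height profile `h`. -/
noncomputable def yCol (q : ℝ) (h : ℤ → ℤ) (c : ℤ) : ℝ :=
  if h c = h (c - 1) + 1 then yUp else yDown q

/-- The `i`-th track crossing the columns `lo, …, lo + n - 1` from right to left. -/
noncomputable def track (q : ℝ) (lo : ℤ) (h : ℤ → ℤ) (i : ℤ) : ℕ → List (ℤ × ℝ)
  | 0 => []
  | n + 1 => (lo + n + i, yCol q h (lo + n)) :: track q lo h i n

/-- Raising the profile at a local minimum. -/
def raise (h : ℤ → ℤ) (p : ℤ) : ℤ → ℤ := Function.update h p (h p + 2)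

variable {q : ℝ} {lo : ℤ} {h h' : ℤ → ℤ} {i : ℤ} {n : ℕ}

lemma yCol_mem (h0 : 0 < q) (hq : q < 1 / 2) (h : ℤ → ℤ) (c : ℤ) :
    0 ≤ yCol q h c ∧ yCol q h c ≤ yDown q := by
  have := le_yDown h0 hq
  unfold yCol
  split_ifs
  · exact ⟨by norm_num [yUp], by simpa [yUp] using this⟩
  · exact ⟨by linarith, le_rfl⟩

lemma track_mem {x : ℤ × ℝ} (hx : x ∈ track q lo h i n) :
    ∃ c, lo ≤ c ∧ c < lo + n ∧ x = (c + i, yCol q h c) := by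
  induction n with
  | zero => simp [track] at hx
  | succ n ih =>
    rw [track, List.mem_cons] at hx
    rcases hx with rfl | hx
    · exact ⟨lo + n, by omega, by push_cast; omega, rfl⟩
    · obtain ⟨c, h1, h2, h3⟩ := ih hx
      exact ⟨c, h1, by push_cast; omega, h3⟩

lemma track_congr (hh : ∀ c, lo - 1 ≤ c → c < lo + n → h c = h' c) :
    track q lo h i n = track q lo h' i n := by
  induction n with
  | zero => rfl
  | succ n ih =>
    rw [track, track, ih fun c h1 h2 => hh c h1 (by push_cast; omega)]
    simp only [yCol]
    rw [hh _ (by omega) (by push_cast; omega), hh (lo + n - 1) (by omega) (by push_cast; omega)]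

lemma run_comm_track (j : ℤ) (hj : lo + n + i + 1 ≤ j) (y : ℝ) (f : State → ℝ) :
    run tl (track q lo h i n) (run tl [(j, y)] f) = run tl [(j, y)] (run tl (track q lo h i n) f) := by
  induction n with
  | zero => rfl
  | succ n ih =>
    rw [track, run_cons, ih (by push_cast at hj; omega), run_cons (l := track q lo h i n),
      run_comm (by push_cast at hj; omega)]

/-- A local flip of the interface can be moved through a track. -/
lemma run_flip_track (hq : q < 1 / 2) {p : ℤ} (hlo : lo ≤ p) (hhi : p + 1 < lo + n)
    (h1 : h (p - 1) = h p + 1) (h2 : h (p + 1) = h p + 1) (f : State → ℝ) :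
    run tl [(p + i, q)] (run tl (track q lo (raise h p) i n) f) =
      run tl (track q lo h i n) (run tl [(p + (i + 1), q)] f) := by
  induction n with
  | zero => simp at hhi; omega
  | succ n ih =>
    have hne : ∀ c, c ≠ p → raise h p c = h c := fun c h => Function.update_of_ne h _ _
    have heq : raise h p p = h p + 2 := Function.update_self _ _ _
    by_cases hn : lo + n = p + 1
    · obtain ⟨n, rfl⟩ : ∃ k, n = k + 1 := ⟨n - 1, by omega⟩
      have hn' : lo + (n : ℤ) = p := by push_cast at hn; omega
      have e1 : yCol q (raise h p) (p + 1) = yDown q := by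
        rw [yCol, hne (p + 1) (by omega), add_sub_cancel_right, heq, h2, if_neg (by omega)]
      have e2 : yCol q (raise h p) p = yUp := by
        rw [yCol, hne (p - 1) (by omega), heq, h1, if_pos (by omega)]
      have e3 : yCol q h (p + 1) = yUp := by
        rw [yCol, add_sub_cancel_right, h2, if_pos rfl]
      have e4 : yCol q h p = yDown q := by
        rw [yCol, h1, if_neg (by omega)]
      have e5 : track q lo (raise h p) i n = track q lo h i n :=
        track_congr fun c _ hc => hne c (by omega)
      rw [track, track, track, track, hn, hn', e1, e2, e3, e4, e5]
      rw [run_cons (l := _ :: _), run_cons (l := track _ _ _ _ _), run_cons (l := _ :: _),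
        run_cons (l := track _ _ _ _ _), run_comm_track _ (by omega)]
      ext σ
      have := run_yang_baxter (yDown_spec hq) (p + i) (run tl (track q lo h i n) f) σ
      rw [show p + i + 1 = p + 1 + i by ring] at this
      rw [show p + (i + 1) = p + 1 + i by ring]
      exact this
    · have hn2 : p + 1 < lo + n := by push_cast at hhi; omega
      have e1 : yCol q (raise h p) (lo + n) = yCol q h (lo + n) := by
        rw [yCol, yCol, hne (lo + n) (by omega), hne (lo + n - 1) (by omega)]
      rw [track, track, e1, run_cons (l := track q lo (raise h p) i n),
        run_cons (l := track q lo h i n), ← ih hn2,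
        run_comm (by omega)]

/-- The steps of a list of flips, after `i` tracks have passed. -/
def flips (q : ℝ) (i : ℤ) (ps : List ℤ) : List (ℤ × ℝ) := ps.map fun p => (p + i, q)

/-- The profile after a list of flips. -/
def raises (h : ℤ → ℤ) (ps : List ℤ) : ℤ → ℤ := ps.foldl raise h

/-- All flips take place at local minima between `lo` and `hi`. -/
def ValidFlips (lo hi : ℤ) : (ℤ → ℤ) → List ℤ → Prop
  | _, [] => True
  | h, p :: ps => (h (p - 1) = h p + 1 ∧ h (p + 1) = h p + 1) ∧ (lo ≤ p ∧ p + 1 < hi) ∧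
      ValidFlips lo hi (raise h p) ps

lemma ValidFlips.append {hi : ℤ} {ps ps' : List ℤ} (h1 : ValidFlips lo hi h ps)
    (h2 : ValidFlips lo hi (raises h ps) ps') : ValidFlips lo hi h (ps ++ ps') := by
  induction ps generalizing h with
  | nil => exact h2
  | cons p ps ih => exact ⟨h1.1, h1.2.1, ih h1.2.2 h2⟩

lemma raises_append (h : ℤ → ℤ) (ps ps' : List ℤ) :
    raises h (ps ++ ps') = raises (raises h ps) ps' := List.foldl_append

lemma run_flips_track (hq : q < 1 / 2) {ps : List ℤ} (hps : ValidFlips lo (lo + n) h ps)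
    (f : State → ℝ) :
    run tl (flips q i ps) (run tl (track q lo (raises h ps) i n) f) =
      run tl (track q lo h i n) (run tl (flips q (i + 1) ps) f) := by
  induction ps generalizing h with
  | nil => rfl
  | cons p ps ih =>
    obtain ⟨⟨h1, h2⟩, ⟨h3, h4⟩, h5⟩ := hps
    have e := ih h5
    simp only [flips, List.map_cons] at e ⊢
    rw [run_cons, run_cons (l := List.map _ _)]
    rw [← run_flip_track hq h3 h4 h1 h2, ← e]
    rfl

/-- The tracks `0, …, k - 1` across a fixed interface. -/
noncomputable def tracks (q : ℝ) (lo : ℤ) (n : ℕ) (h : ℤ → ℤ) : ℕ → List (ℤ × ℝ)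
  | 0 => []
  | k + 1 => tracks q lo n h k ++ track q lo h k n

/-- Track exchange: a block of tracks can be moved through a list of flips. -/
lemma run_flips_tracks (hq : q < 1 / 2) {ps : List ℤ} (hps : ValidFlips lo (lo + n) h ps)
    (k : ℕ) (f : State → ℝ) :
    run tl (flips q 0 ps) (run tl (tracks q lo n (raises h ps) k) f) =
      run tl (tracks q lo n h k) (run tl (flips q k ps) f) := by
  induction k generalizing f with
  | zero => rfl
  | succ k ih =>
    rw [tracks, tracks, run_append, run_append, ih, run_flips_track hq hps]
    push_cast
    rfl

lemma flips_prob (h0 : 0 ≤ q) (h1 : q ≤ 1) (i : ℤ) (ps : List ℤ) : ProbSteps (flips q i ps) := by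
  intro x hx
  simp only [flips, List.mem_map] at hx
  obtain ⟨p, -, rfl⟩ := hx
  exact ⟨h0, h1⟩

lemma track_prob (h0 : 0 < q) (hq : q < 1 / 2) : ProbSteps (track q lo h i n) := by
  intro x hx
  obtain ⟨c, -, -, rfl⟩ := track_mem hx
  have := yCol_mem h0 hq h c
  exact ⟨this.1, this.2.trans (yDown_lt_one hq).le⟩

lemma tracks_prob (h0 : 0 < q) (hq : q < 1 / 2) (k : ℕ) : ProbSteps (tracks q lo n h k) := by
  induction k with
  | zero => intro x hx; simp [tracks] at hx
  | succ k ih => exact ih.append (track_prob h0 hq)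

end YangBaxter

section LastKill

/-- The first mark is connected to the interface. -/
def Alive (σ : State) : Prop := ∃ p, σ (.inr true) (.inl p)

/-- The first mark is connected to at most the site `n` of the interface. -/
def OnlyAt (n : ℤ) (σ : State) : Prop := ∀ p, σ (.inr true) (.inl p) → p = n

open Classical in
/-- The indicator function of `Alive`. -/
noncomputable def alive (σ : State) : ℝ := if Alive σ then 1 else 0

lemma alive_nonneg (σ : State) : 0 ≤ alive σ := by unfold alive; split_ifs <;> norm_num

lemma alive_le_one (σ : State) : alive σ ≤ 1 := by unfold alive; split_ifs <;> norm_num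

lemma touch_tl_even {j : ℤ} (hj : Even j) (σ : State) (p : ℤ) :
    tl j σ (.inr true) (.inl p) ↔ σ (.inr true) (.inl p) ∧ p ≠ j := by
  rw [tl_even hj, isolate_iff]
  simp

lemma Alive.of_tl {j : ℤ} {σ : State} (h : Alive (tl j σ)) : Alive σ := by
  obtain ⟨p, hp⟩ := h
  by_cases hj : Even j
  · exact ⟨p, ((touch_tl_even hj σ p).1 hp).1⟩
  · rw [tl_odd hj, merge_iff] at hp
    rcases hp with h | ⟨h, -⟩ | ⟨h, -⟩
    exacts [⟨_, h⟩, ⟨_, h⟩, ⟨_, h⟩]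

lemma run_alive_le {l : List (ℤ × ℝ)} (hl : ProbSteps l) (σ : State) :
    run tl l alive σ ≤ alive σ := by
  by_cases h : Alive σ
  · rw [show alive σ = 1 from if_pos h]
    exact run_le_one hl alive_le_one σ
  · have := run_mono_of_inv (act := tl) (fun σ => ¬ Alive σ) (fun x _ σ h h' => h h'.of_tl) hl
      (f := alive) (g := fun _ => 0) (fun σ h => (if_neg h : alive σ = 0).le) h
    rw [run_const] at this
    exact this.trans (alive_nonneg σ)

lemma OnlyAt.tl {n j : ℤ} {σ : State} (h : OnlyAt n σ) (h1 : j ≠ n - 1) (h2 : j ≠ n + 1) :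
    OnlyAt n (tl j σ) := by
  intro p hp
  by_cases hj : Even j
  · exact h p ((touch_tl_even hj σ p).1 hp).1
  · rw [tl_odd hj, merge_iff] at hp
    rcases hp with hp | ⟨hp, -⟩ | ⟨hp, -⟩
    · exact h p hp
    · have := h _ hp
      omega
    · have := h _ hp
      omega

/-- A mark connected to a single site stays so with positive probability. -/
lemma run_onlyAt {S : Type*} {act : ℤ → S → S} {φ : S → State}
    (hφ : ∀ j s, φ (act j s) = tl j (φ s)) {n : ℤ} {b : ℝ} (hb : b ≤ 1) {l : List (ℤ × ℝ)}
    (hl : ∀ x ∈ l, 0 ≤ x.2 ∧ x.2 ≤ b) {g : S → ℝ} (hg0 : ∀ s, 0 ≤ g s) {c : ℝ} (h0c : 0 ≤ c)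
    (I : S → Prop) (hI : ∀ x ∈ l, ∀ s, I s → I (act x.1 s))
    (hg : ∀ s, OnlyAt n (φ s) → I s → c ≤ g s) {s : S} (hσ : OnlyAt n (φ s)) (hσI : I s) :
    (1 - b) ^ ((l.map Prod.fst).count (n - 1) + (l.map Prod.fst).count (n + 1)) * c ≤
      run act l g s := by
  induction l generalizing s with
  | nil => simpa [run] using hg s hσ hσI
  | cons x l ih =>
    obtain ⟨j, y⟩ := x
    have hy := hl _ (List.mem_cons_self ..)
    simp only at hy
    have hl' : ∀ x ∈ l, 0 ≤ x.2 ∧ x.2 ≤ b := fun x hx => hl x (List.mem_cons_of_mem _ hx)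
    have hI' : ∀ x ∈ l, ∀ s, I s → I (act x.1 s) := fun x hx => hI x (List.mem_cons_of_mem _ hx)
    have ih1 := ih hl' hI' hσ hσI
    have hb0 : 0 ≤ 1 - b := by linarith
    have hp : ProbSteps l := fun x hx => ⟨(hl' x hx).1, (hl' x hx).2.trans hb⟩
    simp only [List.map_cons, run]
    by_cases hj : j = n - 1 ∨ j = n + 1
    · have : (j :: l.map Prod.fst).count (n - 1) + (j :: l.map Prod.fst).count (n + 1) =
          (l.map Prod.fst).count (n - 1) + (l.map Prod.fst).count (n + 1) + 1 := by
        rcases hj with rfl | rfl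
        · rw [List.count_cons_self, List.count_cons_of_ne (by omega)]; ring
        · rw [List.count_cons_self, List.count_cons_of_ne (by omega)]; ring
      rw [this, pow_succ]
      have h2 := run_nonneg (act := act) hp hg0 (act j s)
      have h3 : 0 ≤ (1 - b) ^ ((l.map Prod.fst).count (n - 1) + (l.map Prod.fst).count (n + 1)) * c :=
        mul_nonneg (pow_nonneg hb0 _) h0c
      nlinarith [mul_nonneg hy.1 h2, mul_le_mul_of_nonneg_left ih1 hb0,
        mul_nonneg (sub_nonneg.2 hy.2) (h3.trans ih1)]
    · push Not at hj
      rw [List.count_cons_of_ne hj.1, List.count_cons_of_ne hj.2]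
      have ih2 := ih hl' hI' (by rw [hφ]; exact hσ.tl hj.1 hj.2) (hI _ (List.mem_cons_self ..) s hσI)
      nlinarith [mul_le_mul_of_nonneg_left ih1 (sub_nonneg.2 (hy.2.trans hb)),
        mul_le_mul_of_nonneg_left ih2 hy.1]

lemma run_dead_of_dead {l : List (ℤ × ℝ)} (hl : ProbSteps l) {σ : State} (h : ¬ Alive σ) :
    run tl l alive σ = 0 :=
  le_antisymm ((run_alive_le hl σ).trans (if_neg h : alive σ = 0).le)
    (run_nonneg hl alive_nonneg σ)

/-- Detaching steps kill a mark connected to a single site. -/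
lemma run_kill {n : ℤ} {q : ℝ} {l : List (ℤ × ℝ)} (hl : ProbSteps l) (he : ∀ x ∈ l, Even x.1)
    (hn : (n, q) ∈ l) {σ : State} (hσ : OnlyAt n σ) : run tl l alive σ ≤ 1 - q := by
  induction l generalizing σ with
  | nil => simp at hn
  | cons x l ih =>
    obtain ⟨j, y⟩ := x
    have hy := hl _ (List.mem_cons_self ..)
    have hl' : ProbSteps l := fun x hx => hl x (List.mem_cons_of_mem _ hx)
    have he' : ∀ x ∈ l, Even x.1 := fun x hx => he x (List.mem_cons_of_mem _ hx)
    have hj : Even j := he _ (List.mem_cons_self ..)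
    have hO : OnlyAt n (tl j σ) := fun p hp => hσ p ((touch_tl_even hj σ p).1 hp).1
    simp only at hy
    simp only [run]
    rcases List.mem_cons.1 hn with h | h
    · simp only [Prod.mk.injEq] at h
      obtain ⟨rfl, rfl⟩ := h
      have hd : ¬ Alive (tl n σ) := by
        rintro ⟨p, hp⟩
        have := (touch_tl_even hj σ p).1 hp
        exact this.2 (hσ p this.1)
      rw [run_dead_of_dead hl' hd]
      have := run_le_one (act := tl) hl' alive_le_one σ
      nlinarith [mul_le_mul_of_nonneg_left this (sub_nonneg.2 hy.2)]
    · have h1 := ih hl' he' h hσ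
      have h2 := ih hl' he' h hO
      nlinarith [mul_le_mul_of_nonneg_left h1 (sub_nonneg.2 hy.2),
        mul_le_mul_of_nonneg_left h2 hy.1]

/-- Connectivity states together with the set of all positions of non-trivial steps. -/
def recAct (j : ℤ) (s : State × Set ℤ) : State × Set ℤ := (tl j s.1, insert j s.2)

/-- If the mark can be disconnected during a pass through distinct positions, then, comparably
often, it survives the pass in a fragile state. -/
lemma last_kill {b c : ℝ} (hb : b ≤ 1) (h0c : 0 ≤ c) {L : List (ℤ × ℝ)} (hL : ProbSteps L)
    {bad : Set ℤ → ℝ} (hbad0 : ∀ F, 0 ≤ bad F)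
    (I : State × Set ℤ → Prop) {l : List (ℤ × ℝ)} (hl : ∀ x ∈ l, 0 ≤ x.2 ∧ x.2 ≤ b)
    (hI : ∀ x ∈ l, ∀ s, I s → I (recAct x.1 s))
    (hd : (l.map Prod.fst).Pairwise (· > ·))
    (hkill : ∀ s n, I s → OnlyAt n s.1 → s.1 (.inr true) (.inl n) →
      c ≤ 1 - run tl L alive s.1 + bad s.2)
    {s : State × Set ℤ} (hs : I s) (ha : Alive s.1) :
    (1 - b) ^ 2 * c * (1 - run recAct l (fun s => alive s.1) s) ≤
      run recAct l (fun s => alive s.1 - run tl L alive s.1 + bad s.2) s := by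
  have hG : ∀ s : State × Set ℤ, 0 ≤ alive s.1 - run tl L alive s.1 + bad s.2 := fun s =>
    add_nonneg (sub_nonneg.2 (run_alive_le hL s.1)) (hbad0 s.2)
  have hb0 : 0 ≤ 1 - b := by linarith
  induction l generalizing s with
  | nil =>
    have := hG s
    simp only [run]
    rw [show alive s.1 = 1 from if_pos ha] at this ⊢
    simpa using this
  | cons x l ih =>
    obtain ⟨j, y⟩ := x
    have hy := hl _ (List.mem_cons_self ..)
    simp only at hy
    have hl' : ∀ x ∈ l, 0 ≤ x.2 ∧ x.2 ≤ b := fun x hx => hl x (List.mem_cons_of_mem _ hx)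
    have hI' : ∀ x ∈ l, ∀ s, I s → I (recAct x.1 s) :=
      fun x hx => hI x (List.mem_cons_of_mem _ hx)
    have hp : ProbSteps l := fun x hx => ⟨(hl' x hx).1, (hl' x hx).2.trans hb⟩
    rw [List.map_cons, List.pairwise_cons] at hd
    have ih1 := ih hl' hI' hd.2 hs ha
    simp only [run]
    by_cases hA : Alive (tl j s.1)
    · have ih2 := ih hl' hI' hd.2 (hI _ (List.mem_cons_self ..) s hs) hA
      simp only at ih2
      nlinarith [mul_le_mul_of_nonneg_left ih1 (sub_nonneg.2 (hy.2.trans hb)),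
        mul_le_mul_of_nonneg_left ih2 hy.1]
    · have hj : Even j := by
        by_contra hj
        obtain ⟨p, hp⟩ := ha
        exact hA ⟨p, by rw [tl_odd hj]; exact le_merge _ _ _ hp⟩
      have hO : OnlyAt j s.1 := fun p hp => by
        by_contra hpj
        exact hA ⟨p, (touch_tl_even hj _ p).2 ⟨hp, hpj⟩⟩
      have hT : s.1 (.inr true) (.inl j) := by
        obtain ⟨p, hp⟩ := ha
        rwa [hO p hp] at hp
      have hc1 : (l.map Prod.fst).count (j + 1) = 0 := List.count_eq_zero.2 fun h => by
        have := hd.1 _ h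
        omega
      have hc2 : (l.map Prod.fst).count (j - 1) ≤ 1 :=
        List.nodup_iff_count_le_one.1 (hd.2.imp fun h => ne_of_gt h) _
      have hne : ∀ x ∈ l, x.1 ≠ j := fun x hx => by
        have := hd.1 _ (List.mem_map_of_mem hx)
        omega
      have key := run_onlyAt (act := recAct) (φ := Prod.fst) (fun _ _ => rfl) (n := j) hb hl' hG h0c
        (fun s => I s ∧ s.1 (.inr true) (.inl j))
        (fun x hx s h => ⟨hI' x hx s h.1, by
          by_cases hx' : Even x.1
          · exact (touch_tl_even hx' _ _).2 ⟨h.2, (hne x hx).symm⟩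
          · show tl x.1 s.1 _ _
            rw [tl_odd hx']
            exact le_merge _ _ _ h.2⟩)
        (fun s h1 h2 => by
          rw [show alive s.1 = 1 from if_pos ⟨j, h2.2⟩]
          exact hkill s j h2.1 h1 h2.2) hO ⟨hs, hT⟩
      rw [hc1, add_zero] at key
      have h1 : (1 - b) ^ 1 ≤ (1 - b) ^ (l.map Prod.fst).count (j - 1) :=
        pow_le_pow_of_le_one hb0 (by linarith) hc2
      have h2 := run_nonneg (act := recAct) hp hG (recAct j s)
      have h3 := run_nonneg (act := recAct) hp (fun s => alive_nonneg s.1) s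
      have h4 := run_nonneg (act := recAct) hp (fun s => alive_nonneg s.1) (recAct j s)
      have h5 : (1 - b) * c ≤
          run recAct l (fun s => alive s.1 - run tl L alive s.1 + bad s.2) s :=
        le_trans (by rw [pow_one] at h1; exact mul_le_mul_of_nonneg_right h1 h0c) key
      have h6 : (1 - b) * ((1 - b) * c) ≤ (1 - y) *
          run recAct l (fun s => alive s.1 - run tl L alive s.1 + bad s.2) s :=
        mul_le_mul (by linarith) h5 (mul_nonneg hb0 h0c) (by linarith)
      have h7 : 0 ≤ (1 - b) ^ 2 * c := by positivity
      nlinarith [mul_nonneg hy.1 h2, mul_nonneg (mul_nonneg (sub_nonneg.2 (hy.2.trans hb)) h3) h7,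
        mul_nonneg (mul_nonneg hy.1 h4) h7]

/-- Bound for the probability that all positions of a finite set have seen non-trivial steps. -/
lemma run_flags {b : ℝ} (hb : b ≤ 1) {l : List (ℤ × ℝ)} (hl : ∀ x ∈ l, 0 ≤ x.2 ∧ x.2 ≤ b)
    (J : Finset ℤ) (F : Set ℤ) [DecidablePred fun F : Set ℤ => ∀ j ∈ J, j ∈ F]
    [DecidablePred (· ∈ F)] :
    run (fun j F => insert j F) l (fun F => if ∀ j ∈ J, j ∈ F then (1 : ℝ) else 0) F ≤
      ∏ j ∈ J, if j ∈ F then 1 else 1 - (1 - b) ^ (l.map Prod.fst).count j := by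
  classical
  have hb0 : 0 ≤ 1 - b := by linarith
  induction l generalizing F with
  | nil =>
    simp only [run]
    split_ifs with h
    · exact (Finset.prod_eq_one fun j hj => if_pos (h j hj)).ge
    · refine Finset.prod_nonneg fun j _ => ?_
      split_ifs <;> simp
  | cons x l ih =>
    obtain ⟨k, y⟩ := x
    have hy := hl _ (List.mem_cons_self ..)
    simp only at hy
    have hl' : ∀ x ∈ l, 0 ≤ x.2 ∧ x.2 ≤ b := fun x hx => hl x (List.mem_cons_of_mem _ hx)
    have ih1 := ih hl' F
    have ih2 := ih hl' (insert k F)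
    simp only [run, List.map_cons]
    have hb1 : 1 - b ≤ 1 := by
      obtain ⟨h1, h2⟩ := hy
      linarith
    have hy1 : 0 ≤ 1 - y := by linarith
    refine (add_le_add (mul_le_mul_of_nonneg_left ih1 hy1)
      (mul_le_mul_of_nonneg_left ih2 hy.1)).trans ?_
    by_cases hk : k ∈ J ∧ k ∉ F
    · rw [← Finset.mul_prod_erase J _ hk.1, ← Finset.mul_prod_erase J _ hk.1,
        ← Finset.mul_prod_erase J _ hk.1]
      have e1 : ∏ j ∈ J.erase k, (if j ∈ insert k F then (1 : ℝ) else
          1 - (1 - b) ^ (l.map Prod.fst).count j) = ∏ j ∈ J.erase k, (if j ∈ F then (1 : ℝ) else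
          1 - (1 - b) ^ (l.map Prod.fst).count j) := by
        refine Finset.prod_congr rfl fun j hj => ?_
        have : j ≠ k := Finset.ne_of_mem_erase hj
        simp [this]
      have e2 : ∏ j ∈ J.erase k, (if j ∈ F then (1 : ℝ) else
          1 - (1 - b) ^ (k :: l.map Prod.fst).count j) = ∏ j ∈ J.erase k, (if j ∈ F then (1 : ℝ) else
          1 - (1 - b) ^ (l.map Prod.fst).count j) := by
        refine Finset.prod_congr rfl fun j hj => ?_
        rw [List.count_cons_of_ne (Finset.ne_of_mem_erase hj).symm]
      rw [e1, e2, if_neg hk.2, if_neg hk.2, if_pos (mem_insert k F), List.count_cons_self]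
      set R := ∏ j ∈ J.erase k, (if j ∈ F then (1 : ℝ) else
          1 - (1 - b) ^ (l.map Prod.fst).count j) with hR
      have hR0 : 0 ≤ R := by
        refine Finset.prod_nonneg fun j _ => ?_
        split_ifs
        · norm_num
        · exact sub_nonneg.2 (pow_le_one₀ hb0 hb1)
      have h3 : 0 ≤ (1 - b) ^ (l.map Prod.fst).count k := pow_nonneg hb0 _
      rw [pow_succ]
      nlinarith [mul_nonneg (mul_nonneg h3 (sub_nonneg.2 hy.2)) hR0]
    · have e1 : ∏ j ∈ J, (if j ∈ insert k F then (1 : ℝ) else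
          1 - (1 - b) ^ (l.map Prod.fst).count j) = ∏ j ∈ J, (if j ∈ F then (1 : ℝ) else
          1 - (1 - b) ^ (l.map Prod.fst).count j) := by
        refine Finset.prod_congr rfl fun j hj => ?_
        by_cases hjk : j = k
        · subst hjk
          have : j ∈ F := by tauto
          simp [this]
        · simp [hjk]
      have e2 : ∏ j ∈ J, (if j ∈ F then (1 : ℝ) else
          1 - (1 - b) ^ (k :: l.map Prod.fst).count j) = ∏ j ∈ J, (if j ∈ F then (1 : ℝ) else
          1 - (1 - b) ^ (l.map Prod.fst).count j) := by
        refine Finset.prod_congr rfl fun j hj => ?_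
        by_cases hjk : j = k
        · subst hjk
          have : j ∈ F := by tauto
          simp [this]
        · rw [List.count_cons_of_ne (Ne.symm hjk)]
      rw [e1, e2]
      apply le_of_eq
      ring

end LastKill

section Profiles

lemma raises_of_nodup {h : ℤ → ℤ} {ps : List ℤ} (hps : ps.Nodup) (p : ℤ) :
    raises h ps p = if p ∈ ps then h p + 2 else h p := by
  induction ps generalizing h with
  | nil => rfl
  | cons a ps ih =>
    obtain ⟨h1, h2⟩ := List.nodup_cons.1 hps
    have : raises h (a :: ps) p = raises (raise h a) ps p := rfl
    rw [this, ih h2]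
    by_cases hpa : p = a
    · subst hpa
      simp [h1, raise]
    · simp [hpa, raise]

lemma validFlips_of_nodup {lo hi : ℤ} {h : ℤ → ℤ} {ps : List ℤ} (hps : ps.Nodup)
    (h1 : ∀ p ∈ ps, h (p - 1) = h p + 1 ∧ h (p + 1) = h p + 1)
    (h2 : ∀ p ∈ ps, lo ≤ p ∧ p + 1 < hi) (h3 : ∀ p ∈ ps, ∀ p' ∈ ps, p' ≠ p + 1) :
    ValidFlips lo hi h ps := by
  induction ps generalizing h with
  | nil => trivial
  | cons a ps ih =>
    obtain ⟨h4, h5⟩ := List.nodup_cons.1 hps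
    refine ⟨h1 a (by simp), h2 a (by simp), ih h5 (fun p hp => ?_)
      (fun p hp => h2 p (by simp [hp])) fun p hp p' hp' => h3 p (by simp [hp]) p' (by simp [hp'])⟩
    have e1 := h1 p (by simp [hp])
    have e2 := h3 p (by simp [hp]) a (by simp)
    have e3 := h3 a (by simp) p (by simp [hp])
    have e4 : p ≠ a := fun h => h4 (h ▸ hp)
    simp only [raise]
    rw [Function.update_of_ne (by omega), Function.update_of_ne (by omega),
      Function.update_of_ne (by omega)]
    exact e1

/-- Positions of the parity of `s` in `[-z, z]`. -/
noncomputable def layer (z s : ℤ) : List ℤ :=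
  ((Finset.Icc (-z) z).filter fun p => (p - s) % 2 = 0).toList

lemma mem_layer {z s p : ℤ} : p ∈ layer z s ↔ (-z ≤ p ∧ p ≤ z) ∧ (p - s) % 2 = 0 := by
  simp [layer]

lemma layer_nodup (z s : ℤ) : (layer z s).Nodup := Finset.nodup_toList _

/-- The initial profile: a cone of height `m`, continued by a zigzag line. -/
def cone (m p : ℤ) : ℤ := if max p (-p) ≤ m then max p (-p) else if p % 2 = 0 then m else m - 1

/-- The half-widths of the layers: the cone is filled, then long layers are added. -/
def width (m Z : ℤ) (s : ℕ) : ℤ := if (s : ℤ) < m - 1 then s else Z - (s - (m - 1))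

/-- The first `s` layers. -/
noncomputable def prog (m Z : ℤ) : ℕ → List ℤ
  | 0 => []
  | s + 1 => prog m Z s ++ layer (width m Z s) s

/-- The profile after `s` layers. -/
noncomputable def profile (m Z : ℤ) (s : ℕ) : ℤ → ℤ := raises (cone m) (prog m Z s)

lemma profile_succ (m Z : ℤ) (s : ℕ) (p : ℤ) : profile m Z (s + 1) p =
    if p ∈ layer (width m Z s) s then profile m Z s p + 2 else profile m Z s p := by
  rw [profile, prog, raises_append, raises_of_nodup (layer_nodup _ _)]
  rfl

lemma profile_spec {m Z : ℤ} (hm : 2 ≤ m) (hm2 : m % 2 = 0) (s : ℕ) :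
    (∀ p, max p (-p) ≤ width m Z s + 1 →
      profile m Z s p = if (p - s) % 2 = 0 then (s : ℤ) else s + 1) ∧
    ((s : ℤ) ≤ m - 1 → ∀ p : ℤ, (s : ℤ) ≤ max p (-p) → profile m Z s p = cone m p) := by
  induction s with
  | zero =>
    refine ⟨fun p hp => ?_, fun _ _ _ => rfl⟩
    have : profile m Z 0 p = cone m p := rfl
    rw [this]
    simp only [width, cone] at *
    push_cast at *
    split_ifs at * <;> omega
  | succ s ih =>
    obtain ⟨ih1, ih2⟩ := ih
    constructor
    · intro p hp
      rw [profile_succ]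
      simp only [mem_layer]
      have e1 := ih1 p
      have e2 := fun h => ih2 h p
      simp only [width, cone] at *
      push_cast at *
      split_ifs at * <;> omega
    · intro hs p hp
      rw [profile_succ]
      simp only [mem_layer]
      have e2 := fun h => ih2 h p
      simp only [width, cone] at *
      push_cast at *
      split_ifs at * <;> omega

lemma prog_valid {m Z : ℤ} (hm : 2 ≤ m) (hm2 : m % 2 = 0) (hZ : m ≤ Z) (s : ℕ) :
    ValidFlips (-Z) (Z + 2) (cone m) (prog m Z s) := by
  induction s with
  | zero => trivial
  | succ s ih =>
    refine ih.append ?_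
    have hsp := (profile_spec (Z := Z) hm hm2 s).1
    refine validFlips_of_nodup (layer_nodup _ _) (fun p hp => ?_) (fun p hp => ?_)
      fun p hp p' hp' => ?_
    · rw [mem_layer] at hp
      have e1 := hsp p
      have e2 := hsp (p - 1)
      have e3 := hsp (p + 1)
      change profile m Z s (p - 1) = profile m Z s p + 1 ∧
        profile m Z s (p + 1) = profile m Z s p + 1
      split_ifs at * <;> omega
    · rw [mem_layer] at hp
      simp only [width] at hp
      split_ifs at hp <;> omega
    · rw [mem_layer] at hp hp'
      omega

lemma prog_count (m Z : ℤ) (s : ℕ) (j : ℤ) : (prog m Z s).count j ≤ s := by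
  induction s with
  | zero => simp [prog]
  | succ s ih =>
    rw [prog, List.count_append]
    have := List.nodup_iff_count_le_one.1 (layer_nodup (width m Z s) s) j
    omega

lemma map_fst_track (q : ℝ) (lo : ℤ) (h : ℤ → ℤ) (i : ℤ) (n : ℕ) :
    ((track q lo h i n).map Prod.fst).Pairwise (· > ·) := by
  induction n with
  | zero => simp [track]
  | succ n ih =>
    rw [track, List.map_cons, List.pairwise_cons]
    refine ⟨fun a ha => ?_, ih⟩
    obtain ⟨x, hx, rfl⟩ := List.mem_map.1 ha
    obtain ⟨c, h1, h2, rfl⟩ := track_mem hx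
    simp only
    omega

lemma tracks_count (q : ℝ) (lo : ℤ) (n : ℕ) (h : ℤ → ℤ) (k : ℕ) (j : ℤ) :
    ((tracks q lo n h k).map Prod.fst).count j ≤ k := by
  induction k with
  | zero => simp [tracks]
  | succ k ih =>
    rw [tracks, List.map_append, List.count_append]
    have := List.nodup_iff_count_le_one.1 ((map_fst_track q lo h k n).imp fun h => ne_of_gt h) j
    omega

end Profiles

section Colors

/-- Connected labels have the same colour. -/
def RespectsColor (c : Label → Prop) (σ : State) : Prop := ∀ x y, σ x y → (c x ↔ c y)

lemma RespectsColor.tl {c : Label → Prop} {σ : State} (h : RespectsColor c σ) {j : ℤ}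
    (hj : ¬ Even j → (c (.inl (j - 1)) ↔ c (.inl (j + 1)))) : RespectsColor c (tl j σ) := by
  intro x y hxy
  by_cases hj' : Even j
  · rw [tl_even hj', isolate_iff] at hxy
    rcases hxy with rfl | hxy
    exacts [Iff.rfl, h _ _ hxy.1]
  · rw [tl_odd hj', merge_iff] at hxy
    rcases hxy with h1 | ⟨h1, h2⟩ | ⟨h1, h2⟩
    · exact h _ _ h1
    · exact (h _ _ h1).trans ((hj hj').trans (h _ _ h2))
    · exact (h _ _ h1).trans ((hj hj').symm.trans (h _ _ h2))

/-- The colour of the sites satisfying `f`, and of the marks. -/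
def siteColor (f : ℤ → Prop) : Label → Prop := Sum.elim f fun _ => True

/-- Two layers of flips kill a mark which is connected to a single site. -/
lemma run_two_layers {q : ℝ} (h0 : 0 ≤ q) (h1 : q ≤ 1) {n i : ℤ} {L₁ L₂ : List ℤ} (hL : L₁.Nodup)
    (h : ((∀ p ∈ L₁, Even (p + i)) ∧ n - i ∈ L₁) ∨ ((∀ p ∈ L₂, Even (p + i)) ∧ n - i ∈ L₂))
    {σ : State} (hσ : OnlyAt n σ) :
    run tl (flips q i L₁ ++ flips q i L₂) alive σ ≤ 1 - (1 - q) ^ 2 * q := by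
  have hp : ∀ L, ProbSteps (flips q i L) := fun L => flips_prob h0 h1 i L
  have hmem : ∀ L, n - i ∈ L → (n, q) ∈ flips q i L := fun L hL =>
    List.mem_map.2 ⟨n - i, hL, by simp⟩
  have heven : ∀ L : List ℤ, (∀ p ∈ L, Even (p + i)) → ∀ x ∈ flips q i L, Even x.1 := by
    intro L hL x hx
    obtain ⟨p, hp, rfl⟩ := List.mem_map.1 hx
    exact hL p hp
  have hq : 0 ≤ 1 - q := by linarith
  rw [run_append]
  rcases h with ⟨h2, h3⟩ | ⟨h2, h3⟩
  · refine (run_mono (hp _) (fun s => run_alive_le (hp L₂) s) σ).trans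
      ((run_kill (hp _) (heven _ h2) (hmem _ h3) hσ).trans ?_)
    have : (1 - q) ^ 2 ≤ 1 := pow_le_one₀ hq (by linarith)
    nlinarith
  · have key := run_onlyAt (act := tl) (φ := id) (fun _ _ => rfl) (n := n) h1 (l := flips q i L₁)
      (g := fun s => 1 - run tl (flips q i L₂) alive s) (c := q)
      (fun x hx => by
        obtain ⟨p, -, rfl⟩ := List.mem_map.1 hx
        exact ⟨h0, le_rfl⟩)
      (fun s => sub_nonneg.2 (run_le_one (hp _) alive_le_one s)) h0 (fun _ => True)
      (fun _ _ _ _ => trivial)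
      (fun s h _ => by
        have := run_kill (hp L₂) (heven _ h2) (hmem _ h3) h
        simp only [id] at *
        linarith) (s := σ) hσ trivial
    rw [run_sub, run_const] at key
    have hcount : ((flips q i L₁).map Prod.fst).count (n - 1) +
        ((flips q i L₁).map Prod.fst).count (n + 1) ≤ 2 := by
      have hnd : ((flips q i L₁).map Prod.fst).Nodup := by
        rw [flips, List.map_map]
        exact hL.map fun a b h => by simpa using h
      have e1 := List.nodup_iff_count_le_one.1 hnd (n - 1)
      have e2 := List.nodup_iff_count_le_one.1 hnd (n + 1)
      omega
    have := pow_le_pow_of_le_one hq (by linarith : 1 - q ≤ 1) hcount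
    have := mul_le_mul_of_nonneg_right this h0
    linarith

end Colors

section Survival

/-- The survival probability of the mark after `s` layers and `i` tracks. -/
noncomputable def survival (q : ℝ) (w Z : ℕ) (σ : State) (i s : ℕ) : ℝ :=
  run tl (flips q 0 (prog (w + 1) Z s))
    (run tl (tracks q (-Z) (2 * Z + 2) (profile (w + 1) Z s) i) alive) σ

lemma flips_append (q : ℝ) (i : ℤ) (ps ps' : List ℤ) :
    flips q i (ps ++ ps') = flips q i ps ++ flips q i ps' := List.map_append

variable {q : ℝ} {w Z : ℕ}

lemma flips_tracks_prog (hq : q < 1 / 2) (hw : Odd w) (hZ : w + 1 ≤ Z)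
    {s t : ℕ} {L : List ℤ} (hL : prog (w + 1) Z t = prog (w + 1) Z s ++ L) (i : ℕ) (σ : State) :
    survival q w Z σ i t = run tl (flips q 0 (prog (w + 1) Z s))
      (run tl (tracks q (-Z) (2 * Z + 2) (profile (w + 1) Z s) i) (run tl (flips q i L) alive))
        σ := by
  have hval := prog_valid (m := w + 1) (Z := Z) (by have := hw.pos; omega)
    (by obtain ⟨r, rfl⟩ := hw; omega) (by omega) t
  rw [hL] at hval
  have hv : ValidFlips (-Z) (-Z + (2 * Z + 2 : ℕ)) (profile (w + 1) Z s) L := by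
    have : ∀ {h : ℤ → ℤ} {ps ps' : List ℤ}, ValidFlips (-Z) (Z + 2) h (ps ++ ps') →
        ValidFlips (-Z) (Z + 2) (raises h ps) ps' := by
      intro h ps ps' h1
      induction ps generalizing h with
      | nil => exact h1
      | cons a ps ih => exact ih h1.2.2
    have e : (-Z + (2 * Z + 2 : ℕ) : ℤ) = Z + 2 := by push_cast; ring
    rw [e]
    exact this hval
  have key := run_flips_tracks hq hv i alive
  unfold profile at key
  rw [survival, profile, hL, flips_append, run_append, raises_append, key]
  rfl

lemma prog_two (m Z' : ℤ) (s : ℕ) : prog m Z' (s + 2) = prog m Z' s ++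
    (layer (width m Z' s) s ++ layer (width m Z' (s + 1)) (s + 1 : ℕ)) := by
  rw [prog, prog, List.append_assoc]

/-- All connections in `σ` are between marks and even sites in `[-m, m]`. -/
def Inside (m : ℤ) (σ : State) : Prop :=
  ∀ x y, σ x y → x = y ∨ (Sum.elim (fun p => Even p ∧ -m ≤ p ∧ p ≤ m) (fun _ => True) x ∧
    Sum.elim (fun p => Even p ∧ -m ≤ p ∧ p ≤ m) (fun _ => True) y)

/-- The invariant of the recorded evolution: no connections across unused odd positions. -/
def CutInv (Jr Jl : Finset ℤ) (s : State × Set ℤ) : Prop :=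
  RespectsColor (siteColor Even) s.1 ∧
    (∀ j ∈ Jr, j ∉ s.2 → RespectsColor (siteColor (· < j)) s.1) ∧
    ∀ j ∈ Jl, j ∉ s.2 → RespectsColor (siteColor (j < ·)) s.1

lemma CutInv.step {Jr Jl : Finset ℤ} (hr : ∀ j ∈ Jr, Odd j) (hl : ∀ j ∈ Jl, Odd j)
    {s : State × Set ℤ} (h : CutInv Jr Jl s) (j : ℤ) : CutInv Jr Jl (recAct j s) := by
  obtain ⟨h1, h2, h3⟩ := h
  refine ⟨h1.tl fun hj => ?_, fun j' hj' hF => ?_, fun j' hj' hF => ?_⟩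
  · change Even (j - 1) ↔ Even (j + 1)
    simp only [Int.even_iff] at *
    omega
  · have hF : j' ∉ insert j s.2 := hF
    rw [mem_insert_iff, not_or] at hF
    refine (h2 j' hj' hF.2).tl fun hj => ?_
    have := hr j' hj'
    change j - 1 < j' ↔ j + 1 < j'
    rw [Int.odd_iff] at this
    rw [Int.even_iff] at hj
    have := hF.1
    omega
  · have hF : j' ∉ insert j s.2 := hF
    rw [mem_insert_iff, not_or] at hF
    refine (h3 j' hj' hF.2).tl fun hj => ?_
    have := hl j' hj'
    change j' < j - 1 ↔ j' < j + 1
    rw [Int.odd_iff] at this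
    rw [Int.even_iff] at hj
    have := hF.1
    omega

lemma Inside.cutInv {m : ℤ} {σ : State} (h : Inside m σ) {Jr Jl : Finset ℤ}
    (hr : ∀ j ∈ Jr, m < j) (hl : ∀ j ∈ Jl, j < -m) (F : Set ℤ) : CutInv Jr Jl (σ, F) := by
  refine ⟨fun x y hxy => ?_, fun j hj _ x y hxy => ?_, fun j hj _ x y hxy => ?_⟩
  · rcases h x y hxy with rfl | ⟨h1, h2⟩
    · rfl
    · rcases x with x | x <;> rcases y with y | y <;> simp_all [siteColor]
  · have := hr j hj
    rcases h x y hxy with rfl | ⟨h1, h2⟩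
    · rfl
    · rcases x with x | x <;> rcases y with y | y <;> simp only [siteColor, Sum.elim_inl,
        Sum.elim_inr] at * <;> first | omega | (simp; try omega)
  · have := hl j hj
    rcases h x y hxy with rfl | ⟨h1, h2⟩
    · rfl
    · rcases x with x | x <;> rcases y with y | y <;> simp only [siteColor, Sum.elim_inl,
        Sum.elim_inr] at * <;> first | omega | (simp; try omega)

open Classical in
/-- Indicator that no unused position is left on one of the sides. -/
noncomputable def noCut (Jr Jl : Finset ℤ) (F : Set ℤ) : ℝ :=
  (if ∀ j ∈ Jr, j ∈ F then 1 else 0) + if ∀ j ∈ Jl, j ∈ F then 1 else 0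

lemma noCut_nonneg (Jr Jl : Finset ℤ) (F : Set ℤ) : 0 ≤ noCut Jr Jl F := by
  unfold noCut
  positivity

lemma one_le_noCut {Jr Jl : Finset ℤ} {F : Set ℤ} (h : (∀ j ∈ Jr, j ∈ F) ∨ ∀ j ∈ Jl, j ∈ F) :
    1 ≤ noCut Jr Jl F := by
  unfold noCut
  split_ifs with h1 h2 h2
  · norm_num
  · norm_num
  · norm_num
  · exact absurd h (not_or.2 ⟨h1, h2⟩)

lemma run_noCut {b : ℝ} (hb0 : 0 ≤ b) (hb : b ≤ 1) {l : List (ℤ × ℝ)}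
    (hl : ∀ x ∈ l, 0 ≤ x.2 ∧ x.2 ≤ b) {T r : ℕ} (hT : ∀ j, (l.map Prod.fst).count j ≤ T)
    {Jr Jl : Finset ℤ} (hJr : Jr.card = r) (hJl : Jl.card = r) (σ : State) :
    run recAct l (fun s => noCut Jr Jl s.2) (σ, ∅) ≤ 2 * (1 - (1 - b) ^ T) ^ r := by
  classical
  rw [run_map (act' := fun j F => insert j F) (φ := Prod.snd) (fun _ _ => rfl)]
  have key : ∀ J : Finset ℤ, J.card = r → run (fun j F => insert j F) l
      (fun F : Set ℤ => if ∀ j ∈ J, j ∈ F then (1 : ℝ) else 0) ∅ ≤ (1 - (1 - b) ^ T) ^ r := by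
    intro J hJ
    refine (run_flags hb hl J ∅).trans ?_
    rw [← hJ, ← Finset.prod_const]
    have h1 : ∀ n, (1 - b) ^ n ≤ 1 := fun n => pow_le_one₀ (sub_nonneg.2 hb) (by linarith)
    refine Finset.prod_le_prod (fun j _ => ?_) fun j _ => ?_ <;>
      simp only [mem_empty_iff_false, if_false]
    · exact sub_nonneg.2 (h1 _)
    · have := pow_le_pow_of_le_one (sub_nonneg.2 hb) (by linarith) (hT j)
      linarith
  have e := run_add (act := fun j (F : Set ℤ) => insert j F) l
    (fun F => if ∀ j ∈ Jr, j ∈ F then (1 : ℝ) else 0)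
    (fun F => if ∀ j ∈ Jl, j ∈ F then (1 : ℝ) else 0) ∅
  have h1 := key Jr hJr
  have h2 := key Jl hJl
  have e3 : (noCut Jr Jl : Set ℤ → ℝ) = fun F => (if ∀ j ∈ Jr, j ∈ F then (1 : ℝ) else 0) +
      if ∀ j ∈ Jl, j ∈ F then (1 : ℝ) else 0 := by
    ext F
    unfold noCut
    congr
  rw [e3]
  change run _ _ _ ∅ ≤ _
  rw [e]
  linarith

end Survival

section SurvivalStep

variable {q : ℝ} {w Z : ℕ}

lemma survival_step (h0 : 0 < q) (hq : q < 1 / 2) (hw : Odd w) {s i r : ℕ} (hs : w ≤ s)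
    {Jr Jl : Finset ℤ} (hJr : Jr.card = r) (hJl : Jl.card = r)
    (hr : ∀ j ∈ Jr, Odd j ∧ w + 1 < j ∧ j + i + s + 2 ≤ Z + w)
    (hl : ∀ j ∈ Jl, Odd j ∧ j < -(w + 1) ∧ -j + i + s + 2 ≤ Z + w) (hZ : w + 1 ≤ Z)
    {σ : State} (hσ : Inside (w + 1) σ) :
    (1 - yDown q) ^ 2 * ((1 - q) ^ 2 * q) * (survival q w Z σ i s - survival q w Z σ (i + 1) s) ≤
      survival q w Z σ (i + 1) s - survival q w Z σ (i + 1) (s + 2) +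
        2 * (1 - (1 - yDown q) ^ (s + i + 1)) ^ r := by
  have hb := yDown_lt_one hq
  have hb2 := le_yDown h0 hq
  set b := yDown q with hbdef
  set L := layer (width (w + 1) Z s) s ++ layer (width (w + 1) Z (s + 1)) (s + 1 : ℕ) with hL
  set A := flips q 0 (prog (w + 1) Z s) with hA
  set n : ℕ := 2 * Z + 2 with hn
  set h := profile (w + 1) Z s with hh
  set Tr := tracks q (-Z) n h i with hTr
  set t := track q (-Z) h i n with ht
  set L' := flips q ((i + 1 : ℕ) : ℤ) L with hL'
  have hAP : ProbSteps A := flips_prob h0.le (by linarith) _ _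
  have hTP : ProbSteps Tr := tracks_prob h0 hq _
  have htP : ProbSteps t := track_prob h0 hq
  have hLP : ProbSteps L' := flips_prob h0.le (by linarith) _ _
  set g : State × Set ℤ → ℝ := fun s => alive s.1 - run tl L' alive s.1 + noCut Jr Jl s.2 with hg
  set a : State × Set ℤ → ℝ := fun s => alive s.1 with ha
  have e0 : ∀ l f, run recAct l (fun s => f s.1) (σ, ∅) = run tl l f σ := fun l f =>
    run_map (φ := Prod.fst) (fun _ _ => rfl) l f _
  have e1 : survival q w Z σ i s = run recAct (A ++ Tr) a (σ, ∅) := by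
    rw [ha, e0, run_append]
    rfl
  have e2 : survival q w Z σ (i + 1) s = run recAct (A ++ Tr) (run recAct t a) (σ, ∅) := by
    rw [← run_append, ha, e0, List.append_assoc, run_append]
    rfl
  have e3 : survival q w Z σ (i + 1) (s + 2) =
      run recAct (A ++ Tr ++ t) (fun s => run tl L' alive s.1) (σ, ∅) := by
    rw [flips_tracks_prog hq hw hZ (prog_two _ _ _), e0, List.append_assoc, run_append]
    rfl
  have hinv : ∀ j s, CutInv Jr Jl s → CutInv Jr Jl (recAct j s) := fun j s hs =>
    hs.step (fun j hj => (hr j hj).1) (fun j hj => (hl j hj).1) j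
  have hcol : ∀ x ∈ t, 0 ≤ x.2 ∧ x.2 ≤ b := by
    intro x hx
    obtain ⟨c, -, -, rfl⟩ := track_mem hx
    exact yCol_mem h0 hq _ _
  have key : ∀ s', CutInv Jr Jl s' →
      (1 - b) ^ 2 * ((1 - q) ^ 2 * q) * (a s' - run recAct t a s') ≤ run recAct t g s' := by
    intro s' hs'
    have hgn : ∀ s, 0 ≤ g s := fun s =>
      add_nonneg (sub_nonneg.2 (run_alive_le hLP _)) (noCut_nonneg _ _ _)
    by_cases hal : Alive s'.1
    · have ha1 : a s' = 1 := by simp [ha, alive, hal]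
      rw [ha1]
      refine last_kill hb.le (by positivity) hLP (noCut_nonneg Jr Jl) (CutInv Jr Jl) hcol
        (fun x _ s => hinv x.1 s) (map_fst_track _ _ _ _ _) ?_ hs' hal
      rintro ⟨s1, F⟩ k hI hk1 hk2
      by_cases hcutr : ∀ j ∈ Jr, j ∈ F
      · have := one_le_noCut (Jr := Jr) (Jl := Jl) (F := F) (Or.inl hcutr)
        have h1 := run_le_one (act := tl) hLP alive_le_one s1
        have h2 : (1 - q) ^ 2 * q ≤ 1 := by nlinarith
        simp only
        linarith
      by_cases hcutl : ∀ j ∈ Jl, j ∈ F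
      · have := one_le_noCut (Jr := Jr) (Jl := Jl) (F := F) (Or.inr hcutl)
        have h1 := run_le_one (act := tl) hLP alive_le_one s1
        have h2 : (1 - q) ^ 2 * q ≤ 1 := by nlinarith
        simp only
        linarith
      push Not at hcutr hcutl
      obtain ⟨j, hj, hjF⟩ := hcutr
      obtain ⟨j', hj', hjF'⟩ := hcutl
      have c1 : Even k := (hI.1 _ _ hk2).1 trivial
      have c2 : k < j := (hI.2.1 j hj hjF _ _ hk2).1 trivial
      have c3 : j' < k := (hI.2.2 j' hj' hjF' _ _ hk2).1 trivial
      have d1 := hr j hj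
      have d2 := hl j' hj'
      have := run_two_layers (q := q) (n := k) (i := ((i + 1 : ℕ) : ℤ)) (σ := s1)
        (L₁ := layer (width (w + 1) Z s) s) (L₂ := layer (width (w + 1) Z (s + 1)) (s + 1 : ℕ))
        h0.le (by linarith) (layer_nodup _ _) (by
          rw [Int.even_iff] at c1
          have hw1 : width (w + 1) Z s = Z - (s - w) := by
            rw [width, if_neg (by omega)]; ring
          have hw2 : width (w + 1) Z (s + 1) = Z - (s + 1 - w) := by
            rw [width, if_neg (by push_cast; omega)]; push_cast; ring
          rcases Int.emod_two_eq_zero_or_one (s + i + 1 : ℤ) with hpar | hpar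
          · left
            refine ⟨fun p hp => ?_, ?_⟩
            · rw [mem_layer] at hp
              rw [Int.even_iff]
              push_cast
              omega
            · rw [mem_layer, hw1]
              push_cast
              omega
          · right
            refine ⟨fun p hp => ?_, ?_⟩
            · rw [mem_layer] at hp
              rw [Int.even_iff]
              push_cast at *
              omega
            · rw [mem_layer, hw2]
              push_cast
              omega) hk1
      have hnn := noCut_nonneg Jr Jl F
      rw [← flips_append] at this
      change run tl L' alive s1 ≤ _ at this
      simp only
      linarith
    · have ha0 : a s' = 0 := by simp [ha, alive, hal]
      have : run recAct t a s' = 0 := by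
        rw [ha, run_map (φ := Prod.fst) (act' := tl) (fun _ _ => rfl), run_dead_of_dead htP hal]
      rw [ha0, this]
      simpa using run_nonneg htP hgn s'
  have main := run_mono_of_inv (act := recAct) (l := A ++ Tr) (CutInv Jr Jl)
    (fun x _ s => hinv x.1 s) (hAP.append hTP) key (s := (σ, ∅))
    (hσ.cutInv (fun j hj => (hr j hj).2.1) (fun j hj => (hl j hj).2.1) _)
  rw [run_const_mul, run_sub, ← e1, ← e2, ← run_append, hg, run_add, run_sub, ← e3] at main
  have e4 : run recAct (A ++ Tr ++ t) (fun s => alive s.1) (σ, ∅) =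
      survival q w Z σ (i + 1) s := by rw [e2, ← run_append]
  rw [e4] at main
  refine main.trans (add_le_add le_rfl (run_noCut (by linarith) hb.le ?_ (fun j => ?_) hJr hJl σ))
  · intro x hx
    rcases List.mem_append.1 hx with hx | hx
    · rcases List.mem_append.1 hx with hx | hx
      · obtain ⟨p, -, rfl⟩ := List.mem_map.1 hx
        exact ⟨h0.le, by simp only; linarith⟩
      · have : ∀ k, ∀ x ∈ tracks q (-Z) n h k, 0 ≤ x.2 ∧ x.2 ≤ b := by
          intro k
          induction k with
          | zero => simp [tracks]
          | succ k ih =>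
            intro x hx
            rcases List.mem_append.1 hx with hx | hx
            · exact ih x hx
            · obtain ⟨c, -, -, rfl⟩ := track_mem hx
              exact yCol_mem h0 hq _ _
        exact this i x hx
    · exact hcol x hx
  · have f1 := tracks_count q (-Z) n h (i + 1) j
    have f2 := prog_count (w + 1) Z s j
    have f3 : A.map Prod.fst = prog (w + 1) Z s := by
      rw [hA, flips, List.map_map]
      simp [Function.comp_def]
    rw [List.append_assoc, List.map_append, List.count_append, f3]
    change _ + ((tracks q (-Z) n h (i + 1)).map Prod.fst).count j ≤ _
    omega

lemma two_step_bound {U : ℕ → ℕ → ℝ} {κ err : ℝ} (hκ : 0 < κ) (herr : 0 ≤ err) {M N : ℕ}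
    (hU0 : ∀ i j, 0 ≤ U i j) (hU1 : U 0 N ≤ 1) (hUj : ∀ i j, U i (j + 1) ≤ U i j)
    (hU : ∀ i j, i < M → j < N → κ * (U i j - U (i + 1) j) ≤ U (i + 1) j - U (i + 1) (j + 1) + err)
    {η : ℝ} (hη : η = κ / (1 + κ)) :
    ∀ i ≤ M, ∀ j ≤ N,
      U 0 N - (2 - η) ^ i * (1 - η / 2) ^ (N - j) - (i + (N - j : ℕ)) * err ≤ U i j := by
  have hη0 : 0 < η := by rw [hη]; positivity
  have hη1 : η < 1 := by rw [hη, div_lt_one (by linarith)]; linarith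
  have step : ∀ i j, i < M → j < N →
      η * U i j + (1 - η) * U (i + 1) (j + 1) - err ≤ U (i + 1) j := by
    intro i j hi hj
    have h1 := hU i j hi hj
    have h2 : κ = η * (1 + κ) := by rw [hη]; field_simp
    have h3 : (1 - η) * (1 + κ) = 1 := by linarith
    have h4 : (1 + κ) * (η * U i j + (1 - η) * U (i + 1) (j + 1) - err) ≤
        (1 + κ) * U (i + 1) j := by
      have : (1 + κ) * (η * U i j + (1 - η) * U (i + 1) (j + 1) - err) =
          κ * U i j + U (i + 1) (j + 1) - (1 + κ) * err := by
        linear_combination (-U i j) * h2 + U (i + 1) (j + 1) * h3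
      nlinarith
    exact le_of_mul_le_mul_left h4 (by linarith)
  intro i
  induction i with
  | zero =>
    intro _ j hj
    have hanti : ∀ d, U 0 (j + d) ≤ U 0 j := by
      intro d
      induction d with
      | zero => exact le_rfl
      | succ d ih => exact (hUj 0 (j + d)).trans ih
    have h1 := hanti (N - j)
    rw [Nat.add_sub_cancel' hj] at h1
    have h2 : 0 ≤ (1 - η / 2) ^ (N - j) := pow_nonneg (by linarith) _
    have h3 : 0 ≤ ((N - j : ℕ) : ℝ) * err := by positivity
    push_cast
    simp only [pow_zero, one_mul, zero_add]
    linarith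
  | succ i ih =>
    intro hi j hj
    obtain ⟨d, rfl⟩ := Nat.exists_eq_add_of_le hj
    clear hj
    rw [Nat.add_sub_cancel_left]
    induction d generalizing j with
    | zero =>
      have h1 : 1 ≤ (2 - η) ^ (i + 1) := one_le_pow₀ (by linarith)
      have h2 := hU0 (i + 1) j
      have h3 : 0 ≤ ((i + 1 : ℕ) : ℝ) * err := by positivity
      simp only [pow_zero, mul_one, Nat.cast_zero, add_zero] at *
      linarith
    | succ d ihd =>
      have h1 := step i j (by omega) (by omega)
      have h2 := ih (by omega) j (by omega)
      rw [Nat.add_sub_cancel_left] at h2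
      have e : j + (d + 1) = j + 1 + d := by ring
      have h3 : U 0 (j + (d + 1)) - (2 - η) ^ (i + 1) * (1 - η / 2) ^ d -
          (((i + 1 : ℕ) : ℝ) + (d : ℕ)) * err ≤ U (i + 1) (j + 1) := by
        have := ihd (j + 1) (by rwa [← e]) (by rwa [← e]) (by rwa [← e])
          (by rwa [← e])
        rwa [e]
      have h4 := mul_le_mul_of_nonneg_left h2 hη0.le
      have h5 := mul_le_mul_of_nonneg_left h3 (sub_nonneg.2 hη1.le)
      have h6 : η * ((2 - η) ^ i * (1 - η / 2) ^ (d + 1)) +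
          (1 - η) * ((2 - η) ^ (i + 1) * (1 - η / 2) ^ d) =
          (2 - η) ^ (i + 1) * (1 - η / 2) ^ (d + 1) := by ring
      push_cast at *
      nlinarith

end SurvivalStep

section SurvivalBound

lemma survival_zero (q : ℝ) (w Z : ℕ) (σ : State) (s : ℕ) :
    survival q w Z σ 0 s = run tl (flips q 0 (prog (w + 1) Z s)) alive σ := rfl

/-- Comparison of the flipped interface with the tracks: the mark survives `M` tracks with almost
the probability with which it survives the filling of the cone and of `K * M` further double
layers. -/
theorem survival_le_tracks {q : ℝ} (h0 : 0 < q) (hq : q < 1 / 2) {ε : ℝ} (hε : 0 < ε) :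
    ∃ K : ℕ, ∀ M w : ℕ, 1 ≤ M → Odd w → ∃ Z₀ : ℕ, ∀ Z, Z₀ ≤ Z → ∀ σ, Inside (w + 1) σ →
      run tl (flips q 0 (prog (w + 1) Z (w + 2 * (K * M)))) alive σ ≤
        run tl (tracks q (-Z) (2 * Z + 2) (cone (w + 1)) M) alive σ + ε := by
  have hb := yDown_lt_one hq
  have hb2 := le_yDown h0 hq
  set b := yDown q with hbdef
  set κ := (1 - b) ^ 2 * ((1 - q) ^ 2 * q) with hκ
  have hκ0 : 0 < κ := by
    have : 0 < 1 - b := by linarith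
    have : 0 < 1 - q := by linarith
    positivity
  set η := κ / (1 + κ) with hη
  have hη0 : 0 < η := by positivity
  have hη1 : η < 1 := by rw [hη, div_lt_one (by linarith)]; linarith
  obtain ⟨δ, hδ0, hδ1, hδε⟩ : ∃ δ : ℝ, 0 < δ ∧ δ ≤ 1 ∧ δ ≤ ε / 2 :=
    ⟨min 1 (ε / 2), by positivity, min_le_left _ _, min_le_right _ _⟩
  obtain ⟨K, hK⟩ := exists_pow_lt_of_lt_one (show (0:ℝ) < δ / (2 - η) by
    apply div_pos hδ0; linarith) (show 1 - η / 2 < 1 by linarith)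
  rw [lt_div_iff₀ (by linarith)] at hK
  refine ⟨K, fun M w hM hw => ?_⟩
  set N := K * M with hN
  set T := w + 2 * N + M + 1 with hT
  have hρ0 : 0 < (1 - b) ^ T := pow_pos (by linarith) _
  have hρ1 : (1 - b) ^ T ≤ 1 := pow_le_one₀ (by linarith) (by linarith)
  obtain ⟨r, hr⟩ := exists_pow_lt_of_lt_one (show (0:ℝ) < ε / 2 / (2 * (M + N)) by positivity)
    (show 1 - (1 - b) ^ T < 1 by linarith)
  rw [lt_div_iff₀ (by positivity)] at hr
  set err := 2 * (1 - (1 - b) ^ T) ^ r with herr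
  have herr0 : 0 ≤ err := by
    have : 0 ≤ 1 - (1 - b) ^ T := by linarith
    positivity
  refine ⟨w + 4 + 2 * r + 2 * N + M, fun Z hZ σ hσ => ?_⟩
  set Jr : Finset ℤ := (Finset.range r).image fun t : ℕ => (w : ℤ) + 2 + 2 * t with hJr
  set Jl : Finset ℤ := (Finset.range r).image fun t : ℕ => -((w : ℤ) + 2 + 2 * t) with hJl
  have hwo : (w : ℤ) % 2 = 1 := by obtain ⟨t, rfl⟩ := hw; omega
  have hstep : ∀ i j, i < M → j < N →
      κ * (survival q w Z σ i (w + 2 * j) - survival q w Z σ (i + 1) (w + 2 * j)) ≤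
        survival q w Z σ (i + 1) (w + 2 * j) - survival q w Z σ (i + 1) (w + 2 * (j + 1)) + err := by
    intro i j hi hj
    have := survival_step h0 hq hw (s := w + 2 * j) (i := i) (r := r) (by omega)
      (Jr := Jr) (Jl := Jl) (Z := Z)
      (by
        rw [hJr, Finset.card_image_of_injective _ fun a b h => by simpa using h, Finset.card_range])
      (by
        rw [hJl, Finset.card_image_of_injective _ fun a b h => by simpa using h, Finset.card_range])
      (fun x hx => by
        obtain ⟨t, ht, rfl⟩ := Finset.mem_image.1 hx
        have := Finset.mem_range.1 ht
        rw [Int.odd_iff]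
        push_cast
        omega)
      (fun x hx => by
        obtain ⟨t, ht, rfl⟩ := Finset.mem_image.1 hx
        have := Finset.mem_range.1 ht
        rw [Int.odd_iff]
        push_cast
        omega) (by omega) hσ
    refine this.trans (add_le_add le_rfl ?_)
    have h1 : (1 - b) ^ T ≤ (1 - b) ^ (w + 2 * j + i + 1) :=
      pow_le_pow_of_le_one (by linarith) (by linarith) (by omega)
    have h2 : (1 - b) ^ (w + 2 * j + i + 1) ≤ 1 := pow_le_one₀ (by linarith) (by linarith)
    have h3 : 0 ≤ 1 - (1 - b) ^ (w + 2 * j + i + 1) := by linarith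
    rw [herr]
    gcongr
  have hAP : ∀ i L, ProbSteps (flips q i L) := fun i L => flips_prob h0.le (by linarith) i L
  have hTP : ∀ h k, ProbSteps (tracks q (-Z) (2 * Z + 2) h k) := fun h k => tracks_prob h0 hq k
  have hdec : ∀ i s, survival q w Z σ i (s + 1) ≤ survival q w Z σ i s := by
    intro i s
    rw [flips_tracks_prog hq hw (by omega) (s := s) (t := s + 1) rfl]
    exact run_mono (hAP _ _) (fun s' => run_mono (hTP _ _) (fun s'' => run_alive_le (hAP _ _) s'') s') σ
  have main := two_step_bound (U := fun i j => survival q w Z σ i (w + 2 * j)) (M := M) (N := N)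
    hκ0 herr0
    (fun i j => run_nonneg (hAP _ _) (fun s => run_nonneg (hTP _ _) alive_nonneg s) σ)
    (run_le_one (hAP _ _) (fun s => run_le_one (hTP _ _) alive_le_one s) σ)
    (fun i j => (hdec i (w + 2 * j + 1)).trans (hdec i (w + 2 * j)))
    hstep hη M le_rfl 0 (Nat.zero_le _)
  rw [Nat.sub_zero] at main
  have hfin : survival q w Z σ M w ≤ run tl (tracks q (-Z) (2 * Z + 2) (cone (w + 1)) M) alive σ := by
    rw [flips_tracks_prog hq hw (by omega) (s := 0) (t := w) (L := prog (w + 1) Z w)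
      (List.nil_append _).symm]
    exact run_mono (hTP _ _) (fun s => run_alive_le (hAP _ _) s) σ
  have hpow : (2 - η) ^ M * (1 - η / 2) ^ N ≤ ε / 2 := by
    rw [hN, pow_mul, ← mul_pow]
    have h1 : 0 ≤ (2 - η) * (1 - η / 2) ^ K := mul_nonneg (by linarith) (pow_nonneg (by linarith) _)
    have h2 : (2 - η) * (1 - η / 2) ^ K ≤ δ := by linarith
    calc ((2 - η) * (1 - η / 2) ^ K) ^ M ≤ δ ^ M := by gcongr
      _ ≤ δ ^ 1 := pow_le_pow_of_le_one hδ0.le hδ1 hM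
      _ ≤ ε / 2 := by rw [pow_one]; exact hδε
  have herr2 : (M + N : ℝ) * err ≤ ε / 2 := by
    rw [herr]
    linarith
  rw [survival_zero] at main
  simp only [mul_zero, add_zero] at main
  linarith

end SurvivalBound

section Execution

open Classical in
/-- The evolution of connectivity states driven by a configuration: the step `(j, e)` acts
if `j` is odd and `e` is open, or `j` is even and `e` is closed. -/
noncomputable def exec (ω : Config SqE) : List (ℤ × SqE) → State → State
  | [], σ => σ
  | x :: l, σ => exec ω l (if (ω x.2 = true ↔ ¬ Even x.1) then tl x.1 σ else σ)

open Classical in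
/-- The random steps corresponding to a list of positions and edges. -/
noncomputable def stepsOf (p : SqE → ℝ) (l : List (ℤ × SqE)) : List (ℤ × ℝ) :=
  l.map fun x => (x.1, if Even x.1 then 1 - p x.2 else p x.2)

lemma exec_congr {ω ω' : Config SqE} {l : List (ℤ × SqE)} (h : ∀ e ∈ l.map Prod.snd, ω e = ω' e)
    (σ : State) : exec ω l σ = exec ω' l σ := by
  induction l generalizing σ with
  | nil => rfl
  | cons x l ih =>
    rw [exec, exec, h x.2 (by simp), ih fun e he => h e (by simp_all)]

lemma resample_congr {E : Type} [DecidableEq E] {p : E → ℝ} {l : List E} {f g : Config E → ℝ}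
    {ω : Config E}
    (h : ∀ ω', (∀ e, e ∉ l → ω' e = ω e) → f ω' = g ω') : resample p l f ω = resample p l g ω := by
  induction l generalizing ω with
  | nil => exact h ω fun _ _ => rfl
  | cons a l ih =>
    rw [resample, resample, ih, ih]
    all_goals
      intro ω' h'
      refine h ω' fun e he => ?_
      rw [h' e fun h => he (by simp [h]), Function.update_of_ne]
      rintro rfl
      simp at he

lemma resample_exec {p : SqE → ℝ} {l : List (ℤ × SqE)} (hl : (l.map Prod.snd).Nodup)
    (g : State → ℝ) (σ : State) (ω : Config SqE) :
    resample p (l.map Prod.snd) (fun ω => g (exec ω l σ)) ω = run tl (stepsOf p l) g σ := by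
  classical
  induction l generalizing σ ω with
  | nil => rfl
  | cons x l ih =>
    obtain ⟨h1, h2⟩ := List.nodup_cons.1 hl
    rw [List.map_cons, resample]
    have key : ∀ b : Bool, resample p (l.map Prod.snd) (fun ω => g (exec ω (x :: l) σ))
        (Function.update ω x.2 b) =
          run tl (stepsOf p l) g (if (b = true ↔ ¬ Even x.1) then tl x.1 σ else σ) := by
      intro b
      rw [← ih h2 _ (Function.update ω x.2 b)]
      refine resample_congr fun ω' h' => ?_
      have : ω' x.2 = b := by rw [h' x.2 h1, Function.update_self]
      rw [exec, this]
    rw [key, key]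
    change _ = (1 - (if Even x.1 then 1 - p x.2 else p x.2)) * run tl (stepsOf p l) g σ +
      (if Even x.1 then 1 - p x.2 else p x.2) * run tl (stepsOf p l) g (tl x.1 σ)
    by_cases hx : Even x.1
    · simp [hx]
    · simp [hx]
      ring

/-- The law of the evolution driven by a Bernoulli configuration. -/
lemma IsBernoulliProduct.real_exec {p : SqE → ℝ} {P : Measure (Config SqE)}
    (hP : IsBernoulliProduct p P) (hp : ∀ e, p e ∈ Icc (0 : ℝ) 1) {l : List (ℤ × SqE)}
    (hl : (l.map Prod.snd).Nodup) (B : Set State) (σ : State) :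
    P.real {ω | exec ω l σ ∈ B} = run tl (stepsOf p l) (B.indicator fun _ => 1) σ := by
  classical
  rw [hP.real_eq_resample hp hl (A := {ω | exec ω l σ ∈ B}) (fun ω ω' h => by
    simp only [mem_ofPred_eq]
    rw [exec_congr h]) fun _ => false, ← resample_exec hl]
  rfl

open Classical in
/-- Raise the interface at an even position. -/
noncomputable def lift (j : ℤ) (W : ℤ → ℤ) : ℤ → ℤ :=
  if Even j then Function.update W (j / 2) (W (j / 2) + 1) else W

open Classical in
/-- The steps of `l` sweep the lattice, starting from the interface `u ↦ (u, W u)`. -/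
def Sweeps : (ℤ → ℤ) → List (ℤ × SqE) → Prop
  | _, [] => True
  | W, x :: l => (x.2 = (x.1 / 2, W (x.1 / 2), decide (¬ Even x.1)) ∧
      (¬ Even x.1 → W (x.1 / 2 + 1) = W (x.1 / 2))) ∧ Sweeps (lift x.1 W) l

/-- The final interface. -/
noncomputable def advance (W : ℤ → ℤ) : List (ℤ × SqE) → ℤ → ℤ
  | [] => W
  | x :: l => advance (lift x.1 W) l

lemma Sweeps.append {W : ℤ → ℤ} {l l' : List (ℤ × SqE)} (h : Sweeps W l)
    (h' : Sweeps (advance W l) l') : Sweeps W (l ++ l') := by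
  induction l generalizing W with
  | nil => exact h'
  | cons x l ih => exact ⟨h.1, ih h.2 h'⟩

lemma advance_append (W : ℤ → ℤ) (l l' : List (ℤ × SqE)) :
    advance W (l ++ l') = advance (advance W l) l' := by
  induction l generalizing W with
  | nil => rfl
  | cons x l ih => exact ih _

/-- The colouring of labels induced by a set of vertices, with one mark coloured. -/
def vertexColor (C : Set (ℤ × ℤ)) (W : ℤ → ℤ) : Label → Prop :=
  Sum.elim (fun p => Even p ∧ (p / 2, W (p / 2)) ∈ C) fun b => b = true

/-- A union of open clusters separates the labels throughout the evolution. -/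
lemma RespectsColor.exec {ω : Config SqE} {C : Set (ℤ × ℤ)}
    (hC : ∀ u v, OAdj ω u v → (u ∈ C ↔ v ∈ C)) {W : ℤ → ℤ} {l : List (ℤ × SqE)} (hl : Sweeps W l)
    {σ : State} (h : RespectsColor (vertexColor C W) σ) :
    RespectsColor (vertexColor C (advance W l)) (exec ω l σ) := by
  induction l generalizing W σ with
  | nil => exact h
  | cons x l ih =>
    obtain ⟨⟨h1, h2⟩, h3⟩ := hl
    refine ih h3 ?_
    obtain ⟨j, e⟩ := x
    simp only at h1 h2 h3 ⊢
    by_cases hj : Even j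
    · by_cases he : ω e = true
      · rw [if_neg (by tauto)]
        have hadj : (j / 2, W (j / 2)) ∈ C ↔ (j / 2, W (j / 2) + 1) ∈ C := by
          refine hC _ _ ⟨e, he, Or.inl ?_⟩
          rw [h1]
          simp [etgt, hj]
          rfl
        have : vertexColor C (lift j W) = vertexColor C W := by
          ext y
          rcases y with y | y
          · simp only [vertexColor, Sum.elim_inl, lift, if_pos hj]
            by_cases hy : y / 2 = j / 2
            · rw [hy, Function.update_self, ← hadj]
            · rw [Function.update_of_ne hy]
          · rfl
        rwa [this]
      · rw [if_pos (by tauto), tl_even hj]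
        have : ∀ y : Label, y ≠ .inl j → (vertexColor C (lift j W) y ↔ vertexColor C W y) := by
          intro y hy
          rcases y with y | y
          · simp only [vertexColor, Sum.elim_inl, lift, if_pos hj]
            by_cases hy2 : y / 2 = j / 2
            · have : ¬ Even y := by
                intro hy3
                rw [Int.even_iff] at hj hy3
                exact hy (congrArg _ (by omega))
              simp [this]
            · rw [Function.update_of_ne hy2]
          · rfl
        intro y z hyz
        rw [isolate_iff] at hyz
        rcases hyz with rfl | ⟨h4, h5, h6⟩
        · rfl
        · rw [this _ h5, this _ h6]
          exact h _ _ h4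
    · have hW : lift j W = W := by rw [lift, if_neg hj]
      rw [hW]
      by_cases he : ω e = true
      · rw [if_pos (by tauto)]
        refine h.tl fun _ => ?_
        have e1 : (j - 1) / 2 = j / 2 := by rw [Int.even_iff] at hj; omega
        have e2 : (j + 1) / 2 = j / 2 + 1 := by rw [Int.even_iff] at hj; omega
        have hadj : (j / 2, W (j / 2)) ∈ C ↔ (j / 2 + 1, W (j / 2)) ∈ C := by
          refine hC _ _ ⟨e, he, Or.inl ?_⟩
          rw [h1]
          simp only [esrc, etgt, hj]
          simp
        have e3 : Even (j - 1) ∧ Even (j + 1) := by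
          simp only [Int.even_iff] at *
          omega
        simp only [vertexColor, Sum.elim_inl, e1, e2, h2 hj, hadj, e3, true_and]
      · rw [if_neg (by tauto)]
        exact h

end Execution

section Domination

/-- The vertices and marks at the interface. -/
def place (W : ℤ → ℤ) : ℤ ⊕ Bool → (ℤ × ℤ) ⊕ Bool := Sum.map (fun u => (u, W u)) id

/-- The labels of the vertices and marks at the interface. -/
def tag : ℤ ⊕ Bool → Label := Sum.map (2 * ·) id

/-- The state is coarser than a connectivity relation on the lattice which only involves vertices
below the interface. -/
def Dominates (W : ℤ → ℤ) (σ : State) (S : Setoid ((ℤ × ℤ) ⊕ Bool)) : Prop :=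
  (∀ x y, S (place W x) (place W y) → σ (tag x) (tag y)) ∧
    ∀ u y, W u < y → ∀ b, S (.inl (u, y)) b → b = .inl (u, y)

lemma place_ne {W : ℤ → ℤ} {u : ℤ} {x : ℤ ⊕ Bool} (hx : x ≠ .inl u) (y : ℤ) :
    place W x ≠ .inl (u, y) := by
  rcases x with x | x
  · intro h
    simp only [place, Sum.map_inl, Sum.inl.injEq, Prod.mk.injEq] at h
    exact hx (by rw [h.1])
  · simp [place]

lemma place_update {W : ℤ → ℤ} {u y : ℤ} {x : ℤ ⊕ Bool} (hx : x ≠ .inl u) :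
    place (Function.update W u y) x = place W x := by
  rcases x with x | x
  · have : x ≠ u := fun h => hx (by rw [h])
    simp [place, Function.update_of_ne this]
  · rfl

/-- The evolution connects whatever the open edges connect. -/
lemma Dominates.exec {ω : Config SqE} {W : ℤ → ℤ} {l : List (ℤ × SqE)} (hl : Sweeps W l)
    {σ : State} {S : Setoid ((ℤ × ℤ) ⊕ Bool)} (h : Dominates W σ S) :
    ∃ S', Dominates (advance W l) (exec ω l σ) S' ∧ S ≤ S' ∧
      ∀ x ∈ l, ω x.2 = true → S' (.inl (esrc x.2)) (.inl (etgt x.2)) := by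
  induction l generalizing W σ S with
  | nil => exact ⟨S, h, le_rfl, by simp⟩
  | cons x l ih =>
    obtain ⟨⟨h1, h2⟩, h3⟩ := hl
    obtain ⟨j, e⟩ := x
    simp only at h1 h2 h3 ⊢
    obtain ⟨hS1, hS2⟩ := h
    suffices hstep : ∃ S', Dominates (lift j W)
        (if (ω e = true ↔ ¬ Even j) then tl j σ else σ) S' ∧ S ≤ S' ∧
          (ω e = true → S' (.inl (esrc e)) (.inl (etgt e))) by
      obtain ⟨S', h4, h5, h6⟩ := hstep
      obtain ⟨S'', h7, h8, h9⟩ := ih h3 h4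
      refine ⟨S'', h7, h5.trans h8, fun x hx hω => ?_⟩
      rcases List.mem_cons.1 hx with rfl | hx
      · exact h8 (h6 hω)
      · exact h9 x hx hω
    by_cases hj : Even j
    · have hj2 : 2 * (j / 2) = j := by rw [Int.even_iff] at hj; omega
      set u := j / 2 with hu
      set Y : (ℤ × ℤ) ⊕ Bool := .inl (u, W u + 1) with hY
      have hYs : ∀ b, S Y b → b = Y := hS2 u (W u + 1) (by omega)
      have hlift : lift j W = Function.update W u (W u + 1) := by rw [lift, if_pos hj]
      have hpu : place (lift j W) (.inl u) = Y := by
        simp [place, hlift, hY]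
      have hpn : ∀ x, x ≠ .inl u → place (lift j W) x = place W x := fun x hx => by
        rw [hlift, place_update hx]
      by_cases he : ω e = true
      · rw [if_neg (by tauto)]
        set X : (ℤ × ℤ) ⊕ Bool := .inl (u, W u) with hX
        have hesrc : (.inl (esrc e) : (ℤ × ℤ) ⊕ Bool) = X := by rw [h1]; rfl
        have hetgt : (.inl (etgt e) : (ℤ × ℤ) ⊕ Bool) = Y := by rw [h1]; simp [etgt, hj, hY]
        refine ⟨merge X Y S, ⟨fun x y hxy => hS1 x y ?_, fun v y hy b hb => ?_⟩, fun _ _ => le_merge _ _ _,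
          fun _ => by rw [hesrc, hetgt]; exact merge_rel _ _ _⟩
        · have hXu : place W (.inl u) = X := rfl
          have hne : ∀ x, x ≠ .inl u → place W x ≠ Y := fun x hx => place_ne hx _
          rw [merge_iff] at hxy
          have aux : ∀ x, S (place (lift j W) x) X → S (place W x) X := by
            intro x hx
            by_cases hxu : x = .inl u
            · subst hxu
              exact S.refl' X
            · rwa [hpn x hxu] at hx
          have aux' : ∀ x, S (place (lift j W) x) Y → S (place W x) X := by
            intro x hx
            by_cases hxu : x = .inl u
            · subst hxu
              exact S.refl' X
            · rw [hpn x hxu] at hx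
              exact absurd (hYs _ (S.symm' hx)) (hne x hxu)
          rcases hxy with h4 | ⟨h4, h5⟩ | ⟨h4, h5⟩
          · by_cases hxu : x = .inl u
            · subst hxu
              rw [hpu] at h4
              exact S.symm' (aux' y (S.symm' h4))
            · by_cases hyu : y = .inl u
              · subst hyu
                rw [hpu] at h4
                exact aux' x h4
              · rwa [hpn x hxu, hpn y hyu] at h4
          · exact S.trans' (aux x h4) (S.symm' (aux' y (S.symm' h5)))
          · exact S.trans' (aux' x h4) (S.symm' (aux y (S.symm' h5)))
        · rw [hlift] at hy
          have hWv : W v < y := by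
            by_cases hv : v = u
            · subst hv; rw [Function.update_self] at hy; omega
            · rwa [Function.update_of_ne hv] at hy
          have h5 := hS2 v y hWv
          have hvX : (.inl (v, y) : (ℤ × ℤ) ⊕ Bool) ≠ X := by
            intro h
            simp only [hX, Sum.inl.injEq, Prod.mk.injEq] at h
            obtain ⟨rfl, rfl⟩ := h
            exact lt_irrefl _ hWv
          have hvY : (.inl (v, y) : (ℤ × ℤ) ⊕ Bool) ≠ Y := by
            intro h
            simp only [hY, Sum.inl.injEq, Prod.mk.injEq] at h
            obtain ⟨rfl, rfl⟩ := h
            rw [Function.update_self] at hy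
            exact lt_irrefl _ hy
          rw [merge_iff] at hb
          rcases hb with hb | ⟨hb, -⟩ | ⟨hb, -⟩
          · exact h5 b hb
          · exact absurd (h5 _ hb).symm hvX
          · exact absurd (h5 _ hb).symm hvY
      · rw [if_pos (by tauto), tl_even hj]
        have htag : ∀ x, x ≠ .inl u → tag x ≠ .inl j := by
          intro x hx h
          rcases x with x | x
          · simp only [tag, Sum.map_inl, Sum.inl.injEq] at h
            exact hx (by rw [hu, ← h]; simp)
          · simp [tag] at h
        refine ⟨S, ⟨fun x y hxy => ?_, fun v y hy b hb => hS2 v y ?_ b hb⟩, le_rfl,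
          fun h => absurd h he⟩
        · rw [isolate_iff]
          by_cases hxu : x = .inl u
          · left
            subst hxu
            rw [hpu] at hxy
            have := hYs _ hxy
            by_contra hyu
            have hyu : y ≠ .inl u := fun h => hyu (by rw [h])
            rw [hpn y hyu] at this
            exact place_ne hyu _ this
          · by_cases hyu : y = .inl u
            · subst hyu
              rw [hpu] at hxy
              have := hYs _ (S.symm' hxy)
              rw [hpn x hxu] at this
              exact absurd this (place_ne hxu _)
            · right
              rw [hpn x hxu, hpn y hyu] at hxy
              exact ⟨hS1 x y hxy, htag x hxu, htag y hyu⟩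
        · rw [hlift] at hy
          by_cases hv : v = u
          · subst hv; rw [Function.update_self] at hy; omega
          · rwa [Function.update_of_ne hv] at hy
    · have hW : lift j W = W := by rw [lift, if_neg hj]
      rw [hW]
      by_cases he : ω e = true
      · rw [if_pos (by tauto), tl_odd hj]
        have e1 : (.inl (esrc e) : (ℤ × ℤ) ⊕ Bool) = place W (.inl (j / 2)) := by rw [h1]; rfl
        have e2 : (.inl (etgt e) : (ℤ × ℤ) ⊕ Bool) = place W (.inl (j / 2 + 1)) := by
          simp [h1, etgt, place, hj, h2 hj]
        have e3 : (.inl (j - 1) : Label) = tag (.inl (j / 2)) := by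
          rw [Int.even_iff] at hj
          simp only [tag, Sum.map_inl]
          congr 1
          omega
        have e4 : (.inl (j + 1) : Label) = tag (.inl (j / 2 + 1)) := by
          rw [Int.even_iff] at hj
          simp only [tag, Sum.map_inl]
          congr 1
          omega
        refine ⟨merge (.inl (esrc e)) (.inl (etgt e)) S, ⟨fun x y hxy => ?_, fun v y hy b hb => ?_⟩,
          fun _ _ => le_merge _ _ _, fun _ => merge_rel _ _ _⟩
        · rw [e1, e2, merge_iff] at hxy
          rw [e3, e4, merge_iff]
          rcases hxy with h4 | ⟨h4, h5⟩ | ⟨h4, h5⟩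
          · exact Or.inl (hS1 _ _ h4)
          · exact Or.inr (Or.inl ⟨hS1 _ _ h4, hS1 _ _ h5⟩)
          · exact Or.inr (Or.inr ⟨hS1 _ _ h4, hS1 _ _ h5⟩)
        · have h5 := hS2 v y hy
          have hne : ∀ k, place W (.inl k) ≠ .inl (v, y) := by
            intro k h
            simp only [place, Sum.map_inl, Sum.inl.injEq, Prod.mk.injEq] at h
            obtain ⟨rfl, rfl⟩ := h
            exact lt_irrefl _ hy
          rw [merge_iff, e1, e2] at hb
          rcases hb with hb | ⟨hb, -⟩ | ⟨hb, -⟩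
          · exact h5 b hb
          · exact absurd (h5 _ hb) (hne _)
          · exact absurd (h5 _ hb) (hne _)
      · rw [if_neg (by tauto)]
        exact ⟨S, ⟨hS1, hS2⟩, le_rfl, fun h => absurd h he⟩

end Domination

section Interface

/-- The edge crossed by the interface when it is raised at `p` from height `s`. -/
def abEdge (p s : ℤ) : SqE :=
  if p % 2 = 0 then (p / 2, s / 2, false) else (p / 2, (s + 1) / 2, true)

/-- The steps of the evolution corresponding to a list of flips. -/
def abList : (ℤ → ℤ) → List ℤ → List (ℤ × SqE)
  | _, [] => []
  | h, p :: ps => (p, abEdge p (h p)) :: abList (raise h p) ps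

lemma abEdge_inj {p s p' s' : ℤ} (h1 : (s - p) % 2 = 0) (h2 : (s' - p') % 2 = 0)
    (h : abEdge p s = abEdge p' s') : p = p' ∧ s = s' := by
  unfold abEdge at h
  split_ifs at h <;> simp only [Prod.mk.injEq, Bool.false_eq_true, Bool.true_eq_false, and_false,
    and_true] at h <;> omega

lemma raise_parity {h : ℤ → ℤ} (hp : ∀ p, (h p - p) % 2 = 0) (a p : ℤ) :
    (raise h a p - p) % 2 = 0 := by
  have := hp p
  by_cases hap : p = a
  · subst hap
    rw [raise, Function.update_self]
    omega
  · rwa [raise, Function.update_of_ne hap]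

lemma le_raise (h : ℤ → ℤ) (a p : ℤ) : h p ≤ raise h a p := by
  by_cases hap : p = a
  · subst hap
    rw [raise, Function.update_self]
    omega
  · rw [raise, Function.update_of_ne hap]

lemma le_raises (h : ℤ → ℤ) (ps : List ℤ) (p : ℤ) : h p ≤ raises h ps p := by
  induction ps generalizing h with
  | nil => exact le_rfl
  | cons a ps ih => exact (le_raise h a p).trans (ih _)

lemma mem_abList {h : ℤ → ℤ} (hp : ∀ p, (h p - p) % 2 = 0) {ps : List ℤ} {x : ℤ × SqE} :
    x ∈ abList h ps ↔
      ∃ s, h x.1 ≤ s ∧ s < raises h ps x.1 ∧ (s - x.1) % 2 = 0 ∧ x.2 = abEdge x.1 s := by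
  induction ps generalizing h with
  | nil =>
    simp only [abList, List.not_mem_nil, false_iff, not_exists]
    rintro s ⟨h1, h2, -⟩
    exact absurd (h1.trans_lt h2) (lt_irrefl _)
  | cons a ps ih =>
    rw [abList, List.mem_cons, ih (raise_parity hp a)]
    have hr : raises h (a :: ps) = raises (raise h a) ps := rfl
    rw [hr]
    have hle := le_raises (raise h a) ps
    constructor
    · rintro (rfl | ⟨s, h1, h2, h3⟩)
      · refine ⟨h a, le_rfl, ?_, hp a, rfl⟩
        refine lt_of_lt_of_le ?_ (hle a)
        simp only [raise, Function.update_self]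
        omega
      · exact ⟨s, (le_raise _ _ _).trans h1, h2, h3⟩
    · rintro ⟨s, h1, h2, h3, h4⟩
      by_cases hs : raise h a x.1 ≤ s
      · exact Or.inr ⟨s, hs, h2, h3, h4⟩
      · left
        have hxa : x.1 = a := by
          by_contra hxa
          rw [raise, Function.update_of_ne hxa] at hs
          exact hs h1
        have hpx := hp x.1
        rw [raise, ← hxa, Function.update_self] at hs
        have : s = h x.1 := by omega
        rw [this] at h4
        rw [← hxa]
        exact Prod.ext rfl h4

lemma abList_nodup {h : ℤ → ℤ} (hp : ∀ p, (h p - p) % 2 = 0) (ps : List ℤ) :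
    ((abList h ps).map Prod.snd).Nodup := by
  induction ps generalizing h with
  | nil => simp [abList]
  | cons a ps ih =>
    rw [abList, List.map_cons, List.nodup_cons]
    refine ⟨fun hmem => ?_, ih (raise_parity hp a)⟩
    obtain ⟨x, hx, hxe⟩ := List.mem_map.1 hmem
    obtain ⟨s, h1, -, h3, h4⟩ := (mem_abList (raise_parity hp a)).1 hx
    obtain ⟨rfl, rfl⟩ := abEdge_inj h3 (hp a) (by rw [← h4, hxe])
    rw [raise, Function.update_self] at h1
    omega

lemma lift_half {h : ℤ → ℤ} (hp : ∀ p, (h p - p) % 2 = 0) (a : ℤ) :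
    lift a (fun u => h (2 * u) / 2) = fun u => raise h a (2 * u) / 2 := by
  have hpa := hp a
  ext u
  unfold lift
  split_ifs with ha
  · rw [Int.even_iff] at ha
    by_cases hu : u = a / 2
    · subst hu
      have : 2 * (a / 2) = a := by omega
      rw [Function.update_self, this, raise, Function.update_self]
      simp only [this]
      omega
    · rw [Function.update_of_ne hu, raise, Function.update_of_ne (by omega)]
  · rw [Int.even_iff] at ha
    rw [raise, Function.update_of_ne (by omega)]

lemma sweeps_abList {lo hi : ℤ} {h : ℤ → ℤ} (hp : ∀ p, (h p - p) % 2 = 0) {ps : List ℤ}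
    (hv : ValidFlips lo hi h ps) : Sweeps (fun u => h (2 * u) / 2) (abList h ps) := by
  induction ps generalizing h with
  | nil => trivial
  | cons a ps ih =>
    obtain ⟨h1, -, h3⟩ := hv
    have hpa := hp a
    refine ⟨⟨?_, fun ha => ?_⟩, ?_⟩
    · simp only [abEdge, Int.even_iff]
      split_ifs with ha
      · have : 2 * (a / 2) = a := by omega
        simp [ha, this]
      · have : 2 * (a / 2) = a - 1 := by omega
        simp [ha, this, h1]
    · rw [Int.even_iff] at ha
      have e1 : 2 * (a / 2) = a - 1 := by omega
      have e2 : 2 * (a / 2 + 1) = a + 1 := by omega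
      simp only [e1, e2, h1]
    · simp only
      rw [lift_half hp]
      exact ih (raise_parity hp a) h3

lemma advance_abList {h : ℤ → ℤ} (hp : ∀ p, (h p - p) % 2 = 0) (ps : List ℤ) :
    advance (fun u => h (2 * u) / 2) (abList h ps) = fun u => raises h ps (2 * u) / 2 := by
  induction ps generalizing h with
  | nil => rfl
  | cons a ps ih =>
    rw [abList, advance, lift_half hp, ih (raise_parity hp a)]
    rfl

lemma stepsOf_abList (q : ℝ) (h : ℤ → ℤ) (ps : List ℤ) :
    stepsOf (sqInt q (1 - q)) (abList h ps) = flips q 0 ps := by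
  induction ps generalizing h with
  | nil => rfl
  | cons a ps ih =>
    rw [abList, stepsOf, List.map_cons, ← stepsOf, ih, flips, flips, List.map_cons]
    congr 1
    simp only [abEdge, Int.even_iff, sqInt]
    split_ifs <;> simp_all

lemma cone_parity {m : ℤ} (hm : m % 2 = 0) (p : ℤ) : (cone m p - p) % 2 = 0 := by
  unfold cone
  split_ifs <;> omega

end Interface

section TrackLattice

open Classical in
/-- The edge of the lattice corresponding to position `j` of the `i`-th track. -/
noncomputable def dEdge (j i : ℤ) : SqE := (j / 2, i - j / 2, decide (¬ Even j))

/-- The steps of the evolution corresponding to a track. -/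
noncomputable def dTrack (lo i : ℤ) : ℕ → List (ℤ × SqE)
  | 0 => []
  | n + 1 => (lo + n + i, dEdge (lo + n + i) i) :: dTrack lo i n

/-- The steps of the evolution corresponding to several tracks. -/
noncomputable def dTracks (lo : ℤ) (n : ℕ) : ℕ → List (ℤ × SqE)
  | 0 => []
  | k + 1 => dTracks lo n k ++ dTrack lo k n

/-- The edge probabilities matching the tracks. -/
noncomputable def trackInt (q : ℝ) (h : ℤ → ℤ) (e : SqE) : ℝ :=
  if e.2.2 then yCol q h (e.1 - e.2.1 + 1) else 1 - yCol q h (e.1 - e.2.1)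

lemma trackInt_mem {q : ℝ} (h0 : 0 < q) (hq : q < 1 / 2) (h : ℤ → ℤ) (e : SqE) :
    trackInt q h e ∈ Icc (0 : ℝ) 1 := by
  have h1 := yDown_lt_one hq
  unfold trackInt
  split_ifs
  · have := yCol_mem h0 hq h (e.1 - e.2.1 + 1)
    constructor <;> linarith
  · have := yCol_mem h0 hq h (e.1 - e.2.1)
    constructor <;> linarith

lemma stepsOf_append (p : SqE → ℝ) (l l' : List (ℤ × SqE)) :
    stepsOf p (l ++ l') = stepsOf p l ++ stepsOf p l' := List.map_append

lemma stepsOf_dTrack (q : ℝ) (h : ℤ → ℤ) (lo i : ℤ) (n : ℕ) :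
    stepsOf (trackInt q h) (dTrack lo i n) = track q lo h i n := by
  induction n with
  | zero => rfl
  | succ n ih =>
    rw [dTrack, stepsOf, List.map_cons, ← stepsOf, ih, track]
    congr 2
    simp only [dEdge, trackInt]
    by_cases hj : Even (lo + n + i)
    · have hj2 := Int.even_iff.1 hj
      simp only [hj, not_true_eq_false, decide_false, Bool.false_eq_true, if_true, if_false]
      rw [sub_sub_cancel]
      congr 1
      omega
    · have hj2 := hj
      rw [Int.even_iff] at hj2
      simp only [hj, not_false_eq_true, decide_true, if_true, if_false]
      congr 1
      omega

lemma stepsOf_dTracks (q : ℝ) (h : ℤ → ℤ) (lo : ℤ) (n k : ℕ) :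
    stepsOf (trackInt q h) (dTracks lo n k) = tracks q lo n h k := by
  induction k with
  | zero => rfl
  | succ k ih => rw [dTracks, stepsOf_append, ih, stepsOf_dTrack, tracks]

lemma dEdge_inj {j i j' i' : ℤ} (h : dEdge j i = dEdge j' i') : j = j' ∧ i = i' := by
  simp only [dEdge, Prod.mk.injEq, decide_eq_decide, Int.even_iff] at h
  omega

lemma mem_dTrack {lo i : ℤ} {n : ℕ} {x : ℤ × SqE} (hx : x ∈ dTrack lo i n) :
    x.1 < lo + n + i ∧ x.2 = dEdge x.1 i := by
  induction n with
  | zero => simp [dTrack] at hx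
  | succ n ih =>
    rcases List.mem_cons.1 hx with rfl | hx
    · simp
    · have := ih hx
      push_cast
      exact ⟨by omega, this.2⟩

lemma mem_dTracks {lo : ℤ} {n k : ℕ} {x : ℤ × SqE} (hx : x ∈ dTracks lo n k) :
    ∃ i : ℤ, i < k ∧ x.2 = dEdge x.1 i := by
  induction k with
  | zero => simp [dTracks] at hx
  | succ k ih =>
    rcases List.mem_append.1 hx with hx | hx
    · obtain ⟨i, hi, h⟩ := ih hx
      exact ⟨i, by push_cast; omega, h⟩
    · exact ⟨k, by push_cast; omega, (mem_dTrack hx).2⟩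

lemma dTrack_nodup (lo i : ℤ) (n : ℕ) : ((dTrack lo i n).map Prod.snd).Nodup := by
  induction n with
  | zero => simp [dTrack]
  | succ n ih =>
    rw [dTrack, List.map_cons, List.nodup_cons]
    refine ⟨fun hmem => ?_, ih⟩
    obtain ⟨x, hx, hxe⟩ := List.mem_map.1 hmem
    obtain ⟨h1, h2⟩ := mem_dTrack hx
    have := (dEdge_inj (h2.symm.trans hxe)).1
    omega

lemma dTracks_nodup (lo : ℤ) (n k : ℕ) : ((dTracks lo n k).map Prod.snd).Nodup := by
  induction k with
  | zero => simp [dTracks]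
  | succ k ih =>
    rw [dTracks, List.map_append, List.nodup_append]
    refine ⟨ih, dTrack_nodup _ _ _, fun e he e' he' => ?_⟩
    obtain ⟨x, hx, rfl⟩ := List.mem_map.1 he
    obtain ⟨y, hy, rfl⟩ := List.mem_map.1 he'
    obtain ⟨i, hi, h1⟩ := mem_dTracks hx
    intro h
    have := (dEdge_inj (h1.symm.trans (h.trans (mem_dTrack hy).2))).2
    omega

/-- The number of tracks, counted from the bottom, below the site `p` after `i` tracks. -/
def level (lo : ℤ) (N : ℕ) (i p : ℤ) : ℤ := max (min i (p - lo + 1)) (p - lo - N + 1)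

/-- The interface after `i` tracks and all but `n` columns of the next one. -/
def front (lo : ℤ) (N : ℕ) (i n : ℤ) (u : ℤ) : ℤ :=
  (if lo + n + i ≤ 2 * u then level lo N (i + 1) (2 * u) else level lo N i (2 * u)) - u

lemma front_zero (lo : ℤ) (N : ℕ) (i : ℤ) : front lo N i 0 = front lo N (i + 1) N := by
  ext u
  simp only [front, level]
  split_ifs <;> omega

lemma sweeps_dTrack {lo i : ℤ} {N n : ℕ} (hn : n ≤ N) :
    Sweeps (front lo N i n) (dTrack lo i n) ∧
      advance (front lo N i n) (dTrack lo i n) = front lo N i 0 := by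
  induction n with
  | zero => exact ⟨trivial, rfl⟩
  | succ n ih =>
    have key : lift (lo + n + i) (front lo N i (n + 1 : ℕ)) = front lo N i n := by
      ext u
      unfold lift
      split_ifs with hj
      · rw [Int.even_iff] at hj
        by_cases hu : u = (lo + n + i) / 2
        · subst hu
          rw [Function.update_self]
          simp only [front, level]
          push_cast
          split_ifs <;> omega
        · rw [Function.update_of_ne hu]
          simp only [front, level]
          push_cast
          split_ifs <;> omega
      · rw [Int.even_iff] at hj
        simp only [front, level]
        push_cast
        split_ifs <;> omega
    obtain ⟨h1, h2⟩ := ih (by omega)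
    refine ⟨⟨⟨?_, fun hj => ?_⟩, ?_⟩, ?_⟩
    · simp only [dEdge, Prod.mk.injEq, true_and, and_true, front, level]
      push_cast
      by_cases hj : (lo + n + i) % 2 = 0
      · split_ifs <;> omega
      · split_ifs <;> omega
    · simp only at hj ⊢
      rw [Int.even_iff] at hj
      simp only [front, level]
      push_cast
      split_ifs <;> omega
    · simp only
      rw [key]
      exact h1
    · rw [dTrack, advance]
      simp only
      rw [key]
      exact h2

lemma sweeps_dTracks (lo : ℤ) (N k : ℕ) :
    Sweeps (front lo N 0 N) (dTracks lo N k) ∧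
      advance (front lo N 0 N) (dTracks lo N k) = front lo N k N := by
  induction k with
  | zero => exact ⟨trivial, rfl⟩
  | succ k ih =>
    obtain ⟨h1, h2⟩ := sweeps_dTrack (lo := lo) (i := k) (le_refl N)
    constructor
    · exact ih.1.append (by rw [ih.2]; exact h1)
    · rw [dTracks, advance_append, ih.2, h2, front_zero]
      push_cast
      rfl

end TrackLattice

section Marks

open Classical in
/-- The initial state: two disjoint arms are attached to the two marks. -/
noncomputable def armMark (k : ℤ) : Label → Label :=
  Sum.elim (fun p => if Even p ∧ 2 * k ≤ p ∧ p ≤ 4 * k then .inr true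
    else if Even p ∧ -(4 * k) ≤ p ∧ p ≤ -(2 * k) then .inr false else .inl p) .inr

/-- The state in which two disjoint arms are attached to the two marks. -/
noncomputable def armState (k : ℤ) : State := Setoid.ker (armMark k)

lemma armState_iff {k : ℤ} {x y : Label} : armState k x y ↔ armMark k x = armMark k y := Iff.rfl

/-- The first mark is not alone. -/
def Escapes (σ : State) : Prop := ∃ x, x ≠ .inr true ∧ σ (.inr true) x

lemma armState_inside {k : ℤ} (hk : 0 ≤ k) : Inside (6 * k) (armState k) := by
  have aux : ∀ x : Label, armMark k x = x ∨
      (∃ b, armMark k x = .inr b) ∧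
        Sum.elim (fun p : ℤ => Even p ∧ -(6 * k) ≤ p ∧ p ≤ 6 * k) (fun _ => True) x := by
    rintro (p | b)
    · simp only [armMark, Sum.elim_inl]
      split_ifs with h1 h2
      · exact Or.inr ⟨⟨_, rfl⟩, h1.1, by omega, by omega⟩
      · exact Or.inr ⟨⟨_, rfl⟩, h2.1, by omega, by omega⟩
      · exact Or.inl rfl
    · exact Or.inl rfl
  intro x y hxy
  rw [armState_iff] at hxy
  rcases aux x with hx | ⟨⟨b, hx⟩, hx'⟩ <;> rcases aux y with hy | ⟨⟨c, hy⟩, hy'⟩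
  · left
    rw [← hx, ← hy, hxy]
  · right
    have : x = .inr c := by rw [← hx, ← hy, hxy]
    exact ⟨by rw [this]; trivial, hy'⟩
  · right
    have : y = .inr b := by rw [← hx, ← hy, hxy]
    exact ⟨hx', by rw [this]; trivial⟩
  · exact Or.inr ⟨hx', hy'⟩

/-- The blocking event: the four strips around the square are not crossed. -/
def blocking (k : ℤ) : Set (Config SqE) :=
  ((HC (2 * k) (3 * k - 1) (-(3 * k - 1)) (-1))ᶜ ∩ (HC 1 k (-(3 * k - 1)) (-1))ᶜ) ∩
    ((VC 1 (3 * k - 1) (-k) (-1))ᶜ ∩ (VC 1 (3 * k - 1) (-(3 * k - 1)) (-(2 * k)))ᶜ)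

/-- The clusters of the square. -/
def innerClusters (k : ℤ) (ω : Config SqE) : Set (ℤ × ℤ) :=
  {v | ∃ u ∈ Box k (2 * k) (-(2 * k)) (-k), OConn ω (Box 1 (3 * k - 1) (-(3 * k - 1)) (-1)) u v}

lemma innerClusters_closed {k : ℤ} (hk : 2 ≤ k) {ω : Config SqE} (hω : ω ∈ blocking k)
    {u v : ℤ × ℤ} (huv : OAdj ω u v) (hu : u ∈ innerClusters k ω) : v ∈ innerClusters k ω := by
  obtain ⟨w, hw, hwu⟩ := hu
  have hub := hwu.right_mem
  by_cases hv : v ∈ Box 1 (3 * k - 1) (-(3 * k - 1)) (-1)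
  · exact ⟨w, hw, hwu.trans (Conn.single huv hub hv)⟩
  exfalso
  obtain ⟨⟨h1, h2⟩, h3, h4⟩ := hω
  have e1 := huv.lAdj.fst_le
  have e2 := huv.symm.lAdj.fst_le
  have e3 := huv.lAdj.snd_le
  have e4 := huv.symm.lAdj.snd_le
  rw [mem_box] at hub hw hv
  have hcases : u.1 = 3 * k - 1 ∨ u.1 = 1 ∨ u.2 = -1 ∨ u.2 = -(3 * k - 1) := by omega
  rcases hcases with h | h | h | h
  · obtain ⟨a, b, ha, hb, hab⟩ := hwu.cross_fst (a := 2 * k) (b := 3 * k - 1) (by omega) (by omega)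
      (by omega)
    refine h1 (mem_HC.2 ⟨a, b, ha, hb, hab.mono fun x hx => ?_⟩)
    have := hx.1
    have := hx.2
    simp only [mem_box, mem_ofPred_eq] at *
    omega
  · obtain ⟨a, b, ha, hb, hab⟩ := OConn.cross_fst hwu.symm (a := 1) (b := k) (by omega) (by omega)
      (by omega)
    refine h2 (mem_HC.2 ⟨a, b, ha, hb, hab.mono fun x hx => ?_⟩)
    have := hx.1
    have := hx.2
    simp only [mem_box, mem_ofPred_eq] at *
    omega
  · obtain ⟨a, b, ha, hb, hab⟩ := hwu.cross_snd (a := -k) (b := -1) (by omega) (by omega)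
      (by omega)
    refine h3 (mem_VC.2 ⟨a, b, ha, hb, hab.mono fun x hx => ?_⟩)
    have := hx.1
    have := hx.2
    simp only [mem_box, mem_ofPred_eq] at *
    omega
  · obtain ⟨a, b, ha, hb, hab⟩ := OConn.cross_snd hwu.symm (a := -(3 * k - 1)) (b := -(2 * k))
      (by omega) (by omega) (by omega)
    refine h4 (mem_VC.2 ⟨a, b, ha, hb, hab.mono fun x hx => ?_⟩)
    have := hx.1
    have := hx.2
    simp only [mem_box, mem_ofPred_eq] at *
    omega

lemma not_escapes_of_blocking {k : ℕ} (hk : 2 ≤ k) {Z : ℕ} (hZ : 6 * k ≤ Z) {ω : Config SqE}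
    (hω : ω ∈ blocking k) :
    ¬ Escapes (exec ω (dTracks (-Z) (2 * Z + 2) (3 * k)) (armState k)) := by
  set C := innerClusters k ω with hCdef
  have hC : ∀ u v, OAdj ω u v → (u ∈ C ↔ v ∈ C) := fun u v h =>
    ⟨innerClusters_closed (by omega) hω h, innerClusters_closed (by omega) hω h.symm⟩
  have hCsub : ∀ v ∈ C, v ∈ Box 1 (3 * k - 1) (-(3 * k - 1)) (-1) := by
    rintro v ⟨u, -, h⟩
    exact h.right_mem
  obtain ⟨hs, ha⟩ := sweeps_dTracks (-Z) (2 * Z + 2) (3 * k)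
  have h0 : RespectsColor (vertexColor C (front (-Z) (2 * Z + 2) 0 (2 * Z + 2 : ℕ)))
      (armState k) := by
    have aux : ∀ x, vertexColor C (front (-Z) (2 * Z + 2) 0 (2 * Z + 2 : ℕ)) x ↔
        vertexColor C (front (-Z) (2 * Z + 2) 0 (2 * Z + 2 : ℕ)) (armMark k x) := by
      rintro (p | b)
      · simp only [armMark, Sum.elim_inl]
        split_ifs with h1 h2
        · simp only [vertexColor, Sum.elim_inl, Sum.elim_inr, h1.1, true_and, iff_true]
          have h3 := Int.even_iff.1 h1.1
          refine ⟨(p / 2, _), ?_, Conn.refl ?_⟩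
          · simp only [mem_box, front, level]
            push_cast
            split_ifs <;> omega
          · simp only [mem_box, front, level]
            push_cast
            split_ifs <;> omega
        · simp only [vertexColor, Sum.elim_inl, Sum.elim_inr, Bool.false_eq_true, iff_false]
          rintro ⟨-, h3⟩
          have := (hCsub _ h3).1
          simp only at this
          omega
        · rfl
      · rfl
    intro x y hxy
    rw [aux x, aux y, armState_iff.1 hxy]
  have h1 := h0.exec hC hs
  rw [ha] at h1
  rintro ⟨x, hx, hσ⟩
  have h2 := (h1 _ _ hσ).1 rfl
  rcases x with p | b
  · obtain ⟨h3, h4⟩ := h2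
    have h4 := hCsub _ h4
    rw [Int.even_iff] at h3
    simp only [mem_box, front, level] at h4
    push_cast at h4
    split_ifs at h4 <;> omega
  · have : b = true := h2
    exact hx (by rw [this])

lemma isotropic_half {P : Measure (Config SqE)} (h : IsCritical (1 / 2) P) : Isotropic P := by
  obtain ⟨Q, hQ, hQP⟩ := h.exists_swap_hc
  have e : ∀ a b : ℤ, hc Q a b = hc P a b := fun a b => by
    have h2 := hQ.law
    norm_num at h2
    have h1 := h.law
    norm_num at h1
    exact h2.real_eq h1 (fun e => by unfold sqInt; split_ifs <;> norm_num) (HC_isLocal _ _ _ _)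
  refine ⟨1, le_rfl, 1 / 2, by norm_num, 1, fun k hk => ?_⟩
  have := hQP k k hk hk
  rw [e] at this
  rw [one_mul]
  constructor <;> linarith

lemma blocking_prob : ∃ c : ℝ, 0 < c ∧ ∃ k₀ : ℤ, ∀ P, IsCritical (1 / 2) P → ∀ k, k₀ ≤ k →
    c ≤ P.real (blocking k) := by
  obtain ⟨P₀, hP₀⟩ := exists_isBernoulliProduct (sqInt (1 / 2) (1 - 1 / 2)) fun e => by
    unfold sqInt; split_ifs <;> norm_num
  have h₀ : IsCritical (1 / 2) P₀ := ⟨by norm_num, hP₀⟩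
  obtain ⟨c, hc0, n₀, hn⟩ := h₀.rsw (isotropic_half h₀) 5
  have huniv : ∀ P, IsCritical (1 / 2) P → ∀ a b, hc P a b = hc P₀ a b := fun P h a b =>
    h.law.real_eq hP₀ h.int_mem (HC_isLocal _ _ _ _)
  have key : ∀ P, IsCritical (1 / 2) P → ∀ k, max n₀ 2 + 1 ≤ k → c ≤ hc P (3 * k - 1) (k - 1) := by
    intro P h k hk
    have h1 := max_le_iff.1 (show max n₀ 2 ≤ k - 1 by omega)
    refine (hn (k - 1) h1.1).trans ?_
    rw [huniv P h]
    refine h₀.hc_anti (by omega) ?_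
    push_cast
    omega
  refine ⟨(c * c) * (c * c), by positivity, max n₀ 2 + 1, fun P h k hk => ?_⟩
  obtain ⟨Q, hQ, hQP⟩ := h.exists_swap_hc
  have hQ' : IsCritical (1 / 2) Q := by
    have := hQ
    norm_num at this ⊢
    exact this
  have hk2 : 3 ≤ k := by omega
  have p1 := key P h k hk
  have p2 := key Q hQ' k hk
  rw [hQP _ _ (by omega) (by omega)] at p2
  have hV : ∀ y₀ y₁ : ℤ, y₁ - y₀ = k - 1 → c ≤ P.real (VC 1 (3 * k - 1) y₀ y₁)ᶜ := by
    intro y₀ y₁ hy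
    rw [h.law.real_compl (VC_isLocal _ _ _ _), h.real_VC (by omega) (by omega), hy,
      show 3 * k - 1 - 1 + 1 = 3 * k - 1 by ring]
    linarith
  have hH : ∀ x₀ x₁ : ℤ, x₁ - x₀ = k - 1 → c ≤ P.real (HC x₀ x₁ (-(3 * k - 1)) (-1))ᶜ := by
    intro x₀ x₁ hx
    rw [h.law.real_compl (HC_isLocal _ _ _ _), h.real_HC, hx,
      show -1 - -(3 * k - 1) + 1 = 3 * k - 1 by ring]
    linarith
  have i1 := fun x₀ x₁ y₀ y₁ => (HC_isIncr x₀ x₁ y₀ y₁).compl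
  have i2 := fun x₀ x₁ y₀ y₁ => (VC_isIncr x₀ x₁ y₀ y₁).compl
  have l1 := fun x₀ x₁ y₀ y₁ => (HC_isLocal x₀ x₁ y₀ y₁).compl
  have l2 := fun x₀ x₁ y₀ y₁ => (VC_isLocal x₀ x₁ y₀ y₁).compl
  have a1 := h.law.harris_decr h.int_mem (l1 _ _ _ _) (l1 _ _ _ _) (i1 (2 * k) (3 * k - 1)
    (-(3 * k - 1)) (-1)) (i1 1 k (-(3 * k - 1)) (-1))
  have a2 := h.law.harris_decr h.int_mem (l2 _ _ _ _) (l2 _ _ _ _) (i2 1 (3 * k - 1) (-k) (-1))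
    (i2 1 (3 * k - 1) (-(3 * k - 1)) (-(2 * k)))
  have a3 := h.law.harris_decr h.int_mem ((l1 _ _ _ _).inter (l1 _ _ _ _))
    ((l2 _ _ _ _).inter (l2 _ _ _ _)) ((i1 (2 * k) (3 * k - 1)
    (-(3 * k - 1)) (-1)).inter (i1 1 k (-(3 * k - 1)) (-1))) ((i2 1 (3 * k - 1) (-k) (-1)).inter
    (i2 1 (3 * k - 1) (-(3 * k - 1)) (-(2 * k))))
  refine le_trans ?_ a3
  have b1 := mul_le_mul (hH (2 * k) (3 * k - 1) (by ring)) (hH 1 k rfl) hc0.le measureReal_nonneg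
  have b2 := mul_le_mul (hV (-k) (-1) (by ring)) (hV (-(3 * k - 1)) (-(2 * k)) (by ring)) hc0.le
    measureReal_nonneg
  exact mul_le_mul (b1.trans a1) (b2.trans a2) (by positivity) measureReal_nonneg

lemma blocking_depOn {k : ℤ} (hk : 2 ≤ k) :
    DepOn (edgesIn (Box 1 (3 * k - 1) (-(3 * k - 1)) (-1))) (blocking k) := by
  have aux : ∀ {R R' : Set (ℤ × ℤ)}, R ⊆ R' → edgesIn R ⊆ edgesIn R' := fun h e he =>
    ⟨h he.1, h he.2⟩
  refine (DepOn.inter (DepOn.mono (connEvent_depOn _ _ _).compl ?_)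
    (DepOn.mono (connEvent_depOn _ _ _).compl ?_)).inter
    (DepOn.inter (DepOn.mono (connEvent_depOn _ _ _).compl ?_)
    (DepOn.mono (connEvent_depOn _ _ _).compl ?_))
  all_goals exact aux (box_mono (by omega) (by omega) (by omega) (by omega))

lemma trackInt_half {q : ℝ} {k : ℤ} {e : SqE}
    (he : e ∈ edgesIn (Box 1 (3 * k - 1) (-(3 * k - 1)) (-1))) :
    trackInt q (cone (6 * k)) e = 1 / 2 := by
  obtain ⟨x, y, b⟩ := e
  obtain ⟨h1, h2⟩ := he
  have aux : ∀ c : ℤ, 1 ≤ c → c ≤ 6 * k → yCol q (cone (6 * k)) c = 1 / 2 := by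
    intro c h1 h2
    unfold yCol
    rw [if_pos, yUp]
    unfold cone
    split_ifs <;> omega
  cases b
  · simp only [esrc, etgt, mem_box, Bool.false_eq_true, if_false] at h1 h2
    simp only [trackInt, Bool.false_eq_true, if_false]
    rw [aux _ (by omega) (by omega)]
    norm_num
  · simp only [esrc, etgt, mem_box, if_true] at h1 h2
    simp only [trackInt, if_true]
    rw [aux _ (by omega) (by omega)]

/-- With probability bounded below, the first mark is isolated by the tracks. -/
theorem escapes_le : ∃ c : ℝ, 0 < c ∧ ∃ k₀ : ℕ, ∀ k : ℕ, k₀ ≤ k → ∀ q : ℝ, 0 < q → q < 1 / 2 →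
    ∀ Z : ℕ, 6 * k ≤ Z →
    run tl (tracks q (-Z) (2 * Z + 2) (cone (6 * k)) (3 * k)) ({σ | Escapes σ}.indicator fun _ => 1)
      (armState k) ≤ 1 - c := by
  obtain ⟨c, hc0, k₀, hk₀⟩ := blocking_prob
  refine ⟨c, hc0, max k₀.toNat 2, fun k hk q h0 hq Z hZ => ?_⟩
  obtain ⟨hk1, hk2⟩ := max_le_iff.1 hk
  obtain ⟨P, hP⟩ := exists_isBernoulliProduct _ (trackInt_mem h0 hq (cone (6 * k)))
  obtain ⟨P', hP'⟩ := exists_isBernoulliProduct (sqInt (1 / 2) (1 - 1 / 2)) fun e => by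
    unfold sqInt; split_ifs <;> norm_num
  have h' : IsCritical (1 / 2) P' := ⟨by norm_num, hP'⟩
  have := hP.1
  have hfin := edgesIn_finite (box_finite 1 (3 * (k : ℤ) - 1) (-(3 * k - 1)) (-1))
  have hdep : DepOn ((hfin.toFinset : Finset SqE) : Set SqE) (blocking k) := by
    rw [hfin.coe_toFinset]
    exact blocking_depOn (by omega)
  have e1 := hP.real_eq_of_agree (trackInt_mem h0 hq _) hP' h'.int_mem hdep fun e he => by
    rw [hfin.mem_toFinset] at he
    rw [trackInt_half he]
    unfold sqInt
    split_ifs <;> norm_num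
  have e2 := hk₀ P' h' k (by omega)
  rw [← e1] at e2
  rw [← stepsOf_dTracks, ← hP.real_exec (trackInt_mem h0 hq _) (dTracks_nodup _ _ _)]
  have hloc : IsLocal (blocking k) := ⟨_, hdep⟩
  have e3 := hP.real_compl hloc
  have e4 : P.real {ω | exec ω (dTracks (-Z) (2 * Z + 2) (3 * k)) (armState k) ∈
      {σ | Escapes σ}} ≤ P.real (blocking k)ᶜ :=
    measureReal_mono (fun ω hω hb => not_escapes_of_blocking hk2 hZ hb hω) (measure_ne_top _ _)
  linarith

end Marks

section Persistence

lemma run_indicator_le {l : List (ℤ × ℝ)} (hl : ProbSteps l) {A : Set State}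
    (hA : ∀ j σ, tl j σ ∈ A → σ ∈ A) (σ : State) :
    run tl l (A.indicator fun _ => 1) σ ≤ A.indicator (fun _ => 1) σ := by
  classical
  by_cases hσ : σ ∈ A
  · rw [indicator_of_mem hσ]
    exact run_le_one hl (fun s => by rw [indicator_apply]; split_ifs <;> norm_num) σ
  · rw [indicator_of_notMem hσ]
    refine (run_mono_of_inv (g := fun _ => 0) (· ∉ A) (fun x _ s hs h => hs (hA _ _ h)) hl
      (fun s hs => by rw [indicator_of_notMem hs]) hσ).trans ?_
    rw [run_const]

lemma indicator_le_run {l : List (ℤ × ℝ)} (hl : ProbSteps l) {A : Set State}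
    (hA : ∀ j σ, σ ∈ A → tl j σ ∈ A) (σ : State) :
    A.indicator (fun _ => 1) σ ≤ run tl l (A.indicator fun _ => 1) σ := by
  classical
  by_cases hσ : σ ∈ A
  · rw [indicator_of_mem hσ]
    refine le_trans (by rw [run_const]) (run_mono_of_inv (f := fun _ => 1) (· ∈ A)
      (fun x _ s hs => hA _ _ hs) hl (fun s hs => by rw [indicator_of_mem hs]) hσ)
  · rw [indicator_of_notMem hσ]
    exact run_nonneg hl (fun s => by rw [indicator_apply]; split_ifs <;> norm_num) σ

lemma Escapes.of_tl {j : ℤ} {σ : State} (h : Escapes (tl j σ)) : Escapes σ := by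
  obtain ⟨x, hx, hσ⟩ := h
  by_cases hj : Even j
  · rw [tl_even hj, isolate_iff] at hσ
    rcases hσ with h1 | h1
    · exact absurd h1.symm hx
    · exact ⟨x, hx, h1.1⟩
  · rw [tl_odd hj, merge_iff] at hσ
    rcases hσ with h1 | ⟨h1, -⟩ | ⟨h1, -⟩
    · exact ⟨x, hx, h1⟩
    · exact ⟨_, by simp, h1⟩
    · exact ⟨_, by simp, h1⟩

lemma tl_marks {j : ℤ} {σ : State} {b c : Bool} (h : σ (.inr b) (.inr c)) :
    tl j σ (.inr b) (.inr c) := by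
  by_cases hj : Even j
  · rw [tl_even hj, isolate_iff]
    exact Or.inr ⟨h, by simp, by simp⟩
  · rw [tl_odd hj]
    exact le_merge _ _ _ h

end Persistence

section Arms

open Classical in
/-- The two arms of the cone are attached to the marks. -/
noncomputable def armVertex (k : ℤ) : (ℤ × ℤ) ⊕ Bool → (ℤ × ℤ) ⊕ Bool :=
  Sum.elim (fun v => if v.2 = v.1 ∧ k ≤ v.1 ∧ v.1 ≤ 2 * k then .inr true
    else if v.2 = -v.1 ∧ -(2 * k) ≤ v.1 ∧ v.1 ≤ -k then .inr false else .inl v) .inr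

lemma armVertex_dominates {k : ℤ} (hk : 1 ≤ k) :
    Dominates (fun u => cone (6 * k) (2 * u) / 2) (armState k) (Setoid.ker (armVertex k)) := by
  constructor
  · have aux : ∀ x, armMark k (tag x) = Sum.map (fun v => 2 * v.1) id
        (armVertex k (place (fun u => cone (6 * k) (2 * u) / 2) x)) := by
      rintro (u | b)
      · have he : Even (2 * u) := even_two_mul u
        simp only [tag, place, Sum.map_inl, armMark, armVertex, Sum.elim_inl, cone, he, true_and]
        split_ifs <;> first | rfl | (exfalso; omega)
      · rfl
    intro x y hxy
    rw [armState_iff, aux, aux]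
    exact congrArg _ hxy
  · intro u y hy b hb
    have h1 : armVertex k (.inl (u, y)) = .inl (u, y) := by
      simp only [armVertex, Sum.elim_inl]
      simp only [cone] at hy
      rw [if_neg, if_neg]
      all_goals
        split_ifs at hy <;> omega
    have h2 : armVertex k b = .inl (u, y) := by rw [← h1]; exact (Eq.symm hb)
    rcases b with v | b
    · simp only [armVertex, Sum.elim_inl] at h2
      split_ifs at h2
      exact h2
    · simp [armVertex] at h2

/-- The part of the cone which is explored by the layers below height `Y`. -/
def coneRegion (k Y : ℤ) : Set (ℤ × ℤ) :=
  {v | -v.2 ≤ v.1 ∧ v.1 ≤ v.2 ∧ -(2 * k) ≤ v.1 ∧ v.1 ≤ 2 * k ∧ v.2 ≤ Y}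

lemma mem_layers {k Y Z : ℤ} (hk : 1 ≤ k) (hY : 3 * k ≤ Y) (hZ : 2 * Y + 6 * k ≤ Z) {s : ℕ}
    (hs : (s : ℤ) = 2 * Y - 1) {e : SqE} (h1 : esrc e ∈ coneRegion k (Y - 1))
    (h2 : etgt e ∈ coneRegion k Y) :
    ∃ p, (p, e) ∈ abList (cone (6 * k)) (prog (6 * k) Z s) := by
  have hpar : ∀ p, (cone (6 * k) p - p) % 2 = 0 := cone_parity (by omega)
  have hsp := (profile_spec (m := 6 * k) (Z := Z) (by omega) (by omega) s).1
  have hw : width (6 * k) Z s = Z - (s - (6 * k - 1)) := by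
    unfold width
    rw [if_neg (by omega)]
  obtain ⟨x, y, b⟩ := e
  simp only [coneRegion, mem_ofPred_eq, esrc, etgt] at h1 h2
  cases b
  · simp only [Bool.false_eq_true, if_false] at h1 h2
    refine ⟨2 * x, (mem_abList hpar).2 ⟨2 * y, ?_, ?_, by simp only; omega, ?_⟩⟩
    · simp only [cone]
      split_ifs <;> omega
    · have := hsp (2 * x) (by omega)
      change _ < profile _ _ _ _
      rw [this]
      split_ifs <;> omega
    · simp only [abEdge]
      rw [if_pos (by omega)]
      simp
  · simp only [if_true] at h1 h2
    refine ⟨2 * x + 1, (mem_abList hpar).2 ⟨2 * y - 1, ?_, ?_, by simp only; omega, ?_⟩⟩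
    · simp only [cone]
      split_ifs <;> omega
    · have := hsp (2 * x + 1) (by omega)
      change _ < profile _ _ _ _
      rw [this]
      split_ifs <;> omega
    · simp only [abEdge]
      rw [if_neg (by omega)]
      have e1 : (2 * x + 1) / 2 = x := by omega
      have e2 : (2 * y - 1 + 1) / 2 = y := by omega
      rw [e1, e2]

/-- The layers detect the connections of the configuration inside the cone. -/
lemma layers_dominate {k Y Z : ℤ} (hk : 1 ≤ k) (hY : 3 * k ≤ Y) (hZ : 2 * Y + 6 * k ≤ Z) {s : ℕ}
    (hs : (s : ℤ) = 2 * Y - 1) (ω : Config SqE) :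
    ∃ S' : Setoid ((ℤ × ℤ) ⊕ Bool),
      (∀ x y, S' (place (fun u => profile (6 * k) Z s (2 * u) / 2) x)
        (place (fun u => profile (6 * k) Z s (2 * u) / 2) y) →
        exec ω (abList (cone (6 * k)) (prog (6 * k) Z s)) (armState k) (tag x) (tag y)) ∧
      (∀ x y, armVertex k x = armVertex k y → S' x y) ∧
      (∀ u v, OAdj ω u v → u ∈ coneRegion k (Y - 1) → v ∈ coneRegion k Y → S' (.inl u) (.inl v)) ∧
      ∀ R ⊆ coneRegion k (Y - 1), ∀ u v, OConn ω R u v → S' (.inl u) (.inl v) := by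
  have hpar : ∀ p, (cone (6 * k) p - p) % 2 = 0 := cone_parity (by omega)
  have hval := prog_valid (m := 6 * k) (Z := Z) (by omega) (by omega) (by omega) s
  obtain ⟨S', h1, h2, h3⟩ := (armVertex_dominates hk).exec (ω := ω) (sweeps_abList hpar hval)
  rw [advance_abList hpar] at h1
  have hstep : ∀ u v, OAdj ω u v → u ∈ coneRegion k (Y - 1) → v ∈ coneRegion k Y →
      S' (.inl u) (.inl v) := by
    rintro u v ⟨e, he, ⟨rfl, rfl⟩ | ⟨rfl, rfl⟩⟩ hu hv
    · obtain ⟨p, hp⟩ := mem_layers hk hY hZ hs hu hv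
      exact h3 _ hp he
    · have hmono : esrc e ∈ coneRegion k (Y - 1) ∧ etgt e ∈ coneRegion k Y := by
        obtain ⟨x, y, b⟩ := e
        cases b
        · simp only [coneRegion, mem_ofPred_eq, esrc, etgt, Bool.false_eq_true, if_false] at *
          omega
        · simp only [coneRegion, mem_ofPred_eq, esrc, etgt, if_true] at *
          omega
      obtain ⟨p, hp⟩ := mem_layers hk hY hZ hs hmono.1 hmono.2
      exact S'.symm' (h3 _ hp he)
  refine ⟨S', h1.1, fun x y hxy => h2 hxy, hstep, fun R hR u v h => ?_⟩
  induction h with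
  | refl h => exact S'.refl' _
  | tail h hvw hw ih =>
    refine S'.trans' ih (hstep _ _ hvw (hR h.right_mem) ?_)
    have := hR hw
    simp only [coneRegion, mem_ofPred_eq] at this ⊢
    omega

lemma armVertex_true {k : ℤ} {v : ℤ × ℤ} (h1 : v.2 = v.1) (h2 : k ≤ v.1) (h3 : v.1 ≤ 2 * k) :
    armVertex k (.inr true) = armVertex k (.inl v) := by
  simp [armVertex, h1, h2, h3]

lemma armVertex_false {k : ℤ} (hk : 1 ≤ k) {v : ℤ × ℤ} (h1 : v.2 = -v.1) (h2 : -(2 * k) ≤ v.1)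
    (h3 : v.1 ≤ -k) : armVertex k (.inr false) = armVertex k (.inl v) := by
  simp only [armVertex, Sum.elim_inr, Sum.elim_inl]
  rw [if_neg (by omega), if_pos ⟨h1, h2, h3⟩]

/-- A horizontal crossing connects the two marks. -/
lemma marks_of_HC {k Y Z : ℤ} (hk : 1 ≤ k) (hY : 3 * k ≤ Y) (hZ : 2 * Y + 6 * k ≤ Z) {s : ℕ}
    (hs : (s : ℤ) = 2 * Y - 1) {ω : Config SqE} (hω : ω ∈ HC (-(2 * k)) (2 * k) k (2 * k)) :
    exec ω (abList (cone (6 * k)) (prog (6 * k) Z s)) (armState k) (.inr true) (.inr false) := by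
  obtain ⟨S', h1, h2, -, h4⟩ := layers_dominate hk hY hZ hs ω
  obtain ⟨u, v, hu, hv, huv⟩ := mem_HC.1 hω
  have b1 := huv.left_mem
  have b2 := huv.right_mem
  rw [mem_box] at b1 b2
  obtain ⟨u', e1, c1, -⟩ := huv.cross_lower (fun x => x.1 + x.2) (fun a _ b _ hab => by
    rcases lAdj_iff.1 hab.lAdj with h | h | h | h <;> subst h <;> simp only <;> omega)
    (a := 0) (by omega) (by omega)
  have b3 := c1.left_mem.1
  rw [mem_box] at b3
  obtain ⟨v', e2, c2, -⟩ := c1.cross_upper (fun x => x.1 - x.2) (fun a _ b _ hab => by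
    rcases lAdj_iff.1 hab.lAdj with h | h | h | h <;> subst h <;> simp only <;> omega)
    (b := 0) (by omega) (by omega)
  have b4 := c2.right_mem.1.1
  rw [mem_box] at b4
  have e3 := h4 _ (fun x hx => by
    obtain ⟨⟨hx1, hx2⟩, hx3⟩ := hx
    simp only [coneRegion, mem_ofPred_eq, mem_box] at *
    omega) _ _ c2
  refine h1 (.inr true) (.inr false) ?_
  exact S'.trans' (h2 _ _ (armVertex_true (by omega) (by omega) (by omega)))
    (S'.trans' (S'.symm' e3) (h2 _ _ (armVertex_false hk (by omega) (by omega) (by omega)).symm))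

/-- A vertical crossing connects the first mark to the interface. -/
lemma alive_of_VC {k Y Z : ℤ} (hk : 1 ≤ k) (hY : 3 * k ≤ Y) (hZ : 2 * Y + 6 * k ≤ Z) {s : ℕ}
    (hs : (s : ℤ) = 2 * Y - 1) {ω : Config SqE} (hω : ω ∈ VC k (2 * k) k Y) :
    Alive (exec ω (abList (cone (6 * k)) (prog (6 * k) Z s)) (armState k)) := by
  obtain ⟨S', h1, h2, h3, h4⟩ := layers_dominate hk hY hZ hs ω
  obtain ⟨u, v, hu, hv, huv⟩ := mem_VC.1 hω
  have b1 := huv.left_mem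
  have b2 := huv.right_mem
  rw [mem_box] at b1 b2
  obtain ⟨u', e1, c1, -⟩ := huv.cross_lower (fun x => x.2 - x.1) (fun a _ b _ hab => by
    rcases lAdj_iff.1 hab.lAdj with h | h | h | h <;> subst h <;> simp only <;> omega)
    (a := 0) (by omega) (by omega)
  have b3 := c1.left_mem.1
  rw [mem_box] at b3
  rcases c1.first_visit {x | x.2 = Y} with c2 | ⟨w, hw, c2, rfl | ⟨w', c3, hw'⟩⟩
  · exact absurd hv c2.right_mem.2
  · simp only [mem_ofPred_eq] at hw
    omega
  simp only [mem_ofPred_eq] at hw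
  have hsub : (Box k (2 * k) k Y ∩ {x | 0 ≤ x.2 - x.1}) \ {x | x.2 = Y} ⊆
      coneRegion k (Y - 1) := by
    rintro x ⟨⟨hx1, hx2⟩, hx3⟩
    simp only [coneRegion, mem_ofPred_eq, mem_box] at *
    omega
  have e3 := h4 _ hsub _ _ c3
  have hwY : w ∈ coneRegion k Y := by
    obtain ⟨hx1, hx2⟩ := c2.left_mem
    simp only [coneRegion, mem_ofPred_eq, mem_box] at *
    omega
  have e4 := h3 _ _ hw' (hsub c3.right_mem) hwY
  have e5 := S'.trans' (h2 _ _ (armVertex_true (k := k) (v := u') (by omega) (by omega) (by omega)))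
    (S'.trans' e3 e4)
  have hprof : profile (6 * k) Z s (2 * w.1) / 2 = Y := by
    have hwid : width (6 * k) Z s = Z - (s - (6 * k - 1)) := by
      unfold width
      rw [if_neg (by omega)]
    simp only [coneRegion, mem_ofPred_eq] at hwY
    rw [(profile_spec (by omega) (by omega) s).1 (2 * w.1) (by omega)]
    split_ifs <;> omega
  refine ⟨2 * w.1, h1 (.inr true) (.inl w.1) ?_⟩
  have : place (fun u => profile (6 * k) Z s (2 * u) / 2) (.inl w.1) = .inl w := by
    simp only [place, Sum.map_inl, hprof, ← hw]
  rw [this]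
  exact e5

end Arms

section IsotropicCrossings

lemma isotropic_of_lt {ph : ℝ} {P : Measure (Config SqE)} (h : IsCritical ph P)
    (hlt : ph < 1 / 2) : Isotropic P := by
  classical
  have hprob := h.isProbabilityMeasure
  obtain ⟨h0, h1⟩ := h.mem
  obtain ⟨c, hc0, k₀, hesc⟩ := escapes_le
  obtain ⟨K, hK⟩ := survival_le_tracks h0 hlt (half_pos hc0)
  refine ⟨4 + 3 * K, by omega, c / 2, half_pos hc0, max k₀ 1 + 1, fun n hn => ?_⟩
  obtain ⟨k, rfl⟩ : ∃ k : ℕ, n = k + 1 := ⟨(n - 1).toNat, by omega⟩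
  have hk1 : 1 ≤ k := by omega
  have hk0 : k₀ ≤ k := by omega
  obtain ⟨Z₀, hZ₀⟩ := hK (3 * k) (6 * k - 1) (by omega) (by rw [Nat.odd_iff]; omega)
  have hcast : ((6 * k - 1 : ℕ) : ℤ) + 1 = 6 * (k : ℤ) := by omega
  set Y : ℤ := 3 * k + 3 * k * K with hYdef
  have hkK : (0 : ℤ) ≤ 3 * k * K := by positivity
  have hs : ((6 * k - 1 + 2 * (K * (3 * k)) : ℕ) : ℤ) = 2 * Y - 1 := by
    push_cast [Nat.cast_sub (show 1 ≤ 6 * k by omega)]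
    ring
  obtain ⟨Z, hZ1, hZ2⟩ : ∃ Z : ℕ, Z₀ ≤ Z ∧ 2 * Y + 6 * k ≤ (Z : ℤ) :=
    ⟨max Z₀ (2 * Y + 6 * k).toNat, le_max_left _ _, by omega⟩
  have hescZ := hesc k hk0 ph h0 hlt Z (by omega)
  have hsurv := hZ₀ Z hZ1 (armState k) (by
    rw [hcast]
    exact armState_inside (by omega))
  rw [hcast] at hsurv
  set s : ℕ := 6 * k - 1 + 2 * (K * (3 * k)) with hsdef
  have hpar : ∀ p, (cone (6 * k) p - p) % 2 = 0 := cone_parity (by omega)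
  have hlaw : ∀ B : Set State, P.real {ω | exec ω (abList (cone (6 * k)) (prog (6 * k) Z s))
      (armState k) ∈ B} =
      run tl (flips ph 0 (prog (6 * k) Z s)) (B.indicator fun _ => 1) (armState k) := fun B => by
    rw [h.law.real_exec h.int_mem (abList_nodup hpar _), stepsOf_abList]
  have hval := prog_valid (m := 6 * k) (Z := Z) (by omega) (by omega) (by omega) s
  have hfp : ∀ i, ProbSteps (flips ph i (prog (6 * k) Z s)) := fun i =>
    flips_prob h0.le h1.le i _
  have hCk : (k : ℤ) * K + k + k ≤ (4 + 3 * K) * (k + 1) ∧ 4 * (k : ℤ) ≤ (4 + 3 * K) * (k + 1) ∧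
      Y - k ≤ (4 + 3 * K) * (k + 1) := by
    have : (0 : ℤ) ≤ k * K := by positivity
    refine ⟨?_, ?_, ?_⟩ <;> nlinarith
  constructor
  · refine (h.hc_anti (a := 4 * k) (by omega) hCk.2.1).trans ?_
    have e1 := h.real_HC (-(2 * k)) (2 * k) k (2 * k)
    rw [show (2 * k - -(2 * k) : ℤ) = 4 * k by ring, show (2 * k - k + 1 : ℤ) = k + 1 by ring] at e1
    rw [← e1]
    set A : Set State := {σ | σ (.inr true) (.inr false)} with hA
    have hAF : ∀ σ, A.indicator (fun _ => (1 : ℝ)) σ ≤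
        ({σ | Escapes σ} : Set State).indicator (fun _ => (1 : ℝ)) σ := fun σ =>
      indicator_le_indicator_of_subset (show A ⊆ {σ | Escapes σ} from
        fun σ hσ => ⟨.inr false, by simp, hσ⟩)
        (fun _ => zero_le_one) σ
    have e2 : P.real (HC (-(2 * k)) (2 * k) k (2 * k)) ≤
        run tl (flips ph 0 (prog (6 * k) Z s)) (A.indicator fun _ => 1) (armState k) := by
      rw [← hlaw]
      exact measureReal_mono (fun ω hω => marks_of_HC (by omega) (by omega) hZ2 hs hω)
        (measure_ne_top _ _)
    refine e2.trans ?_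
    have e3 := run_mono (act := tl) (hfp 0) (indicator_le_run (A := A)
      (tracks_prob (lo := -Z) (n := 2 * Z + 2) (h := raises (cone (6 * k)) (prog (6 * k) Z s))
        h0 hlt (3 * k)) fun j σ => tl_marks) (armState k)
    refine e3.trans ?_
    rw [run_flips_tracks hlt (by
      rw [show (-(Z : ℤ) + (2 * Z + 2 : ℕ)) = Z + 2 by push_cast; ring]
      exact hval)]
    refine le_trans (run_mono (tracks_prob h0 hlt _) (fun σ => ?_) _)
      (hescZ.trans (show 1 - c ≤ 1 - c / 2 by linarith))
    exact (run_mono (hfp _) hAF σ).trans (run_indicator_le (hfp _) (fun j σ => Escapes.of_tl) σ)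
  · refine le_trans ?_ (h.hc_mono (b := Y - k) (by omega) hCk.2.2)
    have e1 := h.real_VC (x₀ := k) (x₁ := 2 * k) (y₀ := k) (y₁ := Y) (by omega) (by omega)
    rw [show (2 * k - k + 1 : ℤ) = k + 1 by ring] at e1
    have e2 : P.real (VC k (2 * k) k Y) ≤
        run tl (flips ph 0 (prog (6 * k) Z s)) alive (armState k) := by
      have : alive = ({σ | Alive σ} : Set State).indicator fun _ => 1 := by
        ext σ
        simp only [alive, indicator_apply, mem_ofPred_eq]
      rw [this, ← hlaw]
      exact measureReal_mono (fun ω hω => alive_of_VC (by omega) (by omega) hZ2 hs hω)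
        (measure_ne_top _ _)
    have e3 : run tl (tracks ph (-Z) (2 * Z + 2) (cone (6 * k)) (3 * k)) alive (armState k) ≤
        1 - c := by
      refine le_trans (run_mono (tracks_prob h0 hlt _) (fun σ => ?_) _) hescZ
      simp only [alive, indicator_apply, mem_ofPred_eq]
      split_ifs with g1 g2 g2
      · exact le_rfl
      · obtain ⟨p, hp⟩ := g1
        exact absurd ⟨.inl p, by simp, hp⟩ g2
      · norm_num
      · exact le_rfl
    linarith

/-- Crossings of boxes of bounded aspect ratio, in either direction, have probability bounded
away from `0` and `1`. -/
theorem IsCritical.isotropic {ph : ℝ} {P : Measure (Config SqE)} (h : IsCritical ph P) :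
    Isotropic P := by
  rcases lt_trichotomy ph (1 / 2) with hlt | rfl | hlt
  · exact isotropic_of_lt h hlt
  · exact isotropic_half h
  · obtain ⟨Q, hQ, hQP⟩ := h.exists_swap_hc
    obtain ⟨C, hC, c, hc0, k₀, hk⟩ := isotropic_of_lt hQ (by linarith)
    refine ⟨C, hC, c, hc0, max k₀ 1, fun k hkk => ?_⟩
    obtain ⟨h1, h2⟩ := max_le_iff.1 hkk
    have h3 : 1 ≤ C * k := by nlinarith
    obtain ⟨h4, h5⟩ := hk k h1
    rw [hQP _ _ h3 h2] at h4
    rw [hQP _ _ h2 h3] at h5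
    constructor <;> linarith

end IsotropicCrossings

section Tubes

lemma OConn.meet_of_cross {ω : Config SqE} {u v b t : ℤ × ℤ}
    {x₀ x₁ y₀ y₁ X₀ X₁ Y₀ Y₁ : ℤ} (hx : x₀ ≤ x₁) (hy : y₀ ≤ y₁)
    (h1 : OConn ω (Box X₀ X₁ y₀ y₁) u v) (h2 : OConn ω (Box x₀ x₁ Y₀ Y₁) b t)
    (hu : u.1 ≤ x₀) (hv : x₁ ≤ v.1) (hb : b.2 ≤ y₀) (ht : y₁ ≤ t.2) :
    OConn ω (Box X₀ X₁ Y₀ Y₁) u b := by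
  have hu' := h1.left_mem
  have hv' := h1.right_mem
  have hb' := h2.left_mem
  have ht' := h2.right_mem
  rw [mem_box] at hu' hv' hb' ht'
  obtain ⟨u', hu', h3, h4⟩ := Conn.cross_lower h1 Prod.fst
    (fun _ _ _ _ h => h.lAdj.fst_le) hu (hx.trans hv)
  obtain ⟨v', hv', h5, -⟩ := Conn.cross_upper h3 Prod.fst
    (fun _ _ _ _ h => h.lAdj.fst_le) (b := x₁) (by omega) hv
  obtain ⟨b', hb', h6, h7⟩ := Conn.cross_lower h2 Prod.snd
    (fun _ _ _ _ h => h.lAdj.snd_le) hb (hy.trans ht)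
  obtain ⟨t', ht', h8, -⟩ := Conn.cross_upper h6 Prod.snd
    (fun _ _ _ _ h => h.lAdj.snd_le) (b := y₁) (by omega) ht
  have A : OConn ω (Box x₀ x₁ y₀ y₁) u' v' := h5.mono fun w hw =>
    ⟨hw.1.2, hw.2, hw.1.1.2.2.1, hw.1.1.2.2.2⟩
  have B : OConn ω (Box x₀ x₁ y₀ y₁) b' t' := h8.mono fun w hw =>
    ⟨hw.1.1.1, hw.1.1.2.1, hw.1.2, hw.2⟩
  have h9 := OConn.meet A B hu' hv' hb' ht'
  refine (h4.mono (box_mono ?_ ?_ ?_ ?_)).trans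
    ((h9.mono (box_mono ?_ ?_ ?_ ?_)).trans ((OConn.symm h7).mono (box_mono ?_ ?_ ?_ ?_))) <;> omega

/-- The cell of mesh `n` at `z` is crossed by two rectangles of aspect ratio `2`. -/
def Cell (n : ℤ) (z : ℤ × ℤ) : Set (Config SqE) :=
  HC (z.1 * n) (z.1 * n + 2 * n) (z.2 * n) (z.2 * n + n) ∩
    VC (z.1 * n) (z.1 * n + n) (z.2 * n) (z.2 * n + 2 * n)

/-- `u` is the lower end of a vertical crossing of the cell at `z`. -/
def Rep (ω : Config SqE) (n : ℤ) (z u : ℤ × ℤ) : Prop :=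
  ∃ t : ℤ × ℤ, u.2 = z.2 * n ∧ t.2 = z.2 * n + 2 * n ∧
    OConn ω (Box (z.1 * n) (z.1 * n + n) (z.2 * n) (z.2 * n + 2 * n)) u t

lemma exists_rep {ω : Config SqE} {n : ℤ} {z : ℤ × ℤ} (h : ω ∈ Cell n z) : ∃ u, Rep ω n z u := by
  obtain ⟨u, t, hu, ht, hut⟩ := mem_VC.1 h.2
  exact ⟨u, t, hu, ht, hut⟩

lemma cell_isLocal (n : ℤ) (z : ℤ × ℤ) : IsLocal (Cell n z) :=
  (HC_isLocal _ _ _ _).inter (VC_isLocal _ _ _ _)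

lemma cell_isIncr (n : ℤ) (z : ℤ × ℤ) : IsIncr (Cell n z) :=
  (HC_isIncr _ _ _ _).inter (VC_isIncr _ _ _ _)

lemma Rep.conn_right {ω : Config SqE} {n a b : ℤ} {u u' : ℤ × ℤ} (hn : 0 ≤ n)
    (hz : ω ∈ Cell n (a, b)) (hu : Rep ω n (a, b) u) (hu' : Rep ω n (a + 1, b) u') :
    OConn ω (Box (a * n) (a * n + 2 * n) (b * n) (b * n + 2 * n)) u u' := by
  obtain ⟨x, y, hx, hy, hxy⟩ := mem_HC.1 hz.1
  obtain ⟨t, h1, h2, h3⟩ := hu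
  obtain ⟨t', h1', h2', h3'⟩ := hu'
  simp only [add_mul, one_mul] at *
  have c1 := OConn.meet_of_cross (by omega) (by omega) hxy h3 (by omega) (by omega)
    (by omega) (by omega)
  have c2 := OConn.meet_of_cross (by omega) (by omega) hxy h3' (by omega) (by omega)
    (by omega) (by omega)
  exact c1.symm.trans c2

lemma Rep.conn_up {ω : Config SqE} {n a b : ℤ} {u u' : ℤ × ℤ} (hn : 0 ≤ n)
    (hz : ω ∈ Cell n (a, b + 1)) (hu : Rep ω n (a, b) u) (hu' : Rep ω n (a, b + 1) u') :
    OConn ω (Box (a * n) (a * n + 2 * n) (b * n) (b * n + 3 * n)) u u' := by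
  obtain ⟨x, y, hx, hy, hxy⟩ := mem_HC.1 hz.1
  obtain ⟨t, h1, h2, h3⟩ := hu
  obtain ⟨t', h1', h2', h3'⟩ := hu'
  simp only [add_mul, one_mul] at *
  have c1 := OConn.meet_of_cross (by omega) (by omega) hxy h3 (by omega) (by omega)
    (by omega) (by omega)
  have c2 := OConn.meet_of_cross (by omega) (by omega) hxy h3' (by omega) (by omega)
    (by omega) (by omega)
  refine (c1.symm.mono (box_mono ?_ ?_ ?_ ?_)).trans (c2.mono (box_mono ?_ ?_ ?_ ?_)) <;> omega

lemma Rep.conn_step {ω : Config SqE} {n : ℤ} {z z' u u' : ℤ × ℤ} (hn : 0 ≤ n)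
    (hcell : ∀ d ∈ (Finset.Icc (-1) 1 : Finset ℤ) ×ˢ (Finset.Icc (-1) 1 : Finset ℤ),
      ω ∈ Cell n (z + d))
    (h1 : |z'.1 - z.1| ≤ 1) (h2 : |z'.2 - z.2| ≤ 1)
    (hu : Rep ω n z u) (hu' : Rep ω n z' u') :
    OConn ω (Box (z.1 * n - n) (z.1 * n + 3 * n) (z.2 * n - n) (z.2 * n + 3 * n)) u u' := by
  obtain ⟨a, b⟩ := z
  obtain ⟨a', b'⟩ := z'
  have hcell' : ∀ x y, a - 1 ≤ x → x ≤ a + 1 → b - 1 ≤ y → y ≤ b + 1 → ω ∈ Cell n (x, y) := by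
    intro x y _ _ _ _
    have := hcell (x - a, y - b) (by simp only [Finset.mem_product, Finset.mem_Icc]; omega)
    simpa using this
  simp only [abs_le] at h1 h2 ⊢
  obtain ⟨m, hm⟩ := exists_rep (hcell' a' b (by omega) (by omega) (by omega) (by omega))
  have A : OConn ω (Box (a * n - n) (a * n + 3 * n) (b * n - n) (b * n + 3 * n)) u m := by
    have e : (a - 1) * n = a * n - n := by ring
    obtain rfl | rfl | rfl : a' = a - 1 ∨ a' = a ∨ a' = a + 1 := by omega
    · have := Rep.conn_right hn (hcell' (a - 1) b (by omega) (by omega) (by omega) (by omega)) hm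
        (by simpa using hu)
      refine (this.symm).mono (box_mono ?_ ?_ ?_ ?_) <;> omega
    · obtain ⟨l, hl⟩ := exists_rep (hcell' (a' + 1) b (by omega) (by omega) (by omega) (by omega))
      have hz := hcell' a' b (by omega) (by omega) (by omega) (by omega)
      have := (Rep.conn_right hn hz hu hl).trans (Rep.conn_right hn hz hm hl).symm
      refine this.mono (box_mono ?_ ?_ ?_ ?_) <;> omega
    · have := Rep.conn_right hn (hcell' a b (by omega) (by omega) (by omega) (by omega)) hu hm
      refine this.mono (box_mono ?_ ?_ ?_ ?_) <;> omega
  have B : OConn ω (Box (a * n - n) (a * n + 3 * n) (b * n - n) (b * n + 3 * n)) m u' := by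
    have hX : a * n - n ≤ a' * n ∧ a' * n ≤ a * n + n := by constructor <;> nlinarith
    have e : (b - 1) * n = b * n - n := by ring
    obtain rfl | rfl | rfl : b' = b - 1 ∨ b' = b ∨ b' = b + 1 := by omega
    · have := Rep.conn_up hn (hcell' a' (b - 1 + 1) (by omega) (by omega) (by omega) (by omega))
        hu' (by simpa using hm)
      refine (this.symm).mono (box_mono ?_ ?_ ?_ ?_) <;> omega
    · obtain ⟨l, hl⟩ := exists_rep (hcell' a' (b' + 1) (by omega) (by omega) (by omega) (by omega))
      have hz := hcell' a' (b' + 1) (by omega) (by omega) (by omega) (by omega)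
      have := (Rep.conn_up hn hz hm hl).trans (Rep.conn_up hn hz hu' hl).symm
      refine this.mono (box_mono ?_ ?_ ?_ ?_) <;> omega
    · have := Rep.conn_up hn (hcell' a' (b + 1) (by omega) (by omega) (by omega) (by omega)) hm hu'
      refine this.mono (box_mono ?_ ?_ ?_ ?_) <;> omega
  exact A.trans B

lemma IsCritical.exists_cell_bound {ph : ℝ} {P : Measure (Config SqE)} (h : IsCritical ph P) :
    ∃ c : ℝ, 0 < c ∧ ∃ n₀ : ℤ, 1 ≤ n₀ ∧ ∀ n, n₀ ≤ n → ∀ z, c ≤ P.real (Cell n z) := by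
  obtain ⟨c, hc0, n₀, hn₀⟩ := h.rsw h.isotropic 2
  obtain ⟨Q, hQ, hQP⟩ := h.exists_swap_hc
  obtain ⟨c', hc0', n₁, hn₁⟩ := hQ.rsw hQ.isotropic 2
  refine ⟨c * c', mul_pos hc0 hc0', max (max n₀ n₁) 1, le_max_right _ _, fun n hn z => ?_⟩
  simp only [max_le_iff] at hn
  have e1 := hn₀ n hn.1.1
  have e2 := hn₁ n hn.1.2
  push_cast at e1 e2
  have e3 : c ≤ P.real (HC (z.1 * n) (z.1 * n + 2 * n) (z.2 * n) (z.2 * n + n)) := by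
    rw [h.real_HC]
    refine e1.trans ((h.hc_mono (b' := n + 1) (by omega) (by omega)).trans_eq ?_)
    congr 1 <;> ring
  have e4 : c' ≤ P.real (VC (z.1 * n) (z.1 * n + n) (z.2 * n) (z.2 * n + 2 * n)) := by
    rw [h.real_VC (by omega) (by omega)]
    have e5 := hQP (2 * n) (n + 1) (by omega) (by omega)
    have e6 := hQ.hc_mono (a := 2 * n) (b := n) (b' := n + 1) (by omega) (by omega)
    rw [show z.1 * n + n - z.1 * n + 1 = n + 1 by ring,
      show z.2 * n + 2 * n - z.2 * n = 2 * n by ring, ← e5]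
    exact e2.trans e6
  exact (mul_le_mul e3 e4 hc0'.le (hc0.le.trans e3)).trans
    (h.law.harris h.int_mem (HC_isLocal _ _ _ _) (VC_isLocal _ _ _ _) (HC_isIncr _ _ _ _)
      (VC_isIncr _ _ _ _))

lemma floor_div_mul_mem {n : ℤ} (hn : 1 ≤ n) (x : ℝ) :
    (⌊x / n⌋ * n : ℝ) ≤ x ∧ x ≤ ⌊x / n⌋ * n + n := by
  have hn' : (0 : ℝ) < n := by exact_mod_cast (by omega : 0 < n)
  have h1 := Int.floor_le (x / n)
  have h2 := (Int.lt_floor_add_one (x / n)).le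
  rw [le_div_iff₀ hn'] at h1
  rw [div_le_iff₀ hn'] at h2
  exact ⟨h1, by linarith⟩

lemma floor_div_sub_le {n : ℤ} (hn : 1 ≤ n) {x y : ℝ} (h : |y - x| ≤ n) :
    |⌊y / n⌋ - ⌊x / n⌋| ≤ 1 := by
  have hn' : (0 : ℝ) < n := by exact_mod_cast (by omega : 0 < n)
  rw [abs_le] at h ⊢
  have h1 : y / n ≤ x / n + 1 := by
    rw [div_add_one hn'.ne']; exact (div_le_div_iff_of_pos_right hn').2 (by linarith)
  have h2 : x / n ≤ y / n + 1 := by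
    rw [div_add_one hn'.ne']; exact (div_le_div_iff_of_pos_right hn').2 (by linarith)
  have h3 := Int.floor_le_floor h1
  have h4 := Int.floor_le_floor h2
  rw [Int.floor_add_one] at h3 h4
  omega

/-- Open connections along a chain of points with steps at most `n`. -/
lemma IsCritical.exists_tube {ph : ℝ} {P : Measure (Config SqE)} (h : IsCritical ph P) (K : ℕ) :
    ∃ δ : ℝ, 0 < δ ∧ ∃ n₀ : ℤ, 1 ≤ n₀ ∧ ∀ n, n₀ ≤ n → ∀ p : ℕ → ℝ × ℝ,
      (∀ i < K, |(p (i + 1)).1 - (p i).1| ≤ n ∧ |(p (i + 1)).2 - (p i).2| ≤ n) →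
      ∃ E : Set (Config SqE), IsLocal E ∧ IsIncr E ∧ δ ≤ P.real E ∧ ∀ ω ∈ E, ∃ u v : ℤ × ℤ,
        OConn ω {w | ∃ i ≤ K, |w.1 - (p i).1| ≤ 3 * n ∧ |w.2 - (p i).2| ≤ 3 * n} u v ∧
        (|u.1 - (p 0).1| ≤ 3 * n ∧ |u.2 - (p 0).2| ≤ 3 * n) ∧
        (|v.1 - (p K).1| ≤ 3 * n ∧ |v.2 - (p K).2| ≤ 3 * n) := by
  obtain ⟨c, hc0, n₀, hn₀, hcell⟩ := h.exists_cell_bound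
  let D : Finset (ℤ × ℤ) := (Finset.Icc (-1) 1 : Finset ℤ) ×ˢ (Finset.Icc (-1) 1 : Finset ℤ)
  let S : Finset (ℕ × ℤ × ℤ) := Finset.range (K + 1) ×ˢ D
  refine ⟨c ^ S.card, pow_pos hc0 _, n₀, hn₀, fun n hn p hp => ?_⟩
  have hn1 : 1 ≤ n := hn₀.trans hn
  have hnR : (1 : ℝ) ≤ n := by exact_mod_cast hn1
  let z : ℕ → ℤ × ℤ := fun i => (⌊(p i).1 / n⌋, ⌊(p i).2 / n⌋)
  have near : ∀ i, ∀ w ∈ Box ((z i).1 * n - n) ((z i).1 * n + 3 * n) ((z i).2 * n - n)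
      ((z i).2 * n + 3 * n), |w.1 - (p i).1| ≤ 3 * n ∧ |w.2 - (p i).2| ≤ 3 * n := by
    intro i w hw
    obtain ⟨a1, a2, a3, a4⟩ := mem_box.1 hw
    obtain ⟨b1, b2⟩ := floor_div_mul_mem hn1 (p i).1
    obtain ⟨b3, b4⟩ := floor_div_mul_mem hn1 (p i).2
    have a1' : ((z i).1 * n - n : ℝ) ≤ w.1 := by exact_mod_cast a1
    have a2' : (w.1 : ℝ) ≤ (z i).1 * n + 3 * n := by exact_mod_cast a2
    have a3' : ((z i).2 * n - n : ℝ) ≤ w.2 := by exact_mod_cast a3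
    have a4' : (w.2 : ℝ) ≤ (z i).2 * n + 3 * n := by exact_mod_cast a4
    simp only [z] at a1' a2' a3' a4'
    simp only [abs_le]
    refine ⟨⟨?_, ?_⟩, ?_, ?_⟩ <;> linarith
  obtain ⟨g1, g2⟩ := h.law.harris_biInter h.int_mem S (A := fun s => Cell n (z s.1 + s.2))
    (fun s _ => cell_isLocal _ _) (fun s _ => cell_isIncr _ _)
  refine ⟨⋂ s ∈ S, Cell n (z s.1 + s.2), isLocal_biInter _ fun s _ => cell_isLocal _ _, g2, ?_, ?_⟩
  · refine le_trans ?_ g1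
    rw [← Finset.prod_const]
    exact Finset.prod_le_prod (fun _ _ => hc0.le) fun _ _ => hcell n hn _
  · intro ω hω
    have hω' : ∀ i ≤ K, ∀ d ∈ D, ω ∈ Cell n (z i + d) := by
      intro i hi d hd
      simp only [mem_iInter] at hω
      exact hω (i, d) (by simp only [S, Finset.mem_product, Finset.mem_range]; exact ⟨by omega, hd⟩)
    have hrep : ∀ i ≤ K, ∃ u, Rep ω n (z i) u := fun i hi =>
      exists_rep (by simpa using hω' i hi 0 (by simp [D]))
    have hin : ∀ i u, Rep ω n (z i) u → u ∈ Box ((z i).1 * n - n) ((z i).1 * n + 3 * n)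
        ((z i).2 * n - n) ((z i).2 * n + 3 * n) := by
      rintro i u ⟨t, -, -, h3⟩
      refine box_mono ?_ ?_ ?_ ?_ h3.left_mem <;> omega
    obtain ⟨u, hu⟩ := hrep 0 (by omega)
    obtain ⟨v, hv⟩ := hrep K le_rfl
    refine ⟨u, v, ?_, near 0 u (hin 0 u hu), near K v (hin K v hv)⟩
    have key : ∀ i ≤ K, ∀ v, Rep ω n (z i) v →
        OConn ω {w | ∃ i ≤ K, |w.1 - (p i).1| ≤ 3 * n ∧ |w.2 - (p i).2| ≤ 3 * n} u v := by
      intro i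
      induction i with
      | zero =>
        intro hi v hv
        have hs : OConn ω (Box ((z 0).1 * n - n) ((z 0).1 * n + 3 * n) ((z 0).2 * n - n)
            ((z 0).2 * n + 3 * n)) u v :=
          Rep.conn_step (z' := z 0) (by omega) (hω' 0 hi) (by simp) (by simp) hu hv
        exact hs.mono fun w hw => ⟨0, hi, near 0 w hw⟩
      | succ i ih =>
        intro hi v hv
        obtain ⟨m, hm⟩ := hrep i (by omega)
        obtain ⟨s1, s2⟩ := hp i (by omega)
        have d1 : |(z (i + 1)).1 - (z i).1| ≤ 1 := floor_div_sub_le hn1 s1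
        have d2 : |(z (i + 1)).2 - (z i).2| ≤ 1 := floor_div_sub_le hn1 s2
        have hs : OConn ω (Box ((z i).1 * n - n) ((z i).1 * n + 3 * n) ((z i).2 * n - n)
            ((z i).2 * n + 3 * n)) m v :=
          Rep.conn_step (by omega) (hω' i (by omega)) d1 d2 hm hv
        exact (ih (by omega) m hm).trans (hs.mono fun w hw => ⟨i, by omega, near i w hw⟩)
    exact key K le_rfl v hv

end Tubes

section Arcs

/-- The embedding of the vertices of the square lattice into the plane. -/
def emb (u : ℤ × ℤ) : Pt := ((u.1 : ℝ), (u.2 : ℝ))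

lemma sqLattice_ends (e : SqE) : sqLattice.ends e = (emb (esrc e), emb (etgt e)) := by
  obtain ⟨x, y, b⟩ := e
  cases b <;> simp [sqLattice, emb, esrc, etgt]

lemma OAdj.segment_subset {ω : Config SqE} {u v : ℤ × ℤ} (h : OAdj ω u v) :
    segment ℝ (emb u) (emb v) ⊆ openEdgeSet sqLattice ω := by
  obtain ⟨e, he, ⟨rfl, rfl⟩ | ⟨rfl, rfl⟩⟩ := h
  · intro z hz
    simp only [openEdgeSet, mem_iUnion]
    exact ⟨e, he, by rwa [sqLattice_ends]⟩
  · intro z hz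
    simp only [openEdgeSet, mem_iUnion]
    exact ⟨e, he, by rw [sqLattice_ends]; rwa [segment_symm] at hz⟩

lemma OAdj.segment_near {ω : Config SqE} {u v : ℤ × ℤ} (h : OAdj ω u v) {z : Pt}
    (hz : z ∈ segment ℝ (emb u) (emb v)) : |z.1 - v.1| ≤ 1 ∧ |z.2 - v.2| ≤ 1 := by
  have h1 : |(u.1 : ℝ) - v.1| ≤ 1 := by
    have h1 := h.lAdj.fst_le
    have h2 := h.symm.lAdj.fst_le
    rw [abs_le]; constructor
    · have : (v.1 : ℝ) ≤ u.1 + 1 := by exact_mod_cast h1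
      linarith
    · have : (u.1 : ℝ) ≤ v.1 + 1 := by exact_mod_cast h2
      linarith
  have h2 : |(u.2 : ℝ) - v.2| ≤ 1 := by
    have h1 := h.lAdj.snd_le
    have h2 := h.symm.lAdj.snd_le
    rw [abs_le]; constructor
    · have : (v.2 : ℝ) ≤ u.2 + 1 := by exact_mod_cast h1
      linarith
    · have : (u.2 : ℝ) ≤ v.2 + 1 := by exact_mod_cast h2
      linarith
  obtain ⟨a, b, ha, hb, hab, rfl⟩ := hz
  have ha1 : a ≤ 1 := by linarith
  obtain rfl : b = 1 - a := by linarith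
  simp only [emb, Prod.smul_mk, Prod.mk_add_mk, smul_eq_mul]
  constructor
  · rw [show a * (u.1 : ℝ) + (1 - a) * v.1 - v.1 = a * (u.1 - v.1) by ring, abs_mul,
      abs_of_nonneg ha]
    nlinarith [abs_nonneg ((u.1 : ℝ) - v.1)]
  · rw [show a * (u.2 : ℝ) + (1 - a) * v.2 - v.2 = a * (u.2 - v.2) by ring, abs_mul,
      abs_of_nonneg ha]
    nlinarith [abs_nonneg ((u.2 : ℝ) - v.2)]

/-- Lattice paths give arcs in the plane. -/
lemma OConn.joinedIn {ω : Config SqE} {R : Set (ℤ × ℤ)} {u v : ℤ × ℤ} (h : OConn ω R u v) :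
    u = v ∨ JoinedIn {z | z ∈ openEdgeSet sqLattice ω ∧
      ∃ w ∈ R, |z.1 - w.1| ≤ 1 ∧ |z.2 - w.2| ≤ 1} (emb u) (emb v) := by
  induction h with
  | refl _ => exact Or.inl rfl
  | @tail v w h1 h2 h3 ih =>
    have h4 : JoinedIn {z | z ∈ openEdgeSet sqLattice ω ∧
        ∃ w ∈ R, |z.1 - w.1| ≤ 1 ∧ |z.2 - w.2| ≤ 1} (emb v) (emb w) :=
      JoinedIn.of_segment_subset fun z hz =>
        ⟨h2.segment_subset hz, w, h3, h2.segment_near hz⟩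
    rcases ih with rfl | ih
    · exact Or.inr h4
    · exact Or.inr (ih.trans h4)

/-- An arc from below level `0` to above level `h` contains an arc from level `0` to level `h`
staying between these levels. -/
lemma exists_arc_between {F : Set Pt} {a b : Pt} (hab : JoinedIn F a b) {X : Pt → ℝ}
    (hX : Continuous X) {h : ℝ} (h0 : 0 ≤ h) (ha : X a ≤ 0) (hb : h ≤ X b) :
    ∃ γ : ℝ → Pt, ContinuousOn γ (Icc 0 1) ∧ X (γ 0) = 0 ∧ X (γ 1) = h ∧
      ∀ t ∈ Icc (0 : ℝ) 1, γ t ∈ F ∧ 0 ≤ X (γ t) ∧ X (γ t) ≤ h := by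
  obtain ⟨p, hp⟩ := hab
  let g : ℝ → Pt := p.extend
  have hg : Continuous g := p.continuous_extend
  have hgF : ∀ t, g t ∈ F := fun t => hp _
  have hφ : Continuous fun t => X (g t) := hX.comp hg
  have hg0 : X (g 0) ≤ 0 := by simpa [g] using ha
  have hg1 : h ≤ X (g 1) := by simpa [g] using hb
  have hT : ({t | X (g t) = h} ∩ Icc (0 : ℝ) 1).Nonempty := by
    obtain ⟨t, ht, hth⟩ := intermediate_value_Icc zero_le_one hφ.continuousOn
      (show h ∈ Icc (X (g 0)) (X (g 1)) from ⟨hg0.trans h0, hg1⟩)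
    exact ⟨t, hth, ht⟩
  have hTc : IsCompact ({t | X (g t) = h} ∩ Icc (0 : ℝ) 1) :=
    isCompact_Icc.inter_left (isClosed_eq hφ continuous_const)
  obtain ⟨t₁, ⟨ht₁, ht₁I⟩, hmin⟩ := hTc.exists_isLeast hT
  simp only [mem_ofPred_eq] at ht₁
  have hle : ∀ t ∈ Icc 0 t₁, X (g t) ≤ h := by
    intro t ht
    by_contra hlt
    push Not at hlt
    obtain ⟨s, hs, hsh⟩ := intermediate_value_Icc ht.1 hφ.continuousOn
      (show h ∈ Icc (X (g 0)) (X (g t)) from ⟨hg0.trans h0, hlt.le⟩)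
    have h1 : t₁ ≤ s := hmin ⟨hsh, hs.1, hs.2.trans (ht.2.trans ht₁I.2)⟩
    have h2 : t = t₁ := le_antisymm ht.2 (h1.trans hs.2)
    rw [h2, ht₁] at hlt
    exact lt_irrefl _ hlt
  have hS : ({t | X (g t) = 0} ∩ Icc (0 : ℝ) t₁).Nonempty := by
    obtain ⟨t, ht, hth⟩ := intermediate_value_Icc ht₁I.1 hφ.continuousOn
      (show 0 ∈ Icc (X (g 0)) (X (g t₁)) from ⟨hg0, h0.trans_eq ht₁.symm⟩)
    exact ⟨t, hth, ht⟩
  have hSc : IsCompact ({t | X (g t) = 0} ∩ Icc (0 : ℝ) t₁) :=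
    isCompact_Icc.inter_left (isClosed_eq hφ continuous_const)
  obtain ⟨t₀, ⟨ht₀, ht₀I⟩, hmax⟩ := hSc.exists_isGreatest hS
  simp only [mem_ofPred_eq] at ht₀
  have hge : ∀ t ∈ Icc t₀ t₁, 0 ≤ X (g t) := by
    intro t ht
    by_contra hlt
    push Not at hlt
    obtain ⟨s, hs, hsh⟩ := intermediate_value_Icc ht.2 hφ.continuousOn
      (show 0 ∈ Icc (X (g t)) (X (g t₁)) from ⟨hlt.le, h0.trans_eq ht₁.symm⟩)
    have h1 : s ≤ t₀ := hmax ⟨hsh, ht₀I.1.trans (ht.1.trans hs.1), hs.2⟩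
    have h2 : t = t₀ := le_antisymm (hs.1.trans h1) ht.1
    rw [h2, ht₀] at hlt
    exact lt_irrefl _ hlt
  refine ⟨fun t => g (t₀ + t * (t₁ - t₀)), by fun_prop, by simpa using ht₀, by simpa using ht₁, ?_⟩
  intro t ht
  have h3 := ht₀I.2
  have h1 : t₀ ≤ t₀ + t * (t₁ - t₀) := by nlinarith [ht.1]
  have h2 : t₀ + t * (t₁ - t₀) ≤ t₁ := by nlinarith [ht.2]
  exact ⟨hgF _, hge _ ⟨h1, h2⟩, hle _ ⟨ht₀I.1.trans h1, h2⟩⟩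

end Arcs

section Boxes

variable {ph : ℝ} {P : Measure (Config SqE)}

lemma abs_le_one_of_sq_add_sq {c s : ℝ} (h : c ^ 2 + s ^ 2 = 1) : |c| ≤ 1 ∧ |s| ≤ 1 :=
  ⟨abs_le_one_iff_mul_self_le_one.2 (by nlinarith), abs_le_one_iff_mul_self_le_one.2 (by nlinarith)⟩

lemma abs_comb_le {c s x y r : ℝ} (h : c ^ 2 + s ^ 2 = 1) (hx : |x| ≤ r) (hy : |y| ≤ r) :
    |c * x + s * y| ≤ 2 * r := by
  obtain ⟨h1, h2⟩ := abs_le_one_of_sq_add_sq h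
  calc |c * x + s * y| ≤ |c * x| + |s * y| := abs_add_le _ _
    _ = |c| * |x| + |s| * |y| := by rw [abs_mul, abs_mul]
    _ ≤ 1 * r + 1 * r := by gcongr
    _ = 2 * r := by ring

/-- A rectangle, in the orthonormal frame `(c, s)`, `(c', s')` based at `t`, is crossed in the
direction `(c, s)` with probability bounded below. -/
lemma IsCritical.exists_arc (h : IsCritical ph P) (K : ℕ) :
    ∃ δ : ℝ, 0 < δ ∧ ∃ n₀ : ℤ, 1 ≤ n₀ ∧ ∀ n, n₀ ≤ n → ∀ c s c' s' : ℝ, c ^ 2 + s ^ 2 = 1 →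
      c' ^ 2 + s' ^ 2 = 1 → c * c' + s * s' = 0 → ∀ (t : Pt) (H l : ℝ), 0 ≤ H → 16 * n ≤ l →
      H + 20 * n ≤ K * n →
      ∃ E : Set (Config SqE), IsLocal E ∧ IsIncr E ∧ δ ≤ P.real E ∧ ∀ ω ∈ E, ∃ γ : ℝ → Pt,
        ContinuousOn γ (Icc 0 1) ∧ c * ((γ 0).1 - t.1) + s * ((γ 0).2 - t.2) = 0 ∧
        c * ((γ 1).1 - t.1) + s * ((γ 1).2 - t.2) = H ∧
        ∀ τ ∈ Icc (0 : ℝ) 1, γ τ ∈ openEdgeSet sqLattice ω ∧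
          (0 ≤ c * ((γ τ).1 - t.1) + s * ((γ τ).2 - t.2) ∧
            c * ((γ τ).1 - t.1) + s * ((γ τ).2 - t.2) ≤ H) ∧
          (0 ≤ c' * ((γ τ).1 - t.1) + s' * ((γ τ).2 - t.2) ∧
            c' * ((γ τ).1 - t.1) + s' * ((γ τ).2 - t.2) ≤ l) := by
  obtain ⟨δ, hδ, n₀, hn₀, htube⟩ := h.exists_tube K
  refine ⟨δ, hδ, n₀, hn₀, fun n hn c s c' s' hcs hcs' horth t H l hH hl hK => ?_⟩
  have hnR : (1 : ℝ) ≤ n := by exact_mod_cast hn₀.trans hn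
  have hK0 : (0 : ℝ) < K := by
    rcases Nat.eq_zero_or_pos K with rfl | hK'
    · simp only [Nat.cast_zero, zero_mul] at hK; linarith
    · exact_mod_cast hK'
  let q : ℝ := (H + 20 * n) / K
  have hq0 : 0 ≤ q := by positivity
  have hqn : q ≤ n := by rw [div_le_iff₀ hK0]; linarith
  have hqK : K * q = H + 20 * n := by simp only [q]; field_simp
  let p : ℕ → ℝ × ℝ := fun i => (t.1 + (-10 * n + i * q) * c + l / 2 * c',
    t.2 + (-10 * n + i * q) * s + l / 2 * s')
  obtain ⟨a1, a2⟩ := abs_le_one_of_sq_add_sq hcs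
  have hstep : ∀ i < K, |(p (i + 1)).1 - (p i).1| ≤ n ∧ |(p (i + 1)).2 - (p i).2| ≤ n := by
    intro i _
    have e1 : (p (i + 1)).1 - (p i).1 = q * c := by simp only [p]; push_cast; ring
    have e2 : (p (i + 1)).2 - (p i).2 = q * s := by simp only [p]; push_cast; ring
    rw [e1, e2, abs_mul, abs_mul, abs_of_nonneg hq0]
    constructor <;> nlinarith
  obtain ⟨E, hE1, hE2, hE3, hE4⟩ := htube n hn p hstep
  refine ⟨E, hE1, hE2, hE3, fun ω hω => ?_⟩
  obtain ⟨u, v, huv, hu, hv⟩ := hE4 ω hω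
  have hXp : ∀ (z : Pt) i, c * (z.1 - t.1) + s * (z.2 - t.2) =
      (-10 * n + i * q) + (c * (z.1 - (p i).1) + s * (z.2 - (p i).2)) := by
    intro z i
    simp only [p]
    linear_combination (-10 * (n : ℝ) + i * q) * hcs + l / 2 * horth
  have hYp : ∀ (z : Pt) i, c' * (z.1 - t.1) + s' * (z.2 - t.2) =
      l / 2 + (c' * (z.1 - (p i).1) + s' * (z.2 - (p i).2)) := by
    intro z i
    simp only [p]
    linear_combination (-10 * (n : ℝ) + i * q) * horth + l / 2 * hcs'
  have hXu : c * ((emb u).1 - t.1) + s * ((emb u).2 - t.2) ≤ -4 * n := by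
    have h1 := hXp (emb u) 0
    have h2 := (abs_le.1 (abs_comb_le hcs hu.1 hu.2)).2
    simp only [emb] at h1 h2 ⊢
    rw [h1]; push_cast; linarith
  have hXv : H + 4 * n ≤ c * ((emb v).1 - t.1) + s * ((emb v).2 - t.2) := by
    have h1 := hXp (emb v) K
    have h2 := (abs_le.1 (abs_comb_le hcs hv.1 hv.2)).1
    simp only [emb] at h1 h2 ⊢
    rw [h1]; linarith
  rcases huv.joinedIn with rfl | hJ
  · linarith
  obtain ⟨γ, g1, g2, g3, g4⟩ := exists_arc_between hJ
    (X := fun z => c * (z.1 - t.1) + s * (z.2 - t.2)) (by fun_prop) hH (by linarith) (by linarith)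
  refine ⟨γ, g1, g2, g3, fun τ hτ => ?_⟩
  obtain ⟨⟨k1, w, ⟨i, hi, k2, k3⟩, k4, k5⟩, k6⟩ := g4 τ hτ
  refine ⟨k1, k6, ?_⟩
  have m1 : |(γ τ).1 - (p i).1| ≤ 4 * n := by
    rw [abs_le] at *; constructor <;> linarith
  have m2 : |(γ τ).2 - (p i).2| ≤ 4 * n := by
    rw [abs_le] at *; constructor <;> linarith
  have m3 := abs_le.1 (abs_comb_le hcs' m1 m2)
  rw [hYp (γ τ) i]
  constructor <;> linarith

lemma eq_rot_add (θ : ℝ) (t z : Pt) :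
    z = rot θ (Real.cos θ * (z.1 - t.1) + Real.sin θ * (z.2 - t.2),
      -Real.sin θ * (z.1 - t.1) + Real.cos θ * (z.2 - t.2)) + t := by
  have h := Real.sin_sq_add_cos_sq θ
  ext
  · simp only [rot, Prod.fst_add]
    linear_combination (-(z.1 - t.1)) * h
  · simp only [rot, Prod.snd_add]
    linear_combination (-(z.2 - t.2)) * h

theorem IsCritical.boxCrossingProperty (h : IsCritical ph P) :
    BoxCrossingProperty sqLattice P := by
  intro α hα
  have := h.isProbabilityMeasure
  obtain ⟨a, ha, haα, ha1⟩ : ∃ a : ℝ, 0 < a ∧ a ≤ α ∧ a ≤ 1 :=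
    ⟨min α 1, lt_min hα one_pos, min_le_left _ _, min_le_right _ _⟩
  obtain ⟨δ, hδ, n₀, hn₀, harc⟩ := h.exists_arc (⌈200 * (α + 1) / a⌉₊ + 20)
  refine ⟨δ * δ, mul_pos hδ hδ, ⌈(100 * n₀ + 200) / a⌉₊, fun N hN f hf => ?_⟩
  obtain ⟨θ, t, rfl⟩ := hf
  have hN' : 100 * n₀ + 200 ≤ N * a := by
    rw [← div_le_iff₀ ha]; exact (Nat.le_ceil _).trans (by exact_mod_cast hN)
  let n : ℤ := ⌊a * N / 100⌋
  have f1 : (n : ℝ) ≤ a * N / 100 := Int.floor_le _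
  have f2 : a * N / 100 < n + 1 := Int.lt_floor_add_one _
  have hn : n₀ ≤ n := Int.le_floor.2 (by linarith)
  have hn₀R : (1 : ℝ) ≤ n₀ := by exact_mod_cast hn₀
  have hnR : (1 : ℝ) ≤ n := by exact_mod_cast hn₀.trans hn
  have hN0 : (0 : ℝ) ≤ N := N.cast_nonneg
  have b1 : a * N ≤ α * N := by gcongr
  have b2 : a * N ≤ 1 * N := by gcongr
  have hK : (α + 1) * N + 20 * n ≤ ((⌈200 * (α + 1) / a⌉₊ + 20 : ℕ) : ℝ) * n := by
    have k1 : 200 * (α + 1) / a * n ≤ (⌈200 * (α + 1) / a⌉₊ : ℝ) * n := by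
      gcongr; exact Nat.le_ceil _
    have k2 : (α + 1) * N ≤ 200 * (α + 1) / a * n := by
      have k3 : N ≤ 200 * (n : ℝ) / a := by rw [le_div_iff₀ ha]; linarith
      calc (α + 1) * N ≤ (α + 1) * (200 * (n : ℝ) / a) := by gcongr
        _ = _ := by ring
    push_cast
    linarith
  have c1 := Real.sin_sq_add_cos_sq θ
  have b3 : 0 ≤ α * N := by positivity
  obtain ⟨E, hE1, hE2, hE3, hE4⟩ := harc n hn (Real.cos θ) (Real.sin θ) (-Real.sin θ) (Real.cos θ)
    (by linarith) (by linarith) (by ring) t (α * N) N b3 (by linarith) (by linarith)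
  obtain ⟨E', hE1', hE2', hE3', hE4'⟩ := harc n hn (-Real.sin θ) (Real.cos θ) (Real.cos θ)
    (Real.sin θ) (by linarith) (by linarith) (by ring) t N (α * N) hN0 (by linarith) (by linarith)
  have hsub : E ∩ E' ⊆ {ω | HasBoxCrossings sqLattice ω (α * N) N fun z => rot θ z + t} := by
    rintro ω ⟨hω, hω'⟩
    obtain ⟨γ, g1, g2, g3, g4⟩ := hE4 ω hω
    obtain ⟨γ', g1', g2', g3', g4'⟩ := hE4' ω hω'
    have u0 : (0 : ℝ) ∈ Icc (0 : ℝ) 1 := by simp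
    have u1 : (1 : ℝ) ∈ Icc (0 : ℝ) 1 := by simp
    constructor
    · exact ⟨γ, g1, ⟨_, ⟨g2, (g4 0 u0).2.2⟩, (eq_rot_add θ t _).symm⟩,
        ⟨_, ⟨g3, (g4 1 u1).2.2⟩, (eq_rot_add θ t _).symm⟩, fun τ hτ =>
        ⟨⟨_, ⟨(g4 τ hτ).2.1.1, (g4 τ hτ).2.1.2, (g4 τ hτ).2.2⟩, (eq_rot_add θ t _).symm⟩,
          (g4 τ hτ).1⟩⟩
    · exact ⟨γ', g1', ⟨_, ⟨g2', (g4' 0 u0).2.2⟩, (eq_rot_add θ t _).symm⟩,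
        ⟨_, ⟨g3', (g4' 1 u1).2.2⟩, (eq_rot_add θ t _).symm⟩, fun τ hτ =>
        ⟨⟨_, ⟨(g4' τ hτ).2.2.1, (g4' τ hτ).2.2.2, (g4' τ hτ).2.1⟩, (eq_rot_add θ t _).symm⟩,
          (g4' τ hτ).1⟩⟩
  have hprob : δ * δ ≤ P.real (E ∩ E') :=
    (mul_le_mul hE3 hE3' hδ.le (hδ.le.trans hE3)).trans
      (h.law.harris h.int_mem hE1 hE1' hE2 hE2')
  exact (ENNReal.ofReal_le_of_le_toReal hprob).trans (measure_mono hsub)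

end Boxes

/-- If `(ph, pv) ∈ (0,1)²` satisfies `κ_□(ph,pv) = 0`, then the
inhomogeneous bond percolation measure `P^□_{(ph,pv)}` on the square lattice has the
box-crossing property. -/
theorem square_inhomogeneous_box_crossing (ph pv : ℝ)
    (hph : ph ∈ Set.Ioo (0 : ℝ) 1) (hpv : pv ∈ Set.Ioo (0 : ℝ) 1)
    (hκ : kappaS ph pv = 0)
    (P : Measure (Config SqE)) (hP : IsBernoulliProduct (sqInt ph pv) P) :
    BoxCrossingProperty sqLattice P := by
  obtain rfl : pv = 1 - ph := by unfold kappaS at hκ; linarith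
  exact IsCritical.boxCrossingProperty ⟨hph, hP⟩

end Perc
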